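/- arXiv:2103.12108 — 2 statements merged into one kernel-verified Lean document; each statement's English description precedes it below -/
import Mathlib

section
/- Let f : ℂ → ℂ be holomorphic and injective on the open unit disc 𝔻 = {z ∈ ℂ : |z| < 1}, with f(0) = 0 and f'(0) = 1. Then for every integer n ≥ 2, the n-th Taylor coefficient bₙ = f⁽ⁿ⁾(0)/n! of f at 0 satisfies |bₙ| ≤ n. -/
namespace DeBranges

open Complex Metric Set Filter Topology
open scoped Nat

/-- The `n`-th Taylor coefficient of `f` at the origin. -/
noncomputable def taylorCoeff (f : ℂ → ℂ) (n : ℕ) : ℂ := iteratedDeriv n f 0 / (n ! : ℂ)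

section TaylorCoeff

variable {f g : ℂ → ℂ} {n : ℕ}

lemma taylorCoeff_zero : taylorCoeff f 0 = f 0 := by simp [taylorCoeff]

lemma taylorCoeff_congr (h : f =ᶠ[𝓝 0] g) : taylorCoeff f n = taylorCoeff g n := by
  unfold taylorCoeff
  rw [h.iteratedDeriv_eq]

lemma taylorCoeff_congr_ball (h : EqOn f g (ball 0 1)) : taylorCoeff f n = taylorCoeff g n :=
  taylorCoeff_congr (h.eventuallyEq_of_mem (ball_mem_nhds _ one_pos))

lemma taylorCoeff_add (hf : AnalyticAt ℂ f 0) (hg : AnalyticAt ℂ g 0) :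
    taylorCoeff (fun z => f z + g z) n = taylorCoeff f n + taylorCoeff g n := by
  unfold taylorCoeff
  rw [iteratedDeriv_fun_add hf.contDiffAt hg.contDiffAt, add_div]

lemma taylorCoeff_sub (hf : AnalyticAt ℂ f 0) (hg : AnalyticAt ℂ g 0) :
    taylorCoeff (fun z => f z - g z) n = taylorCoeff f n - taylorCoeff g n := by
  unfold taylorCoeff
  rw [iteratedDeriv_fun_sub hf.contDiffAt hg.contDiffAt, sub_div]

lemma taylorCoeff_const_mul (c : ℂ) :
    taylorCoeff (fun z => c * f z) n = c * taylorCoeff f n := by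
  unfold taylorCoeff
  rw [iteratedDeriv_const_mul_field, mul_div_assoc]

lemma taylorCoeff_const (c : ℂ) :
    taylorCoeff (fun _ => c) (n + 1) = 0 := by
  simp [taylorCoeff, iteratedDeriv_const]

lemma taylorCoeff_mul (hf : AnalyticAt ℂ f 0) (hg : AnalyticAt ℂ g 0) :
    taylorCoeff (fun z => f z * g z) n =
      ∑ i ∈ Finset.range (n + 1), taylorCoeff f i * taylorCoeff g (n - i) := by
  unfold taylorCoeff
  rw [iteratedDeriv_fun_mul hf.contDiffAt hg.contDiffAt, Finset.sum_div]
  refine Finset.sum_congr rfl fun i hi => ?_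
  have hi' : i ≤ n := Nat.lt_succ_iff.1 (Finset.mem_range.1 hi)
  have h := Nat.choose_mul_factorial_mul_factorial hi'
  have h' : ((n.choose i : ℕ) : ℂ) * (i ! : ℂ) * ((n - i)! : ℂ) = (n ! : ℂ) := by exact_mod_cast h
  have h1 : (i ! : ℂ) ≠ 0 := by exact_mod_cast i.factorial_ne_zero
  have h2 : ((n - i)! : ℂ) ≠ 0 := by exact_mod_cast (n - i).factorial_ne_zero
  have h3 : (n ! : ℂ) ≠ 0 := by exact_mod_cast n.factorial_ne_zero
  field_simp
  rw [← h']; ring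

lemma taylorCoeff_deriv :
    taylorCoeff (deriv f) n = (n + 1) * taylorCoeff f (n + 1) := by
  unfold taylorCoeff
  rw [iteratedDeriv_succ', Nat.factorial_succ]
  have h3 : (n ! : ℂ) ≠ 0 := by exact_mod_cast n.factorial_ne_zero
  have h4 : (n : ℂ) + 1 ≠ 0 := by exact_mod_cast n.succ_ne_zero
  push_cast
  field_simp

lemma taylorCoeff_id_mul (hf : AnalyticAt ℂ f 0) :
    taylorCoeff (fun z => z * f z) (n + 1) = taylorCoeff f n := by
  rw [taylorCoeff_mul (f := fun z => z) analyticAt_id hf, Finset.sum_eq_single 1]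
  · simp [taylorCoeff]
  · intro i _ hi
    have : taylorCoeff (fun z : ℂ => z) i = 0 := by
      unfold taylorCoeff
      rcases i with _ | _ | i
      · simp
      · simp at hi
      · rw [iteratedDeriv_succ', iteratedDeriv_succ']
        simp
    simp [this]
  · simp

lemma taylorCoeff_id_mul_deriv (hf : AnalyticAt ℂ f 0) :
    taylorCoeff (fun z => z * deriv f z) n = n * taylorCoeff f n := by
  rcases n with _ | n
  · simp [taylorCoeff_zero]
  · rw [taylorCoeff_id_mul hf.deriv, taylorCoeff_deriv]; push_cast; ring

lemma norm_taylorCoeff_le {r C : ℝ} (hr : 0 < r) (hr1 : r < 1)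
    (hf : DifferentiableOn ℂ f (ball 0 1)) (hC : ∀ z ∈ sphere (0 : ℂ) r, ‖f z‖ ≤ C) :
    ‖taylorCoeff f n‖ ≤ C / r ^ n := by
  have hd : DiffContOnCl ℂ f (ball 0 r) :=
    (hf.mono (closure_ball_subset_closedBall.trans (closedBall_subset_ball hr1))).diffContOnCl
  have := norm_iteratedDeriv_le_of_forall_mem_sphere_norm_le n hr hd hC
  unfold taylorCoeff
  rw [norm_div, Complex.norm_natCast]
  have h3 : (0 : ℝ) < (n ! : ℝ) := by exact_mod_cast n.factorial_pos
  rw [div_le_iff₀ h3]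
  calc _ ≤ _ := this
    _ = _ := by ring

lemma analyticAt_zero (hf : DifferentiableOn ℂ f (ball 0 1)) : AnalyticAt ℂ f 0 :=
  hf.analyticAt (ball_mem_nhds _ one_pos)

end TaylorCoeff

/-- The second Lebedev–Milin inequality, in unsummed form. -/
lemma lebedev_milin {α β : ℕ → ℂ} (h0 : β 0 = 1)
    (h : ∀ k : ℕ, ((k : ℂ) + 1) * β (k + 1) =
      ∑ i ∈ Finset.range (k + 1), (((i : ℂ) + 1) * α (i + 1)) * β (k - i)) (n : ℕ) :
    ∑ j ∈ Finset.range (n + 1), ‖β j‖ ^ 2 ≤ (n + 1) * Real.exp (∑ m ∈ Finset.range n,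
      ((∑ i ∈ Finset.range (m + 1), ((i : ℝ) + 1) ^ 2 * ‖α (i + 1)‖ ^ 2) - (m + 1)) /
        (((m : ℝ) + 1) * (m + 2))) := by
  induction n with
  | zero => simp [h0]
  | succ n ih =>
    rw [Finset.sum_range_succ (fun j => ‖β j‖ ^ 2) (n + 1), Finset.sum_range_succ (fun m : ℕ =>
      ((∑ i ∈ Finset.range (m + 1), ((i : ℝ) + 1) ^ 2 * ‖α (i + 1)‖ ^ 2) - (m + 1)) /
        (((m : ℝ) + 1) * (m + 2))) n, Real.exp_add]
    set S := ∑ j ∈ Finset.range (n + 1), ‖β j‖ ^ 2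
    set E := Real.exp (∑ m ∈ Finset.range n,
      ((∑ i ∈ Finset.range (m + 1), ((i : ℝ) + 1) ^ 2 * ‖α (i + 1)‖ ^ 2) - (m + 1)) /
        (((m : ℝ) + 1) * (m + 2)))
    set A := ∑ i ∈ Finset.range (n + 1), ((i : ℝ) + 1) ^ 2 * ‖α (i + 1)‖ ^ 2
    have hS : 0 ≤ S := Finset.sum_nonneg fun _ _ => by positivity
    have hA : 0 ≤ A := Finset.sum_nonneg fun _ _ => by positivity
    have hn : (0 : ℝ) < n + 1 := by positivity
    have hcs : ((n : ℝ) + 1) ^ 2 * ‖β (n + 1)‖ ^ 2 ≤ A * S := by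
      have h1 : ((n : ℝ) + 1) * ‖β (n + 1)‖ ≤
          ∑ i ∈ Finset.range (n + 1), (((i : ℝ) + 1) * ‖α (i + 1)‖) * ‖β (n - i)‖ := by
        have e : ((n : ℝ) + 1) * ‖β (n + 1)‖ = ‖((n : ℂ) + 1) * β (n + 1)‖ := by
          rw [norm_mul]
          congr 1
          exact_mod_cast (Complex.norm_natCast (n + 1)).symm
        rw [e, h n]
        refine (norm_sum_le _ _).trans (Finset.sum_le_sum fun i _ => ?_)
        rw [norm_mul, norm_mul]
        refine le_of_eq ?_
        congr 2
        exact_mod_cast (Complex.norm_natCast (i + 1))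
      have h2 := Finset.sum_mul_sq_le_sq_mul_sq (Finset.range (n + 1))
        (fun i => ((i : ℝ) + 1) * ‖α (i + 1)‖) (fun i => ‖β (n - i)‖)
      have h3 : ∑ i ∈ Finset.range (n + 1), ‖β (n - i)‖ ^ 2 = S :=
        Finset.sum_range_reflect (fun j => ‖β j‖ ^ 2) (n + 1)
      rw [h3] at h2
      simp only [mul_pow] at h2
      calc ((n : ℝ) + 1) ^ 2 * ‖β (n + 1)‖ ^ 2 = (((n : ℝ) + 1) * ‖β (n + 1)‖) ^ 2 := by ring
        _ ≤ _ := by gcongr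
        _ ≤ A * S := h2
    have h4 : S + ‖β (n + 1)‖ ^ 2 ≤
        S * ((n + 2) / (n + 1) * (1 + (A - (n + 1)) / ((n + 1) * (n + 2)))) := by
      have : S * (((n : ℝ) + 2) / (n + 1) * (1 + (A - (n + 1)) / ((n + 1) * (n + 2)))) =
          S + A * S / (n + 1) ^ 2 := by field_simp; ring
      rw [this]
      gcongr
      rw [le_div_iff₀ (by positivity)]
      linarith
    have h5 : 1 + (A - (n + 1)) / ((n + 1) * (n + 2)) ≤
        Real.exp ((A - (n + 1)) / ((n + 1) * (n + 2))) := by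
      rw [add_comm]; exact Real.add_one_le_exp _
    refine h4.trans ?_
    calc _ ≤ ((n + 1) * E) * ((n + 2) / (n + 1) *
          Real.exp ((A - (n + 1)) / ((n + 1) * (n + 2)))) := by
          have h6 : 0 ≤ 1 + (A - (n + 1)) / ((n + 1) * (n + 2)) := by
            have : 1 + (A - (n + 1)) / (((n : ℝ) + 1) * (n + 2)) =
                (A + (n + 1) ^ 2) / ((n + 1) * (n + 2)) := by field_simp; ring
            rw [this]; positivity
          gcongr
      _ = _ := by push_cast; field_simp; ring

lemma sum_milin_eq (x : ℕ → ℝ) (n : ℕ) :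
    (n + 1) * ∑ m ∈ Finset.range n,
      ((∑ i ∈ Finset.range (m + 1), ((i : ℝ) + 1) ^ 2 * x (i + 1)) - (m + 1)) /
        (((m : ℝ) + 1) * (m + 2)) =
    ∑ k ∈ Finset.range n, ((n : ℝ) - k) * ((k + 1) * x (k + 1) - 1 / (k + 1)) := by
  induction n with
  | zero => simp
  | succ n ih =>
    have hs : ∑ k ∈ Finset.range (n + 1), (((n + 1 : ℕ) : ℝ) - k) *
          ((k + 1) * x (k + 1) - 1 / (k + 1)) =
        ∑ k ∈ Finset.range n, ((n : ℝ) - k) * ((k + 1) * x (k + 1) - 1 / (k + 1)) +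
        ∑ k ∈ Finset.range (n + 1), ((k + 1) * x (k + 1) - 1 / (k + 1)) := by
      rw [Finset.sum_range_succ, Finset.sum_range_succ _ n, ← add_assoc, ← Finset.sum_add_distrib]
      congr 1
      · refine Finset.sum_congr rfl fun k _ => ?_
        push_cast; ring
      · push_cast; ring
    have ht : ∀ n : ℕ, ∑ m ∈ Finset.range n,
      ((∑ i ∈ Finset.range (m + 1), ((i : ℝ) + 1) ^ 2 * x (i + 1)) - (m + 1)) /
        (((m : ℝ) + 1) * (m + 2)) + (∑ i ∈ Finset.range n, ((i : ℝ) + 1) ^ 2 * x (i + 1) - n) /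
        (n + 1) = ∑ k ∈ Finset.range n, ((k + 1) * x (k + 1) - 1 / (k + 1)) := by
      intro n
      induction n with
      | zero => simp
      | succ n ih =>
        rw [Finset.sum_range_succ, Finset.sum_range_succ _ n, Finset.sum_range_succ _ n, ← ih]
        push_cast
        field_simp
        ring
    rw [hs, ← ih, ← ht (n + 1), Finset.sum_range_succ]
    push_cast
    field_simp
    ring

/-- Milin's inequality for the logarithmic coefficients bounds the Taylor coefficients. -/
lemma norm_taylorCoeff_le_of_milin {L : ℂ → ℂ} (hL : DifferentiableOn ℂ L (ball 0 1))
    (hL0 : L 0 = 0) (n : ℕ)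
    (hM : ∑ k ∈ Finset.range n, ((n : ℝ) - k) *
      ((k + 1) * ‖taylorCoeff L (k + 1)‖ ^ 2 - 4 / (k + 1)) ≤ 0) :
    ‖taylorCoeff (fun z => z * cexp (L z)) (n + 1)‖ ≤ n + 1 := by
  set B : ℂ → ℂ := fun z => cexp (1 / 2 * L z) with hB
  have hLa := analyticAt_zero hL
  have hBa : AnalyticAt ℂ B 0 := by
    apply AnalyticAt.cexp; exact analyticAt_const.mul hLa
  have h1 : taylorCoeff (fun z => z * cexp (L z)) (n + 1) =
      taylorCoeff (fun z => B z * B z) n := by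
    rw [← taylorCoeff_id_mul (f := fun z => B z * B z) (hBa.mul hBa)]
    congr 1
    ext z
    rw [hB]
    simp only
    rw [← Complex.exp_add]
    ring_nf
  set β := taylorCoeff B
  set α : ℕ → ℂ := fun k => 1 / 2 * taylorCoeff L k
  have hβ0 : β 0 = 1 := by simp [β, taylorCoeff_zero, hB, hL0]
  have hrec : ∀ k : ℕ, ((k : ℂ) + 1) * β (k + 1) =
      ∑ i ∈ Finset.range (k + 1), (((i : ℂ) + 1) * α (i + 1)) * β (k - i) := by
    intro k
    rw [← taylorCoeff_deriv]
    have : deriv B =ᶠ[𝓝 0] fun z => (1 / 2 * deriv L z) * B z := by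
      filter_upwards [ball_mem_nhds (0 : ℂ) one_pos] with z hz
      have hd := (hL.differentiableAt (isOpen_ball.mem_nhds hz)).hasDerivAt
      rw [((hd.const_mul (1 / 2)).cexp).deriv]
      ring
    rw [taylorCoeff_congr this, taylorCoeff_mul (f := fun z => 1 / 2 * deriv L z)
      (analyticAt_const.mul hLa.deriv) hBa]
    refine Finset.sum_congr rfl fun i _ => ?_
    rw [taylorCoeff_const_mul, taylorCoeff_deriv]
    ring
  have hLM := lebedev_milin hβ0 hrec n
  have hsum := sum_milin_eq (fun k => ‖α k‖ ^ 2) n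
  have hle : ∑ m ∈ Finset.range n,
      ((∑ i ∈ Finset.range (m + 1), ((i : ℝ) + 1) ^ 2 * ‖α (i + 1)‖ ^ 2) - (m + 1)) /
        (((m : ℝ) + 1) * (m + 2)) ≤ 0 := by
    have h3 : ∑ k ∈ Finset.range n, ((n : ℝ) - k) * ((k + 1) * ‖α (k + 1)‖ ^ 2 - 1 / (k + 1))
        = 1 / 4 * ∑ k ∈ Finset.range n, ((n : ℝ) - k) *
      ((k + 1) * ‖taylorCoeff L (k + 1)‖ ^ 2 - 4 / (k + 1)) := by
      rw [Finset.mul_sum]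
      refine Finset.sum_congr rfl fun k _ => ?_
      simp only [α, norm_mul, mul_pow]
      norm_num
      ring
    rw [h3] at hsum
    have hn : (0 : ℝ) < n + 1 := by positivity
    by_contra hc
    push Not at hc
    have := mul_pos hn hc
    linarith
  have hS : ∑ j ∈ Finset.range (n + 1), ‖β j‖ ^ 2 ≤ n + 1 := by
    refine hLM.trans ?_
    have := Real.exp_le_one_iff.2 hle
    have hn : (0 : ℝ) < n + 1 := by positivity
    nlinarith
  rw [h1, taylorCoeff_mul hBa hBa]
  refine (norm_sum_le _ _).trans ?_
  simp only [norm_mul]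
  have h2 := Finset.sum_mul_sq_le_sq_mul_sq (Finset.range (n + 1))
        (fun i => ‖β i‖) (fun i => ‖β (n - i)‖)
  have h3 : ∑ i ∈ Finset.range (n + 1), ‖β (n - i)‖ ^ 2 =
      ∑ j ∈ Finset.range (n + 1), ‖β j‖ ^ 2 :=
    Finset.sum_range_reflect (fun j => ‖β j‖ ^ 2) (n + 1)
  rw [h3] at h2
  have h4 : 0 ≤ ∑ j ∈ Finset.range (n + 1), ‖β j‖ ^ 2 := Finset.sum_nonneg fun _ _ => by positivity
  have h5 : ∑ i ∈ Finset.range (n + 1), ‖β i‖ * ‖β (n - i)‖ ≤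
      ∑ j ∈ Finset.range (n + 1), ‖β j‖ ^ 2 :=
    abs_le_of_sq_le_sq' (by nlinarith) h4 |>.2
  exact h5.trans hS

section Weights

open Polynomial

/-- Shifted Chebyshev polynomials of the second kind: `shiftedU n` evaluated at `2 * (t - 1)` is
`U n` evaluated at `t`. -/
noncomputable def shiftedU : ℕ → ℝ[X]
  | 0 => 1
  | 1 => 2 + X
  | n + 2 => (2 + X) * shiftedU (n + 1) - shiftedU n

lemma natDegree_shiftedU_le (n : ℕ) : (shiftedU n).natDegree ≤ n := by
  induction n using Nat.twoStepInduction with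
  | zero => simp [shiftedU]
  | one =>
    rw [shiftedU]
    compute_degree
  | more n h0 h1 =>
    rw [shiftedU]
    have h2 : (2 + X : ℝ[X]).natDegree ≤ 1 := by compute_degree
    refine (natDegree_sub_le _ _).trans (max_le ?_ (h0.trans (by omega)))
    refine natDegree_mul_le.trans ?_
    omega

/-- The diagonal entry, indexed by `(p, i)`, of the symmetric power of a `2 × 2` matrix. -/
noncomputable def symDiag (A B c E : ℝ) (p i : ℕ) : ℝ :=
  ((C A + C B * X) ^ p * (C c + C E * X) ^ i).coeff i

lemma symDiag_zero_right (A B c E : ℝ) (p : ℕ) : symDiag A B c E p 0 = A ^ p := by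
  simp [symDiag, coeff_zero_eq_eval_zero]

lemma symDiag_zero_left (A B c E : ℝ) (i : ℕ) : symDiag A B c E 0 i = E ^ i := by
  rw [symDiag, pow_zero, one_mul]
  have h1 : (C c + C E * X : ℝ[X]).natDegree ≤ 1 := by compute_degree
  have := coeff_pow_of_natDegree_le h1 (m := i)
  simpa using this

lemma symDiag_succ_succ {A B c E : ℝ} (h : A * E - B * c = 1) (p i : ℕ) :
    symDiag A B c E (p + 1) (i + 1) = A * symDiag A B c E p (i + 1) +
      E * symDiag A B c E (p + 1) i - symDiag A B c E p i := by
  unfold symDiag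
  set F := (C A + C B * X : ℝ[X]) ^ p * (C c + C E * X) ^ i with hF
  have e1 : (C A + C B * X : ℝ[X]) ^ (p + 1) * (C c + C E * X) ^ (i + 1) =
      C A * ((C A + C B * X : ℝ[X]) ^ p * (C c + C E * X) ^ (i + 1)) +
      X * (C E * ((C A + C B * X : ℝ[X]) ^ (p + 1) * (C c + C E * X) ^ i)) - X * F := by
    have : (1 : ℝ[X]) = C A * C E - C B * C c := by
      rw [← C_mul, ← C_mul, ← C_sub, h, C_1]
    rw [hF]
    linear_combination (X * (C A + C B * X) ^ p * (C c + C E * X) ^ i : ℝ[X]) * this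
  rw [e1, coeff_sub, coeff_add, coeff_X_mul, coeff_X_mul, coeff_C_mul, coeff_C_mul]

lemma sum_symDiag {A B c E : ℝ} (h : A * E - B * c = 1) (n : ℕ) :
    ∑ q ∈ Finset.HasAntidiagonal.antidiagonal n, symDiag A B c E q.1 q.2 = (shiftedU n).eval (A + E - 2) := by
  induction n using Nat.twoStepInduction with
  | zero => simp [shiftedU, symDiag]
  | one =>
    rw [Finset.Nat.sum_antidiagonal_succ]
    simp [shiftedU, symDiag_zero_left, symDiag_zero_right]
    ring
  | more n h0 h1 =>
    rw [Finset.Nat.sum_antidiagonal_succ, Finset.Nat.sum_antidiagonal_succ', shiftedU]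
    have e1 := h1
    rw [Finset.Nat.sum_antidiagonal_succ'] at e1
    have e2 := h1
    rw [Finset.Nat.sum_antidiagonal_succ] at e2
    simp only [symDiag_zero_left, symDiag_zero_right] at *
    simp only [symDiag_succ_succ h, Finset.sum_sub_distrib, Finset.sum_add_distrib,
      ← Finset.mul_sum, h0]
    simp only [eval_sub, eval_mul, eval_add, eval_X, eval_ofNat]
    linear_combination E * e2 + A * e1

/-- The homogenisation of `f`, of degree `n`, evaluated at `(u, v)`. -/
noncomputable def homEval (u v : ℝ[X]) (n : ℕ) (f : ℝ[X]) : ℝ[X] :=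
  ∑ j ∈ Finset.range (n + 1), C (f.coeff j) * u ^ (n - j) * v ^ j

lemma homEval_linear_mul (u v f : ℝ[X]) (a b : ℝ) (n : ℕ) (hf : f.natDegree ≤ n) :
    homEval u v (n + 1) ((C a + C b * X) * f) = (C a * u + C b * v) * homEval u v n f := by
  unfold homEval
  rw [Finset.sum_range_succ', add_mul (C a * u), Finset.mul_sum, Finset.mul_sum,
    Finset.sum_range_succ' (fun j => C a * u * (C (f.coeff j) * u ^ (n - j) * v ^ j))]
  have h0 : ((C a + C b * X) * f).coeff 0 = a * f.coeff 0 := by simp [mul_coeff_zero]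
  have hs : ∀ j, ((C a + C b * X) * f).coeff (j + 1) = a * f.coeff (j + 1) + b * f.coeff j := by
    intro j
    rw [add_mul, coeff_add, coeff_C_mul, mul_assoc, coeff_C_mul, coeff_X_mul]
  simp only [h0, hs]
  have hlast : f.coeff (n + 1) = 0 := coeff_eq_zero_of_natDegree_lt (by omega)
  have e1 : ∑ j ∈ Finset.range (n + 1), C (a * f.coeff (j + 1) + b * f.coeff j) *
      u ^ (n + 1 - (j + 1)) * v ^ (j + 1) =
      ∑ j ∈ Finset.range (n + 1), C (a * f.coeff (j + 1)) * u ^ (n - j) * v ^ (j + 1) +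
      ∑ j ∈ Finset.range (n + 1), C b * v * (C (f.coeff j) * u ^ (n - j) * v ^ j) := by
    rw [← Finset.sum_add_distrib]
    refine Finset.sum_congr rfl fun j _ => ?_
    rw [Nat.add_sub_add_right, C_add, C_mul, C_mul]
    ring
  rw [e1, Finset.sum_range_succ, hlast]
  have e2 : ∑ j ∈ Finset.range n, C (a * f.coeff (j + 1)) * u ^ (n - j) * v ^ (j + 1) =
      ∑ j ∈ Finset.range n, C a * u * (C (f.coeff (j + 1)) * u ^ (n - (j + 1)) * v ^ (j + 1)) := by
    refine Finset.sum_congr rfl fun j hj => ?_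
    have : n - j = n - (j + 1) + 1 := by have := Finset.mem_range.1 hj; omega
    rw [this, C_mul]; ring
  rw [e2]
  simp only [Nat.sub_zero, C_mul, mul_zero, C_0, zero_mul, add_zero, pow_zero]
  ring

lemma homEval_mul_pow (u v : ℝ[X]) (a b c e : ℝ) (p i : ℕ) :
    homEval u v (p + i) ((C a + C b * X) ^ p * (C c + C e * X) ^ i) =
      (C a * u + C b * v) ^ p * (C c * u + C e * v) ^ i := by
  have h1 : ∀ a b : ℝ, (C a + C b * X : ℝ[X]).natDegree ≤ 1 := by intro a b; compute_degree
  induction p with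
  | zero =>
    rw [pow_zero, one_mul, pow_zero, one_mul, zero_add]
    induction i with
    | zero => simp [homEval]
    | succ i ih =>
      rw [pow_succ', homEval_linear_mul, ih, pow_succ']
      exact (natDegree_pow_le_of_le i (h1 c e)).trans (by omega)
  | succ p ih =>
    rw [pow_succ', mul_assoc, show p + 1 + i = p + i + 1 by ring, homEval_linear_mul, ih, pow_succ',
      mul_assoc]
    refine natDegree_mul_le.trans ?_
    have := natDegree_pow_le_of_le p (h1 a b)
    have := natDegree_pow_le_of_le i (h1 c e)
    omega

/-- Matrix entry of the symmetric power of the matrix with rows `(a, b)` and `(-b, a)`. -/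
noncomputable def rotEntry (n : ℕ) (a b : ℝ) (i j : ℕ) : ℝ :=
  ((C a + C b * X) ^ (n - i) * (C (-b) + C a * X) ^ i).coeff j

lemma choose_mul_rotEntry {n i j : ℕ} (hi : i ≤ n) (hj : j ≤ n) (a b : ℝ) :
    n.choose i * rotEntry n a b i j = n.choose j * rotEntry n a (-b) j i := by
  have key : ∀ {R : Type} [CommRing R] (a b s y : R),
      ∑ m ∈ Finset.range (n + 1), ((a + b * y) ^ (n - m) * (-b + a * y) ^ m * n.choose m) * s ^ m =
      ∑ m ∈ Finset.range (n + 1), ((a + -b * s) ^ (n - m) * (b + a * s) ^ m * n.choose m) *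
        y ^ m := by
    intro R _ a b s y
    have h1 := add_pow (s * (-b + a * y)) (a + b * y) n
    have h2 := add_pow (y * (b + a * s)) (a + -b * s) n
    rw [show y * (b + a * s) + (a + -b * s) = s * (-b + a * y) + (a + b * y) by ring, h1] at h2
    simp only [mul_pow] at h2
    convert h2 using 2 <;> ring
  have hpoly := key (C (C a)) (C (C b)) (X : ℝ[X][X]) (C X)
  have e1 : ∀ m, ((C (C a) + C (C b) * C X) ^ (n - m) * (-C (C b) + C (C a) * C X) ^ m *
      (n.choose m : ℝ[X][X])) = C (((C a + C b * X) ^ (n - m) * (C (-b) + C a * X) ^ m) *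
        C (n.choose m : ℝ)) := by
    intro m
    simp
  have e2 : ∀ m, ((C (C a) + -C (C b) * X) ^ (n - m) * (C (C b) + C (C a) * X) ^ m *
      (n.choose m : ℝ[X][X])) = (((C a + C (-b) * X) ^ (n - m) * (C (- -b) + C a * X) ^ m) *
        C (n.choose m : ℝ)).map C := by
    intro m
    simp only [Polynomial.map_mul, Polynomial.map_pow, Polynomial.map_add, map_C, map_X, C_neg,
      neg_neg, Polynomial.map_neg, map_natCast]
    simp
  simp only [e1, e2, ← C_pow] at hpoly
  have hc := congrArg (fun q : ℝ[X][X] => (q.coeff i).coeff j) hpoly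
  simp only [finsetSum_coeff, C_pow, coeff_C_mul_X_pow] at hc
  have hc' : ∑ m ∈ Finset.range (n + 1), (if i = m then
      (((C a + C b * X) ^ (n - m) * (C (-b) + C a * X) ^ m) * C (n.choose m : ℝ)) else 0 : ℝ[X]).coeff j
      = n.choose i * rotEntry n a b i j := by
    rw [Finset.sum_eq_single i]
    · rw [if_pos rfl, coeff_mul_C, rotEntry, mul_comm]
    · intro m _ hm
      rw [if_neg (Ne.symm hm), coeff_zero]
    · intro h
      exact absurd (Finset.mem_range.2 (by omega)) h
  rw [hc'] at hc
  rw [hc, Finset.sum_eq_single j]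
  · rw [← C_pow, coeff_mul_C, coeff_map, coeff_C_mul, coeff_X_pow, if_pos rfl, rotEntry, coeff_mul_C]
    ring
  · intro m _ hm
    rw [← C_pow, coeff_mul_C, coeff_map, coeff_C_mul, coeff_X_pow, if_neg (Ne.symm hm), mul_zero]
  · intro h
    exact absurd (Finset.mem_range.2 (by omega)) h


lemma rotEntry_mul_nonneg {n i j : ℕ} (hi : i ≤ n) (hj : j ≤ n) (a b : ℝ) :
    0 ≤ rotEntry n a b i j * rotEntry n a (-b) j i := by
  have h := choose_mul_rotEntry hi hj a b
  have h1 : (0 : ℝ) < n.choose i := by exact_mod_cast Nat.choose_pos hi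
  have h2 : (0 : ℝ) < n.choose j := by exact_mod_cast Nat.choose_pos hj
  have h3 : rotEntry n a (-b) j i = n.choose i / n.choose j * rotEntry n a b i j := by
    field_simp; linarith
  rw [h3]
  have : rotEntry n a b i j * (n.choose i / n.choose j * rotEntry n a b i j) =
    n.choose i / n.choose j * rotEntry n a b i j ^ 2 := by ring
  rw [this]; positivity

lemma symDiag_conj {n p i : ℕ} (hpi : p + i = n) (a b x : ℝ) (hx : x ≠ 0) :
    symDiag (a * a + x * b * b) (x * a * b - a * b) (a * b - a * b / x) (b * b / x + a * a) p i =
      ∑ j ∈ Finset.range (n + 1), x ^ j / x ^ i * (rotEntry n a b i j * rotEntry n a (-b) j i) := by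
  have h := homEval_mul_pow (C a + C (-b) * X) (C (- -b) + C a * X) a (x * b) (-b / x) a p i
  have e1 : (C a * (C a + C (-b) * X) + C (x * b) * (C (- -b) + C a * X) : ℝ[X]) =
      C (a * a + x * b * b) + C (x * a * b - a * b) * X := by
    simp only [C_mul, C_add, C_sub, C_neg]; ring
  have e2 : (C (-b / x) * (C a + C (-b) * X) + C a * (C (- -b) + C a * X) : ℝ[X]) =
      C (a * b - a * b / x) + C (b * b / x + a * a) * X := by
    simp only [C_mul, C_add, C_sub, C_neg, div_eq_mul_inv]; ring
  rw [e1, e2] at h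
  rw [symDiag, ← h, homEval, finsetSum_coeff, hpi]
  refine Finset.sum_congr rfl fun j hj => ?_
  rw [mul_assoc, coeff_C_mul]
  have e3 : (C a + C (x * b) * X : ℝ[X]) ^ p * (C (-b / x) + C a * X) ^ i =
      C ((1 / x) ^ i) * ((C a + C b * X) ^ (n - i) * (C (-b) + C a * X) ^ i).comp (C x * X) := by
    have : n - i = p := by omega
    simp only [this, mul_comp, pow_comp, add_comp, C_comp, X_comp]
    have e4 : (C (-b / x) + C a * X : ℝ[X]) = C (1 / x) * (C (-b) + C a * (C x * X)) := by
      rw [mul_add, ← C_mul, ← mul_assoc, ← mul_assoc, ← C_mul, ← C_mul]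
      congr 2
      · ring
      · congr 1; field_simp
    rw [e4, mul_pow, C_pow]
    simp only [C_mul]; ring
  rw [e3, coeff_C_mul, comp_C_mul_X_coeff]
  simp only [rotEntry, one_div, inv_pow]
  field_simp

/-- The generating polynomial of the de Branges weights. -/
noncomputable def weightGen (n : ℕ) (a : ℝ) : ℝ[X] :=
  ∑ m ∈ Finset.range (n + 1), C ((shiftedU n).coeff m * a ^ m) * (X ^ (n - m) * (X - C 1) ^ (2 * m))

lemma eval_weightGen (n : ℕ) (a x : ℝ) (hx : x ≠ 0) :
    (weightGen n a).eval x = x ^ n * (shiftedU n).eval (a * (x - 1) ^ 2 / x) := by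
  rw [eval_eq_sum_range' (Nat.lt_succ_of_le (natDegree_shiftedU_le n)), Finset.mul_sum, weightGen,
    eval_finsetSum]
  refine Finset.sum_congr rfl fun m hm => ?_
  simp only [eval_mul, eval_C, eval_pow, eval_X, eval_sub]
  have : n = n - m + m := by have := Finset.mem_range.1 hm; omega
  have h2 : x ^ n = x ^ (n - m) * x ^ m := by rw [← pow_add]; congr 1
  rw [h2, div_pow, mul_pow, ← pow_mul]
  field_simp

lemma weightGen_eq (n : ℕ) {a : ℝ} (h0 : 0 ≤ a) (h1 : a ≤ 1) :
    weightGen n a = ∑ i ∈ Finset.range (n + 1), ∑ j ∈ Finset.range (n + 1),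
      C (rotEntry n √(1 - a) √a i j * rotEntry n √(1 - a) (-√a) j i) * X ^ (n - i + j) := by
  refine eq_of_infinite_eval_eq _ _ ?_
  refine Set.Infinite.mono (s := {0}ᶜ) ?_ (Set.finite_singleton (0 : ℝ)).infinite_compl
  intro x hx
  have hx : x ≠ 0 := hx
  have hα : √(1 - a) * √(1 - a) = 1 - a := Real.mul_self_sqrt (by linarith)
  have hβ : √a * √a = a := Real.mul_self_sqrt h0
  set α := √(1 - a)
  set β := √a
  have hdet : (α * α + x * β * β) * (β * β / x + α * α) -
      (x * α * β - α * β) * (α * β - α * β / x) = 1 := by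
    have : (α * α + x * β * β) * (β * β / x + α * α) -
      (x * α * β - α * β) * (α * β - α * β / x) = (α * α + β * β) ^ 2 := by
      field_simp; ring
    rw [this, hα, hβ]; ring
  have htr : (α * α + x * β * β) + (β * β / x + α * α) - 2 = a * (x - 1) ^ 2 / x := by
    have : (α * α + x * β * β) + (β * β / x + α * α) - 2 =
      2 * (α * α) + (β * β) * (x + 1 / x) - 2 := by ring
    rw [this, hα, hβ]; field_simp; ring
  show eval x _ = eval x _
  rw [eval_weightGen n a x hx, ← htr, ← sum_symDiag hdet, Finset.mul_sum, eval_finsetSum,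
    Finset.Nat.antidiagonal_eq_map', Finset.sum_map]
  refine Finset.sum_congr rfl fun i hi => ?_
  have hin : i ≤ n := by have := Finset.mem_range.1 hi; omega
  change x ^ n * symDiag _ _ _ _ (n - i) i = _
  rw [eval_finsetSum, symDiag_conj (n := n) (by omega) _ _ _ hx, Finset.mul_sum]
  refine Finset.sum_congr rfl fun j _ => ?_
  simp only [eval_mul, eval_C, eval_pow, eval_X]
  rw [show x ^ n = x ^ (n - i) * x ^ i by rw [← pow_add]; congr 1; omega, pow_add]
  field_simp

lemma coeff_weightGen_nonneg (n k : ℕ) {a : ℝ} (h0 : 0 ≤ a) (h1 : a ≤ 1) :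
    0 ≤ (weightGen n a).coeff k := by
  rw [weightGen_eq n h0 h1, finsetSum_coeff]
  refine Finset.sum_nonneg fun i hi => ?_
  rw [finsetSum_coeff]
  refine Finset.sum_nonneg fun j hj => ?_
  have hi := Finset.mem_range.1 hi
  have hj := Finset.mem_range.1 hj
  rw [coeff_C_mul_X_pow]
  split_ifs
  · exact rotEntry_mul_nonneg (by omega) (by omega) _ _
  · exact le_rfl

lemma weightGen_one (n : ℕ) :
    weightGen n 1 = ∑ i ∈ Finset.range (n + 1), X ^ (2 * i) := by
  refine eq_of_infinite_eval_eq _ _ ?_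
  refine Set.Infinite.mono (s := {0}ᶜ) ?_ (Set.finite_singleton (0 : ℝ)).infinite_compl
  intro x hx
  have hx : x ≠ 0 := hx
  show eval x _ = eval x _
  have hdet : x⁻¹ * x - 0 * 0 = 1 := by field_simp; ring
  have htr : x⁻¹ + x - 2 = 1 * (x - 1) ^ 2 / x := by field_simp; ring
  rw [eval_weightGen n 1 x hx, ← htr, ← sum_symDiag hdet, Finset.mul_sum, eval_finsetSum,
    Finset.Nat.antidiagonal_eq_map', Finset.sum_map]
  refine Finset.sum_congr rfl fun i hi => ?_
  have hin : i ≤ n := by have := Finset.mem_range.1 hi; omega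
  change x ^ n * symDiag _ _ _ _ (n - i) i = _
  simp only [symDiag, C_0, zero_mul, add_zero, zero_add, mul_pow,
    ← C_pow, coeff_C_mul, coeff_X_pow, if_pos, eval_pow, eval_X]
  have : x ^ n = x ^ (n - i) * x ^ i := by rw [← pow_add]; congr 1; omega
  rw [this, two_mul, pow_add, inv_pow]
  field_simp

lemma coeff_weightGen_one (n k : ℕ) (hk : k ≤ n) :
    (weightGen n 1).coeff (n + k) + (weightGen n 1).coeff (n + (k + 1)) = 1 := by
  have h : ∀ l, (weightGen n 1).coeff l = if Even l ∧ l ≤ 2 * n then 1 else 0 := by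
    intro l
    rw [weightGen_one, finsetSum_coeff]
    simp only [coeff_X_pow]
    split_ifs with h
    · obtain ⟨⟨c, rfl⟩, hl⟩ := h
      rw [Finset.sum_eq_single c]
      · rw [if_pos (by omega)]
      · intro b _ hb; rw [if_neg (by omega)]
      · intro h; exact absurd (Finset.mem_range.2 (by omega)) h
    · refine Finset.sum_eq_zero fun i hi => ?_
      rw [if_neg]
      rintro rfl
      have := Finset.mem_range.1 hi
      exact h ⟨even_two_mul i, by omega⟩
  rw [h, h]
  rcases Nat.even_or_odd (n + k) with he | ho
  · rw [if_pos ⟨he, by omega⟩, if_neg, add_zero]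
    rintro ⟨h, _⟩
    rw [← add_assoc, Nat.even_add_one] at h
    exact h he
  · rw [if_neg, if_pos, zero_add]
    · refine ⟨by rw [← add_assoc]; exact ho.add_one, ?_⟩
      obtain ⟨c, hc⟩ := ho
      omega
    · rintro ⟨h, _⟩
      exact (Nat.not_even_iff_odd.2 ho) h

/-- The polynomial whose value at `exp (-t)` is the (normalised) derivative of a de Branges
weight. -/
noncomputable def weightQ (n k : ℕ) : ℝ[X] :=
  ∑ m ∈ Finset.range (n + 1),
    C ((shiftedU n).coeff m * ((-1) ^ (m + k) * (2 * m).choose (m + k))) * X ^ m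

lemma eval_weightQ (n k : ℕ) (a : ℝ) : (weightQ n k).eval a = (weightGen n a).coeff (n + k) := by
  rw [weightQ, weightGen, eval_finsetSum, finsetSum_coeff]
  refine Finset.sum_congr rfl fun m hm => ?_
  have hm := Finset.mem_range.1 hm
  simp only [eval_mul, eval_C, eval_pow, eval_X, coeff_C_mul]
  rw [show n + k = (m + k) + (n - m) by omega, coeff_X_pow_mul, sub_eq_add_neg,
    ← C_neg, coeff_X_add_C_pow]
  by_cases hk : k ≤ m
  · have : ((-1 : ℝ)) ^ (m + k) = (-1) ^ (2 * m - (m + k)) := by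
      have : m + k = (2 * m - (m + k)) + 2 * k := by omega
      rw [this, pow_add, pow_mul]; simp; congr 1; omega
    rw [this]; ring
  · rw [Nat.choose_eq_zero_of_lt (by omega)]; simp

lemma weightQ_eq_zero {n k : ℕ} (hk : n < k) : weightQ n k = 0 := by
  refine Finset.sum_eq_zero fun m hm => ?_
  have hm := Finset.mem_range.1 hm
  rw [Nat.choose_eq_zero_of_lt (by omega)]; simp

lemma X_mul_derivative_weightQ (n k : ℕ) :
    X * derivative (weightQ n k + weightQ n (k + 1)) =
      C (k : ℝ) * weightQ n k - C ((k : ℝ) + 1) * weightQ n (k + 1) := by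
  simp only [weightQ]
  rw [← Finset.sum_add_distrib, derivative_sum, Finset.mul_sum, Finset.mul_sum, Finset.mul_sum,
    ← Finset.sum_sub_distrib]
  refine Finset.sum_congr rfl fun m _ => ?_
  have e : ∀ c : ℝ, X * derivative (C c * X ^ m : ℝ[X]) = C (m * c) * X ^ m := by
    intro c
    rcases m with _ | m
    · simp
    · rw [derivative_C_mul_X_pow]; push_cast; simp only [C_mul]; ring
  rw [derivative_add, mul_add, e, e, ← mul_assoc (C (k : ℝ)), ← mul_assoc (C ((k : ℝ) + 1)), ← C_mul, ← C_mul, ← add_mul,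
    ← sub_mul, ← C_add, ← C_sub]
  congr 2
  have hch : ((m : ℝ) - k) * (2 * m).choose (m + k) = (m + k + 1) * (2 * m).choose (m + (k + 1)) := by
    by_cases hk : k ≤ m
    · have h := Nat.choose_succ_right_eq (2 * m) (m + k)
      have h' : ((2 * m).choose (m + k + 1) : ℝ) * (m + k + 1 : ℕ) =
          (2 * m).choose (m + k) * (2 * m - (m + k) : ℕ) := by exact_mod_cast h
      rw [Nat.cast_sub (by omega)] at h'
      push_cast at h'
      rw [← add_assoc]
      linear_combination -h'
    · rw [Nat.choose_eq_zero_of_lt (by omega), Nat.choose_eq_zero_of_lt (by omega)]; simp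
  rw [← add_assoc m k 1, pow_succ]
  rw [← add_assoc m k 1] at hch
  linear_combination (shiftedU n).coeff m * (-1) ^ (m + k) * hch

/-- Existence of the de Branges weights, as polynomials in `exp (-t)`. -/
theorem exists_weights (n : ℕ) : ∃ P Q : ℕ → ℝ[X],
    (∀ k, X * derivative (P k) = C (k : ℝ) * Q k) ∧
    (∀ k ≤ n, P k - P (k + 1) = Q k + Q (k + 1)) ∧
    P (n + 1) = 0 ∧ Q (n + 1) = 0 ∧
    (∀ k ≤ n, (P k).eval 1 = n + 1 - k) ∧
    (∀ k, 1 ≤ k → (P k).eval 0 = 0) ∧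
    (∀ k, ∀ a : ℝ, 0 ≤ a → a ≤ 1 → 0 ≤ (Q k).eval a) := by
  refine ⟨fun k => ∑ j ∈ Finset.Ico k (n + 1), (weightQ n j + weightQ n (j + 1)), weightQ n,
    ?_, ?_, ?_, ?_, ?_, ?_, ?_⟩
  · intro k
    rcases le_or_gt k (n + 1) with hk | hk
    · rw [derivative_sum, Finset.mul_sum]
      simp only [X_mul_derivative_weightQ]
      have := Finset.sum_Ico_sub (fun j : ℕ => -(C (j : ℝ) * weightQ n j)) hk
      rw [weightQ_eq_zero (Nat.lt_succ_self n)] at this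
      simp only [mul_zero, neg_zero, zero_sub, neg_neg] at this
      rw [← this]
      refine Finset.sum_congr rfl fun j _ => ?_
      push_cast; ring
    · beta_reduce
      rw [Finset.Ico_eq_empty (by omega), weightQ_eq_zero (by omega)]; simp
  · intro k hk
    beta_reduce
    rw [Finset.sum_eq_sum_Ico_succ_bot (by omega)]; ring
  · simp
  · exact weightQ_eq_zero (Nat.lt_succ_self n)
  · intro k hk
    rw [eval_finsetSum, Finset.sum_congr rfl (g := fun _ => (1 : ℝ))]
    · rw [Finset.sum_const, Nat.card_Ico, Nat.smul_one_eq_cast, Nat.cast_sub (by omega)]; push_cast; ring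
    · intro j hj
      rw [eval_add, eval_weightQ, eval_weightQ]
      exact coeff_weightGen_one n j (by have := Finset.mem_Ico.1 hj; omega)
  · intro k hk
    rw [eval_finsetSum]
    refine Finset.sum_eq_zero fun j hj => ?_
    have hj := Finset.mem_Ico.1 hj
    rw [weightQ, weightQ, eval_add, eval_finsetSum, eval_finsetSum,
      Finset.sum_eq_zero, Finset.sum_eq_zero, add_zero]
    all_goals
      intro m _
      rcases m with _ | m
      · rw [Nat.choose_eq_zero_of_lt (by omega)]; simp
      · simp
  · intro k a h0 h1
    rw [eval_weightQ]
    exact coeff_weightGen_nonneg n _ h0 h1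

end Weights

lemma abel_identity (p lam B : ℕ → ℝ) (n : ℕ)
    (hrel : ∀ i < n, p (i + 1) - p (i + 2) = lam (i + 1) + lam (i + 2)) (hB : B 0 = 1) :
    ∑ i ∈ Finset.range n, p (i + 1) * (B (i + 1) - B i) =
      ∑ i ∈ Finset.range n, lam (i + 1) * (B (i + 1) + B i - 2) +
        (p (n + 1) + lam (n + 1)) * (B n - 1) := by
  induction n with
  | zero => simp [hB]
  | succ n ih =>
    rw [Finset.sum_range_succ, Finset.sum_range_succ, ih fun i hi => hrel i (by omega)]
    have := hrel n (Nat.lt_succ_self n)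
    linear_combination (B (n + 1) - 1) * this

lemma point_ineq {n : ℕ} {p lam : ℕ → ℝ} (hlam : ∀ k, 0 ≤ lam k)
    (hrel : ∀ i < n, p (i + 1) - p (i + 2) = lam (i + 1) + lam (i + 2))
    (hp : p (n + 1) = 0) (hl : lam (n + 1) = 0) {e : ℕ → ℂ} (he : e 0 = 1) {κ : ℂ} (hκ : ‖κ‖ = 1) :
    0 ≤ ∑ i ∈ Finset.range n, (-lam (i + 1) * (‖e (i + 1)‖ ^ 2 - 4) + 2 * p (i + 1) *
      (starRingEnd ℂ (e (i + 1)) * (e (i + 1) +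
        2 * ∑ m ∈ Finset.range (i + 1), κ ^ (m + 1) * e (i - m))).re) := by
  have hκ0 : κ ≠ 0 := by rintro rfl; simp at hκ
  set B : ℕ → ℂ := fun k => ∑ j ∈ Finset.range (k + 1), e j * κ⁻¹ ^ j with hB
  have hBs : ∀ i, B (i + 1) = B i + e (i + 1) * κ⁻¹ ^ (i + 1) := fun i => by
    simp only [hB]; rw [Finset.sum_range_succ]
  have hd : ∀ i, e (i + 1) + 2 * ∑ m ∈ Finset.range (i + 1), κ ^ (m + 1) * e (i - m) =
      κ ^ (i + 1) * (B (i + 1) + B i) := by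
    intro i
    have h1 : ∑ m ∈ Finset.range (i + 1), κ ^ (m + 1) * e (i - m) = κ ^ (i + 1) * B i := by
      rw [hB, Finset.mul_sum, ← Finset.sum_range_reflect]
      refine Finset.sum_congr rfl fun m hm => ?_
      have hm := Finset.mem_range.1 hm
      rw [show i - (i + 1 - 1 - m) = m by omega, show i + 1 - 1 - m + 1 = i + 1 - m by omega]
      have : κ ^ (i + 1) = κ ^ (i + 1 - m) * κ ^ m := by rw [← pow_add]; congr 1; omega
      rw [this, inv_pow]
      field_simp
    rw [h1, hBs, inv_pow]
    field_simp
    ring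
  have he' : ∀ i, e (i + 1) = κ ^ (i + 1) * (B (i + 1) - B i) := by
    intro i
    rw [hBs, inv_pow]
    field_simp
    ring
  have hconj : ∀ i, starRingEnd ℂ (κ ^ i) * κ ^ i = 1 := by
    intro i
    rw [← Complex.normSq_eq_conj_mul_self, Complex.normSq_eq_norm_sq, norm_pow, hκ]; simp
  have h2 : ∀ i, (starRingEnd ℂ (e (i + 1)) * (e (i + 1) +
        2 * ∑ m ∈ Finset.range (i + 1), κ ^ (m + 1) * e (i - m))).re =
        ‖B (i + 1)‖ ^ 2 - ‖B i‖ ^ 2 := by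
    intro i
    rw [hd, he', map_mul]
    have : starRingEnd ℂ (κ ^ (i + 1)) * starRingEnd ℂ (B (i + 1) - B i) *
        (κ ^ (i + 1) * (B (i + 1) + B i)) = starRingEnd ℂ (B (i + 1) - B i) * (B (i + 1) + B i) := by
      linear_combination starRingEnd ℂ (B (i + 1) - B i) * (B (i + 1) + B i) * hconj (i + 1)
    rw [this, ← Complex.normSq_eq_norm_sq, ← Complex.normSq_eq_norm_sq]
    simp [Complex.normSq_apply]
    ring
  have h3 : ∀ i, ‖e (i + 1)‖ ^ 2 = ‖B (i + 1) - B i‖ ^ 2 := by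
    intro i
    rw [he', norm_mul, norm_pow, hκ]; simp
  simp only [h2, h3]
  have hab := abel_identity p lam (fun k => ‖B k‖ ^ 2) n hrel (by simp [hB, he])
  simp only [hp, hl, add_zero, zero_mul] at hab
  have : ∑ i ∈ Finset.range n, (-lam (i + 1) * (‖B (i + 1) - B i‖ ^ 2 - 4) +
      2 * p (i + 1) * (‖B (i + 1)‖ ^ 2 - ‖B i‖ ^ 2)) =
      ∑ i ∈ Finset.range n, lam (i + 1) * ‖B (i + 1) + B i‖ ^ 2 := by
    rw [Finset.sum_add_distrib]
    simp only [mul_assoc (2 : ℝ)]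
    rw [← Finset.mul_sum, hab, Finset.mul_sum, ← Finset.sum_add_distrib]
    refine Finset.sum_congr rfl fun i _ => ?_
    simp only [← Complex.normSq_eq_norm_sq, Complex.normSq_apply, sub_re, sub_im, add_re, add_im]
    ring
  rw [this]
  exact Finset.sum_nonneg fun i _ => mul_nonneg (hlam _) (by positivity)

lemma circleAverage_div_pow {q : ℂ → ℂ} (hq : DifferentiableOn ℂ q (ball 0 1)) {r : ℝ} (hr : 0 < r)
    (hr1 : r < 1) (m : ℕ) :
    Real.circleAverage (fun z => q z / z ^ m) 0 r = taylorCoeff q m := by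
  have hd : DiffContOnCl ℂ q (ball 0 r) :=
    (hq.mono (closure_ball_subset_closedBall.trans (closedBall_subset_ball hr1))).diffContOnCl
  rw [Real.circleAverage_eq_circleIntegral hr.ne']
  have := hd.circleIntegral_one_div_sub_center_pow_smul hr m
  have e : ∀ z : ℂ, (z - 0)⁻¹ • (q z / z ^ m) = (1 / (z - 0) ^ (m + 1)) • q z := by
    intro z
    simp only [sub_zero, smul_eq_mul, pow_succ, one_div, mul_inv]
    ring
  simp only [e]
  rw [this, smul_eq_mul, smul_eq_mul, taylorCoeff]
  have : (2 * Real.pi * I : ℂ) ≠ 0 := by simp [Real.pi_ne_zero]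
  field_simp

lemma nonneg_of_trig_nonneg {A : ℝ} {w : ℕ → ℂ} {n : ℕ}
    (hT : ∀ κ : ℂ, ‖κ‖ = 1 → 0 ≤ A + 2 * ∑ m ∈ Finset.range n, (w m * κ ^ (m + 1)).re)
    {q : ℂ → ℂ} (hq : DifferentiableOn ℂ q (ball 0 1)) (hre : ∀ z ∈ ball (0 : ℂ) 1, 0 ≤ (q z).re)
    (hq0 : q 0 = 1) :
    0 ≤ A + ∑ m ∈ Finset.range n, (w m * taylorCoeff q (m + 1)).re := by
  have main : ∀ r : ℝ, 0 < r → r < 1 →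
      0 ≤ A + ∑ m ∈ Finset.range n, r ^ (m + 1) * (w m * taylorCoeff q (m + 1)).re := by
    intro r hr hr1
    have hsub : sphere (0 : ℂ) r ⊆ ball 0 1 := sphere_subset_closedBall.trans
      (closedBall_subset_ball hr1)
    have hr0 : (r : ℂ) ≠ 0 := by exact_mod_cast hr.ne'
    have hz0 : ∀ z ∈ sphere (0 : ℂ) r, z ≠ 0 := by
      rintro z hz rfl
      simp at hz; exact hr.ne hz
    set F1 : ℂ → ℂ := fun z => q z * (2 * A + 2 * ∑ m ∈ Finset.range n,
      starRingEnd ℂ (w m) * (z / r) ^ (m + 1)) with hF1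
    set F2 : ℂ → ℂ := fun z => ∑ m ∈ Finset.range n, (2 * w m * r ^ (m + 1)) • (q z / z ^ (m + 1))
      with hF2
    have hF1d : DifferentiableOn ℂ F1 (ball 0 1) := by
      refine hq.mul ?_
      fun_prop
    have hcont : ∀ m : ℕ, CircleIntegrable
        (fun z => (2 * w m * r ^ (m + 1)) • (q z / z ^ (m + 1))) 0 r := by
      intro m
      refine ContinuousOn.circleIntegrable hr.le ?_
      have : ContinuousOn (fun z => q z / z ^ (m + 1)) (sphere 0 r) :=
        (hq.continuousOn.mono hsub).div (continuous_id.pow (m + 1)).continuousOn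
          fun z hz => pow_ne_zero _ (hz0 z hz)
      exact this.const_smul (2 * w m * (r : ℂ) ^ (m + 1))
    have hF1i : CircleIntegrable F1 0 r :=
      ContinuousOn.circleIntegrable hr.le (hF1d.continuousOn.mono hsub)
    have hF2i : CircleIntegrable F2 0 r := by
      have := CircleIntegrable.fun_sum (Finset.range n) (fun m _ => hcont m)
      exact this
    have hav1 : Real.circleAverage F1 0 r = 2 * A := by
      have : DiffContOnCl ℂ F1 (ball 0 |r|) := by
        rw [abs_of_pos hr]
        exact (hF1d.mono (closure_ball_subset_closedBall.trans
          (closedBall_subset_ball hr1))).diffContOnCl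
      rw [this.circleAverage]
      simp [hF1, hq0]
    have hav2 : Real.circleAverage F2 0 r =
        ∑ m ∈ Finset.range n, 2 * w m * r ^ (m + 1) * taylorCoeff q (m + 1) := by
      rw [hF2, Real.circleAverage_fun_sum fun m _ => hcont m]
      refine Finset.sum_congr rfl fun m _ => ?_
      rw [Real.circleAverage_fun_smul, circleAverage_div_pow hq hr hr1, smul_eq_mul]
    have hav : Real.circleAverage (fun z => F1 z + F2 z) 0 r = 2 * A +
        ∑ m ∈ Finset.range n, 2 * w m * r ^ (m + 1) * taylorCoeff q (m + 1) := by
      rw [Real.circleAverage_fun_add hF1i hF2i, hav1, hav2]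
    have hcomm := Complex.reCLM.circleAverage_comp_comm (hF1i.add hF2i)
    have hnn : 0 ≤ Real.circleAverage (Complex.reCLM ∘ (F1 + F2)) 0 r := by
      refine Real.circleAverage_nonneg_of_nonneg ?_
      intro z hz
      rw [abs_of_pos hr] at hz
      have hz1 : ‖z‖ = r := by simpa using hz
      have hn : ‖(r : ℂ) / z‖ = 1 := by
        rw [norm_div, hz1, Complex.norm_real, Real.norm_of_nonneg hr.le, div_self hr.ne']
      have hcj : (z / r : ℂ) = starRingEnd ℂ (r / z) := by
        have h1 : starRingEnd ℂ (r / z) * (r / z) = 1 := by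
          rw [← Complex.normSq_eq_conj_mul_self, Complex.normSq_eq_norm_sq, hn]; simp
        have := hz0 z hz
        field_simp at h1 ⊢
        linear_combination -h1
      have h2 : F1 z + F2 z = q z * (2 * (A + 2 * ∑ m ∈ Finset.range n,
          (w m * (r / z) ^ (m + 1)).re : ℝ)) := by
        have e1 : F2 z = q z * ∑ m ∈ Finset.range n, 2 * (w m * (r / z) ^ (m + 1)) := by
          rw [hF2, Finset.mul_sum]
          refine Finset.sum_congr rfl fun m _ => ?_
          rw [div_pow, smul_eq_mul]; ring
        rw [e1, hF1]
        simp only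
        rw [← mul_add, add_assoc, Finset.mul_sum, ← Finset.sum_add_distrib]
        congr 1
        push_cast
        rw [mul_add, Finset.mul_sum, Finset.mul_sum]
        congr 1
        refine Finset.sum_congr rfl fun m _ => ?_
        rw [hcj, ← map_pow, ← map_mul, Complex.re_eq_add_conj]
        ring
      show 0 ≤ (F1 z + F2 z).re
      rw [h2, show (2 : ℂ) = ((2 : ℝ) : ℂ) by simp, ← Complex.ofReal_mul, Complex.re_mul_ofReal]
      exact mul_nonneg (hre z (hsub hz)) (mul_nonneg zero_le_two (hT _ hn))
    rw [hcomm] at hnn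
    have hav' : Real.circleAverage (F1 + F2) 0 r = 2 * A +
        ∑ m ∈ Finset.range n, 2 * w m * r ^ (m + 1) * taylorCoeff q (m + 1) := hav
    rw [hav'] at hnn
    have : (Complex.reCLM (2 * A +
        ∑ m ∈ Finset.range n, 2 * w m * r ^ (m + 1) * taylorCoeff q (m + 1))) =
        2 * (A + ∑ m ∈ Finset.range n, r ^ (m + 1) * (w m * taylorCoeff q (m + 1)).re) := by
      rw [Complex.reCLM_apply, add_re, re_sum, mul_add, Finset.mul_sum]
      congr 1
      · simp
      · refine Finset.sum_congr rfl fun m _ => ?_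
        rw [show 2 * w m * (r : ℂ) ^ (m + 1) * taylorCoeff q (m + 1) =
          ((2 * r ^ (m + 1) : ℝ) : ℂ) * (w m * taylorCoeff q (m + 1)) by push_cast; ring,
          Complex.re_ofReal_mul]
        ring
    rw [this] at hnn
    linarith
  have hlim : Tendsto (fun r : ℝ => A + ∑ m ∈ Finset.range n,
      r ^ (m + 1) * (w m * taylorCoeff q (m + 1)).re) (𝓝[<] 1)
      (𝓝 (A + ∑ m ∈ Finset.range n, (1 : ℝ) ^ (m + 1) * (w m * taylorCoeff q (m + 1)).re)) := by
    refine Tendsto.mono_left (Continuous.tendsto ?_ 1) nhdsWithin_le_nhds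
    fun_prop
  simp only [one_pow, one_mul] at hlim
  refine ge_of_tendsto hlim ?_
  filter_upwards [Ioo_mem_nhdsLT (zero_lt_one' ℝ)] with r hr
  exact main r hr.1 hr.2

theorem weighted_ineq {n : ℕ} {p lam : ℕ → ℝ} (hlam : ∀ k, 0 ≤ lam k)
    (hrel : ∀ i < n, p (i + 1) - p (i + 2) = lam (i + 1) + lam (i + 2))
    (hp : p (n + 1) = 0) (hl : lam (n + 1) = 0) {e : ℕ → ℂ} (he : e 0 = 1)
    {q : ℂ → ℂ} (hq : DifferentiableOn ℂ q (ball 0 1)) (hre : ∀ z ∈ ball (0 : ℂ) 1, 0 ≤ (q z).re)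
    (hq0 : q 0 = 1) :
    0 ≤ ∑ i ∈ Finset.range n, (-lam (i + 1) * (‖e (i + 1)‖ ^ 2 - 4) + 2 * p (i + 1) *
      (starRingEnd ℂ (e (i + 1)) *
        ∑ j ∈ Finset.range (i + 2), taylorCoeff q j * e (i + 1 - j)).re) := by
  set A : ℝ := ∑ i ∈ Finset.range n, (-lam (i + 1) * (‖e (i + 1)‖ ^ 2 - 4) + 2 * p (i + 1) *
      (starRingEnd ℂ (e (i + 1)) * e (i + 1)).re) with hA
  set w : ℕ → ℂ := fun m => ∑ i ∈ Finset.range n, (2 * p (i + 1) : ℝ) *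
    (starRingEnd ℂ (e (i + 1)) * if m < i + 1 then e (i - m) else 0) with hw
  have expand : ∀ x : ℕ → ℂ, A + ∑ m ∈ Finset.range n, (w m * x m).re =
      ∑ i ∈ Finset.range n, (-lam (i + 1) * (‖e (i + 1)‖ ^ 2 - 4) + 2 * p (i + 1) *
      (starRingEnd ℂ (e (i + 1)) * (e (i + 1) +
        ∑ m ∈ Finset.range (i + 1), x m * e (i - m))).re) := by
    intro x
    simp only [hw, Finset.sum_mul, re_sum]
    rw [Finset.sum_comm, hA, ← Finset.sum_add_distrib]
    refine Finset.sum_congr rfl fun i hi => ?_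
    have hi := Finset.mem_range.1 hi
    rw [mul_add (starRingEnd ℂ (e (i + 1))), add_re, mul_add (2 * p (i + 1)), ← add_assoc]
    congr 1
    rw [← Complex.re_ofReal_mul, Finset.mul_sum, Finset.mul_sum, re_sum]
    symm
    refine Finset.sum_subset_zero_on_sdiff ?_ ?_ ?_
    · intro m hm; have := Finset.mem_range.1 hm; exact Finset.mem_range.2 (by omega)
    · intro m hm
      simp only [Finset.mem_sdiff, Finset.mem_range] at hm
      rw [if_neg (by omega)]; simp
    · intro m hm
      rw [if_pos (Finset.mem_range.1 hm)]
      congr 1; ring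
  have key := nonneg_of_trig_nonneg (A := A) (w := w) (n := n) ?_ hq hre hq0
  · rw [expand fun m => taylorCoeff q (m + 1)] at key
    refine key.trans_eq (Finset.sum_congr rfl fun i _ => ?_)
    rw [Finset.sum_range_succ' _ (i + 1), taylorCoeff_zero, hq0]
    congr 4
    rw [add_comm]
    simp
  · intro κ hκ
    have h := point_ineq hlam hrel hp hl he hκ
    refine h.trans_eq ?_
    have := expand fun m => 2 * κ ^ (m + 1)
    rw [Finset.mul_sum]
    have e1 : ∀ m, (w m * (2 * κ ^ (m + 1))).re = 2 * (w m * κ ^ (m + 1)).re := by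
      intro m
      rw [show w m * (2 * κ ^ (m + 1)) = ((2 : ℝ) : ℂ) * (w m * κ ^ (m + 1)) by push_cast; ring,
        Complex.re_ofReal_mul]
    simp only [e1] at this
    rw [this]
    simp only [Finset.mul_sum, mul_assoc]

lemma norm_sub_sub_mul_deriv_le {g : ℂ → ℂ} {C : ℝ} (hg : DifferentiableOn ℂ g (ball 0 (1 / 4)))
    (hC : ∀ u ∈ ball (0 : ℂ) (1 / 4), ‖g u‖ ≤ C) {u : ℂ} (hu : u ∈ ball (0 : ℂ) (1 / 4)) :
    ‖g u - g 0 - u * deriv g 0‖ ≤ 64 * C * ‖u‖ ^ 2 := by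
  have h0 : (0 : ℂ) ∈ ball (0 : ℂ) (1 / 4) := mem_ball_self (by norm_num)
  have hd0 : ‖deriv g 0‖ ≤ 2 * C / (1 / 4) := by
    refine Complex.norm_deriv_le_div_of_mapsTo_ball hg ?_ (by norm_num)
    intro z hz
    rw [mem_closedBall, dist_eq_norm]
    linarith [norm_sub_le (g z) (g 0), hC z hz, hC 0 h0]
  set F : ℂ → ℂ := fun z => g z - g 0 - z * deriv g 0 with hF
  have hF0 : F 0 = 0 := by simp [hF]
  have hmaps : MapsTo F (ball 0 (1 / 4)) (closedBall (F 0) (4 * C)) := by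
    intro z hz
    rw [hF0, mem_closedBall, dist_zero_right]
    have h1 : ‖z * deriv g 0‖ ≤ 1 / 4 * (2 * C / (1 / 4)) := by
      rw [norm_mul]
      have : ‖z‖ ≤ 1 / 4 := (mem_ball_zero_iff.1 hz).le
      gcongr
    have h2 : ‖F z‖ ≤ ‖g z - g 0‖ + ‖z * deriv g 0‖ := norm_sub_le _ _
    linarith [norm_sub_le (g z) (g 0), hC z hz, hC 0 h0]
  have hFd : DifferentiableOn ℂ F (ball 0 (1 / 4)) := by
    refine (hg.sub_const _).sub ?_
    fun_prop
  have hlo : (fun z => F z - F 0) =o[𝓝 0] (fun w : ℂ => ‖w - 0‖ ^ 1) := by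
    have hgd := (hg.differentiableAt (ball_mem_nhds _ (by norm_num))).hasDerivAt (x := (0 : ℂ))
    have := hgd.isLittleO
    simp only [pow_one, sub_zero, hF] at *
    refine Asymptotics.IsLittleO.congr_left this.norm_right ?_
    intro z
    simp
  have := Complex.dist_le_mul_div_pow_of_mapsTo_ball_of_isLittleO hFd hmaps hlo hu
  rw [hF0, dist_zero_right, dist_zero_right] at this
  calc _ ≤ _ := this
    _ = _ := by ring

lemma norm_le_five {q : ℂ → ℂ} (hq : DifferentiableOn ℂ q (ball 0 1))
    (hre : ∀ z ∈ ball (0 : ℂ) 1, 0 ≤ (q z).re) (hq0 : q 0 = 1) {z : ℂ} (hz : ‖z‖ ≤ 1 / 2) :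
    ‖q z‖ ≤ 5 := by
  have h := Complex.borelCaratheodory (M := 1) (f := fun z => - q z) (R := 1) (z := z) one_pos hq.neg
    ?_ one_pos (mem_ball_zero_iff.2 (by linarith))
  · rw [norm_neg, norm_neg, hq0, norm_one] at h
    have h1 : 0 < 1 - ‖z‖ := by linarith
    rw [← add_div, le_div_iff₀ h1] at h
    by_contra hc
    push Not at hc
    nlinarith
  · intro z hz
    have := hre z hz
    simp only [Set.mem_ofPred_eq, neg_re]
    linarith

section Weights

open Polynomial

lemma exists_bound_eval (P : ℝ[X]) : ∃ B : ℝ, ∀ a : ℝ, 0 ≤ a → a ≤ 1 → |P.eval a| ≤ B := by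
  obtain ⟨B, hB⟩ := (isCompact_Icc (a := (0 : ℝ)) (b := 1)).exists_bound_of_continuousOn
    P.continuous.continuousOn
  exact ⟨B, fun a h0 h1 => hB a ⟨h0, h1⟩⟩

lemma abs_exp_sub_one_sub_le {x : ℝ} (hx : 0 ≤ x) : |Real.exp x - 1 - x| ≤ x ^ 2 * Real.exp x := by
  have h := Complex.norm_exp_sub_sum_le_norm_mul_exp (x : ℂ) 2
  simp only [Finset.sum_range_succ, Finset.sum_range_zero, Complex.norm_real,
    Real.norm_of_nonneg hx] at h
  rw [← Real.norm_eq_abs, ← Complex.norm_real]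
  convert h using 2
  push_cast
  simp
  ring

lemma exists_second_order (P : ℝ[X]) : ∃ B : ℝ, ∀ a h : ℝ, 0 ≤ a → a ≤ 1 → 0 ≤ h → h ≤ 1 →
    |P.eval (a * Real.exp h) - P.eval a - h * (X * derivative P).eval a| ≤ B * h ^ 2 := by
  induction P using Polynomial.induction_on' with
  | add p q hp hq =>
    obtain ⟨B1, h1⟩ := hp
    obtain ⟨B2, h2⟩ := hq
    refine ⟨B1 + B2, fun a h ha ha1 hh hh1 => ?_⟩
    have e : (p + q).eval (a * Real.exp h) - (p + q).eval a - h * (X * derivative (p + q)).eval a =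
      (p.eval (a * Real.exp h) - p.eval a - h * (X * derivative p).eval a) +
      (q.eval (a * Real.exp h) - q.eval a - h * (X * derivative q).eval a) := by
      simp only [derivative_add, mul_add, eval_add]; ring
    rw [e, add_mul]
    exact (abs_add_le _ _).trans (add_le_add (h1 a h ha ha1 hh hh1) (h2 a h ha ha1 hh hh1))
  | monomial m c =>
    refine ⟨|c| * m ^ 2 * Real.exp m, fun a h ha ha1 hh hh1 => ?_⟩
    have e : (monomial m c).eval (a * Real.exp h) - (monomial m c).eval a -
        h * (X * derivative (monomial m c)).eval a =
        c * a ^ m * (Real.exp (m * h) - 1 - m * h) := by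
      rcases m with _ | m
      · simp
      · simp only [eval_monomial, derivative_monomial, eval_mul, eval_X, mul_pow, ← Real.exp_nat_mul]
        simp only [add_tsub_cancel_right]
        push_cast
        ring
    rw [e, abs_mul, abs_mul, abs_of_nonneg (pow_nonneg ha m)]
    have hmh : (0 : ℝ) ≤ m * h := by positivity
    have h1 := abs_exp_sub_one_sub_le hmh
    have h2 : a ^ m ≤ 1 := pow_le_one₀ ha ha1
    have h3 : Real.exp (m * h) ≤ Real.exp m := by
      apply Real.exp_le_exp.2
      nlinarith [(Nat.cast_nonneg m : (0 : ℝ) ≤ m)]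
    calc |c| * a ^ m * |Real.exp (m * h) - 1 - m * h|
        ≤ |c| * 1 * ((m * h) ^ 2 * Real.exp m) := by
          gcongr
          exact h1.trans (by gcongr)
      _ = _ := by ring

end Weights

lemma le_of_le_add_sq {u : ℝ → ℝ} {C δ T : ℝ} (hδ : 0 < δ) (hT : 0 ≤ T)
    (h : ∀ s s', 0 ≤ s → s ≤ s' → s' - s ≤ δ → u s ≤ u s' + C * (s' - s) ^ 2) : u 0 ≤ u T := by
  have step : ∀ N : ℕ, ∀ η : ℝ, 0 ≤ η → η ≤ δ → u 0 ≤ u (N * η) + N * (C * η ^ 2) := by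
    intro N η h0 h1
    induction N with
    | zero => simp
    | succ N ih =>
      have := h (N * η) ((N + 1 : ℕ) * η) (by positivity) (by push_cast; nlinarith)
        (by push_cast; linarith)
      push_cast at this ⊢
      have e : (N + 1 : ℝ) * η - N * η = η := by ring
      rw [e] at this
      linarith
  have hlim : Tendsto (fun N : ℕ => u T + C * T ^ 2 * (1 / ((N : ℝ) + 1))) atTop
      (𝓝 (u T + C * T ^ 2 * 0)) :=
    tendsto_const_nhds.add (tendsto_const_nhds.mul tendsto_one_div_add_atTop_nhds_zero_nat)
  rw [mul_zero, add_zero] at hlim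
  refine ge_of_tendsto hlim ?_
  obtain ⟨N0, hN0⟩ := exists_nat_gt (T / δ)
  filter_upwards [eventually_ge_atTop N0] with N hN
  have hN' : (0 : ℝ) < (N : ℝ) + 1 := by positivity
  have h1 : T / (N + 1) ≤ δ := by
    rw [div_le_iff₀ hN']
    rw [div_lt_iff₀ hδ] at hN0
    have : (N0 : ℝ) ≤ N := by exact_mod_cast hN
    nlinarith
  have := step (N + 1) (T / (N + 1)) (by positivity) h1
  refine this.trans_eq ?_
  push_cast
  rw [mul_div_cancel₀ _ hN'.ne']
  field_simp

/-- Second-order expansion of one summand of the de Branges functional. -/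
lemma weight_step {k B h T lam ρ : ℝ} {x y ε : ℂ} (hk : 1 ≤ k) (hkB : k ≤ B) (hh : 0 ≤ h)
    (hh1 : h ≤ 1)
    (hT : |T| ≤ B) (hlam : |lam| ≤ B) (hρ : |ρ| ≤ B * h ^ 2) (hx : ‖x‖ ≤ B) (hy : ‖y‖ ≤ B)
    (hε : ‖ε‖ ≤ B * h ^ 2) :
    (T + h * (k * lam) + ρ) * (k * ‖x - h * y + ε‖ ^ 2 - 4 / k) ≤
      T * (k * ‖x‖ ^ 2 - 4 / k) - h * (-lam * (‖k * x‖ ^ 2 - 4) + 2 * T *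
        (starRingEnd ℂ (k * x) * y).re) + 100 * B ^ 5 * h ^ 2 := by
  have hB : 1 ≤ B := hk.trans hkB
  have hk0 : 0 < k := by linarith
  have h2 : h ^ 2 ≤ h := by nlinarith
  set w : ℂ := h * y - ε with hw
  have hwn : ‖w‖ ≤ 2 * B * h := by
    have h3 : ‖(h : ℂ) * y‖ ≤ h * B := by
      rw [norm_mul, Complex.norm_real, Real.norm_of_nonneg hh]
      gcongr
    have := norm_sub_le ((h : ℂ) * y) ε
    nlinarith
  set m : ℝ := (starRingEnd ℂ x * y).re with hm
  set R : ℝ := ‖w‖ ^ 2 + 2 * (starRingEnd ℂ x * ε).re with hR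
  have hc : ‖x - h * y + ε‖ ^ 2 = ‖x‖ ^ 2 - 2 * h * m + R := by
    simp only [hR, hm, hw, ← Complex.normSq_eq_norm_sq, Complex.normSq_apply]
    simp
    ring
  have hmB : |m| ≤ B ^ 2 := by
    refine (Complex.abs_re_le_norm _).trans ?_
    rw [norm_mul, RCLike.norm_conj, sq]
    gcongr
  have hRB : |R| ≤ 6 * B ^ 2 * h ^ 2 := by
    have h3 : |(starRingEnd ℂ x * ε).re| ≤ B * (B * h ^ 2) := by
      refine (Complex.abs_re_le_norm _).trans ?_
      rw [norm_mul, RCLike.norm_conj]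
      gcongr
    have h4 : ‖w‖ ^ 2 ≤ (2 * B * h) ^ 2 := by gcongr
    have h5 := abs_add_le (‖w‖ ^ 2) (2 * (starRingEnd ℂ x * ε).re)
    rw [abs_mul, abs_two, abs_of_nonneg (sq_nonneg ‖w‖)] at h5
    nlinarith
  have hcn : ‖x - h * y + ε‖ ≤ 3 * B := by
    have : x - h * y + ε = x - w := by rw [hw]; ring
    rw [this]
    have := norm_sub_le x w
    nlinarith
  have e1 : |T * (k * R)| ≤ 6 * B ^ 5 * h ^ 2 := by
    rw [abs_mul, abs_mul, abs_of_pos hk0]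
    calc |T| * (k * |R|) ≤ B * (B * (6 * B ^ 2 * h ^ 2)) := by gcongr
      _ = 6 * (B ^ 4 * h ^ 2) := by ring
      _ ≤ 6 * (B ^ 5 * h ^ 2) := by gcongr; norm_num
      _ = _ := by ring
  have e2 : |h * (k * lam) * (k * (R - 2 * h * m))| ≤ 8 * B ^ 5 * h ^ 2 := by
    have h3 : |R - 2 * h * m| ≤ 8 * B ^ 2 * h := by
      have h4 := abs_sub R (2 * h * m)
      rw [abs_mul (2 * h), abs_of_nonneg (by positivity : 0 ≤ 2 * h)] at h4
      have h6 : h * |m| ≤ h * B ^ 2 := by gcongr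
      have h7 : B ^ 2 * h ^ 2 ≤ B ^ 2 * h := by gcongr
      nlinarith
    rw [abs_mul, abs_mul, abs_mul, abs_mul, abs_of_pos hk0, abs_of_nonneg hh]
    calc h * (k * |lam|) * (k * |R - 2 * h * m|) ≤ h * (B * B) * (B * (8 * B ^ 2 * h)) := by gcongr
      _ = _ := by ring
  have e3 : |ρ * (k * ‖x - h * y + ε‖ ^ 2 - 4 / k)| ≤ 13 * B ^ 5 * h ^ 2 := by
    have h3 : 4 / k ≤ 4 * B ^ 3 := by
      have : 4 / k ≤ 4 := by rw [div_le_iff₀ hk0]; linarith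
      have : 1 ≤ B ^ 3 := one_le_pow₀ hB
      linarith
    have h4 : k * ‖x - h * y + ε‖ ^ 2 ≤ B * (3 * B) ^ 2 := by gcongr
    have h5 : |k * ‖x - h * y + ε‖ ^ 2 - 4 / k| ≤ 13 * B ^ 3 := by
      have h6 : 0 ≤ 4 / k := by positivity
      have h7 : 0 ≤ k * ‖x - h * y + ε‖ ^ 2 := by positivity
      rw [abs_le]
      constructor <;> nlinarith
    rw [abs_mul]
    calc |ρ| * |k * ‖x - h * y + ε‖ ^ 2 - 4 / k| ≤ B * h ^ 2 * (13 * B ^ 3) := by gcongr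
      _ = 13 * (B ^ 4 * h ^ 2) := by ring
      _ ≤ 13 * (B ^ 5 * h ^ 2) := by gcongr; norm_num
      _ = _ := by ring
  have e4 : (T + h * (k * lam) + ρ) * (k * ‖x - h * y + ε‖ ^ 2 - 4 / k) =
      T * (k * ‖x‖ ^ 2 - 4 / k) - h * (-lam * (‖k * x‖ ^ 2 - 4) + 2 * T *
        (starRingEnd ℂ (k * x) * y).re) + (T * (k * R) + h * (k * lam) * (k * (R - 2 * h * m)) +
        ρ * (k * ‖x - h * y + ε‖ ^ 2 - 4 / k)) := by
    have h3 : (starRingEnd ℂ (k * x) * y).re = k * m := by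
      rw [map_mul, Complex.conj_ofReal, mul_assoc, Complex.re_ofReal_mul]
    rw [h3, norm_mul, Complex.norm_real, Real.norm_of_nonneg hk0.le, add_mul (T + _), hc]
    field_simp
    ring
  rw [e4]
  have h8 : 0 ≤ B ^ 5 * h ^ 2 := by positivity
  linarith [(abs_le.1 e1).2, (abs_le.1 e2).2, (abs_le.1 e3).2]

lemma norm_mul_exp_neg_le {h : ℝ} (hh : 0 ≤ h) {w : ℂ} (hw : 0 ≤ w.re) (z : ℂ) :
    ‖z * cexp (-(h : ℂ) * w)‖ ≤ ‖z‖ := by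
  rw [norm_mul, Complex.norm_exp]
  have : (-(h : ℂ) * w).re ≤ 0 := by
    rw [← ofReal_neg, re_ofReal_mul]
    nlinarith
  exact mul_le_of_le_one_right (norm_nonneg _) (Real.exp_le_one_iff.2 this)

lemma norm_sub_add_mul_deriv_le {M : ℂ → ℂ} {C0 : ℝ} (hM : DifferentiableOn ℂ M (ball 0 1))
    (hC : ∀ z : ℂ, ‖z‖ ≤ 3 / 4 → ‖M z‖ ≤ C0) {z u : ℂ} (hz : ‖z‖ ≤ 1 / 2) (hu : ‖u‖ < 1 / 4) :
    ‖M (z * cexp (-u)) - M z + u * (z * deriv M z)‖ ≤ 64 * C0 * ‖u‖ ^ 2 := by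
  have hin : ∀ v ∈ ball (0 : ℂ) (1 / 4), ‖z * cexp (-v)‖ ≤ 3 / 4 := by
    intro v hv
    rw [mem_ball_zero_iff] at hv
    rw [norm_mul, Complex.norm_exp, neg_re]
    have h1 : -v.re ≤ 1 / 4 := by
      have := (abs_le.1 (Complex.abs_re_le_norm v)).1
      linarith
    have h2 : Real.exp (1 / 4) ≤ 3 / 2 := by
      have h3 : Real.exp (1 / 4) ^ 4 = Real.exp 1 := by
        rw [← Real.exp_nat_mul]; norm_num
      have h4 := Real.exp_one_lt_d9
      by_contra hc
      push Not at hc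
      have : (3 / 2 : ℝ) ^ 4 < Real.exp (1 / 4) ^ 4 := by gcongr
      norm_num at this h3 h4
      linarith
    calc ‖z‖ * Real.exp (-v.re) ≤ 1 / 2 * (3 / 2) := by
          gcongr
          exact (Real.exp_le_exp.2 h1).trans h2
      _ = 3 / 4 := by norm_num
  have hd : DifferentiableOn ℂ (fun v => M (z * cexp (-v))) (ball 0 (1 / 4)) := by
    refine hM.comp (t := ball 0 1) (by fun_prop) ?_
    intro v hv
    rw [mem_ball_zero_iff]
    linarith [hin v hv]
  have hder : deriv (fun v => M (z * cexp (-v))) 0 = - (z * deriv M z) := by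
    have h1 : HasDerivAt (fun v : ℂ => z * cexp (-v)) (-z) 0 := by
      have := ((hasDerivAt_id (0 : ℂ)).neg.cexp).const_mul z
      simpa using this
    have h2 : HasDerivAt M (deriv M z) (z * cexp (-0)) := by
      simp only [neg_zero, Complex.exp_zero, mul_one]
      exact (hM.differentiableAt (isOpen_ball.mem_nhds (by
        rw [mem_ball_zero_iff]; linarith))).hasDerivAt
    have h3 := (HasDerivAt.comp (0 : ℂ) h2 h1).deriv
    rw [Function.comp_def] at h3
    rw [h3]
    ring
  have := norm_sub_sub_mul_deriv_le hd (fun v hv => hC _ (hin v hv)) (mem_ball_zero_iff.2 hu)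
  rw [hder] at this
  simp only [neg_zero, Complex.exp_zero, mul_one] at this
  convert this using 2
  ring

lemma norm_taylorCoeff_step_le {M q : ℂ → ℂ} {C0 h : ℝ} (hM : DifferentiableOn ℂ M (ball 0 1))
    (hC : ∀ z : ℂ, ‖z‖ ≤ 3 / 4 → ‖M z‖ ≤ C0) (hq : DifferentiableOn ℂ q (ball 0 1))
    (hre : ∀ z ∈ ball (0 : ℂ) 1, 0 ≤ (q z).re) (hq0 : q 0 = 1) (hh : 0 ≤ h) (hh1 : h < 1 / 20)
    {k : ℕ} (hk : k ≠ 0) :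
    ‖taylorCoeff (fun z => h * (1 - q z) + M (z * cexp (-(h : ℂ) * q z))) k -
      (taylorCoeff M k - h * taylorCoeff (fun z => q z * (1 + z * deriv M z)) k)‖ ≤
      1600 * C0 * h ^ 2 * 2 ^ k := by
  have hd1 : DifferentiableOn ℂ (fun z => M (z * cexp (-(h : ℂ) * q z))) (ball 0 1) := by
    refine hM.comp (t := ball 0 1) (by fun_prop) ?_
    intro z hz
    rw [mem_ball_zero_iff] at hz ⊢
    exact (norm_mul_exp_neg_le hh (hre z (mem_ball_zero_iff.2 hz)) z).trans_lt hz
  have hd2 : DifferentiableOn ℂ (deriv M) (ball 0 1) := hM.deriv isOpen_ball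
  have hG : DifferentiableOn ℂ (fun z => h * (1 - q z) + M (z * cexp (-(h : ℂ) * q z)))
    (ball 0 1) := DifferentiableOn.add (by fun_prop) hd1
  have hQ : DifferentiableOn ℂ (fun z => q z * (1 + z * deriv M z)) (ball 0 1) := by fun_prop
  have hC' : ∀ w ∈ sphere (0 : ℂ) (1 / 2),
      ‖M (w * cexp (-(h * q w))) - M w + (h * q w) * (w * deriv M w)‖ ≤ 1600 * C0 * h ^ 2 := by
    intro w hw
    have hw' : ‖w‖ = 1 / 2 := by simpa using hw
    have hq5 := norm_le_five hq hre hq0 hw'.le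
    have hu : ‖(h : ℂ) * q w‖ ≤ h * 5 := by
      rw [norm_mul, Complex.norm_real, Real.norm_of_nonneg hh]
      gcongr
    have := norm_sub_add_mul_deriv_le hM hC hw'.le (u := h * q w) (by linarith)
    have hC0 : 0 ≤ C0 := (norm_nonneg _).trans (hC 0 (by norm_num))
    refine this.trans ?_
    calc 64 * C0 * ‖(h : ℂ) * q w‖ ^ 2 ≤ 64 * C0 * (h * 5) ^ 2 := by gcongr
      _ = _ := by ring
  have hE : DifferentiableOn ℂ
      (fun w => M (w * cexp (-(h * q w))) - M w + (h * q w) * (w * deriv M w)) (ball 0 1) := by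
    have : DifferentiableOn ℂ (fun z => M (z * cexp (-(h * q z)))) (ball 0 1) := by
      simpa only [neg_mul] using hd1
    exact (this.sub hM).add (by fun_prop)
  have hb := norm_taylorCoeff_le (r := 1 / 2) (C := 1600 * C0 * h ^ 2) (by norm_num) (by norm_num)
    hE (by simpa using hC') (n := k)
  have heq : taylorCoeff (fun z => h * (1 - q z) + M (z * cexp (-(h : ℂ) * q z))) k -
      (taylorCoeff M k - h * taylorCoeff (fun z => q z * (1 + z * deriv M z)) k) =
      taylorCoeff
        (fun w => M (w * cexp (-(h * q w))) - M w + (h * q w) * (w * deriv M w)) k := by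
    have aG := analyticAt_zero hG
    have aM := analyticAt_zero hM
    have aQ := analyticAt_zero hQ
    obtain ⟨k, rfl⟩ := Nat.exists_eq_succ_of_ne_zero hk
    have h1 := taylorCoeff_sub (n := k + 1) aG (aM.sub (aQ.const_smul (c := (h : ℂ))))
    have h2 := taylorCoeff_sub (n := k + 1) aM (aQ.const_smul (c := (h : ℂ)))
    have h3 := taylorCoeff_sub (n := k + 1) (aG.sub (aM.sub (aQ.const_smul (c := (h : ℂ)))))
      (analyticAt_const (v := (h : ℂ)))
    simp only [Pi.sub_apply, Pi.smul_apply, smul_eq_mul] at h1 h2 h3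
    have h4 : taylorCoeff ((h : ℂ) • fun z => q z * (1 + z * deriv M z)) (k + 1) =
      h * taylorCoeff (fun z => q z * (1 + z * deriv M z)) (k + 1) := taylorCoeff_const_mul _
    rw [taylorCoeff_const, sub_zero] at h3
    change taylorCoeff _ _ = taylorCoeff _ _ - taylorCoeff (fun z => M z - _) _ at h1
    simp only [Pi.smul_apply, smul_eq_mul] at h1
    rw [h2, h4] at h1
    rw [← h1]
    refine h3.symm.trans (taylorCoeff_congr_ball fun z _ => ?_)
    simp only [neg_mul]
    ring
  rw [heq]
  refine hb.trans_eq ?_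
  rw [one_div, inv_pow, div_inv_eq_mul]

lemma norm_taylorCoeff_mul_one_add_le {M q : ℂ → ℂ} {C0 : ℝ}
    (hM : DifferentiableOn ℂ M (ball 0 1))
    (hC : ∀ z : ℂ, ‖z‖ ≤ 3 / 4 → ‖M z‖ ≤ C0) (hq : DifferentiableOn ℂ q (ball 0 1))
    (hre : ∀ z ∈ ball (0 : ℂ) 1, 0 ≤ (q z).re) (hq0 : q 0 = 1) (k : ℕ) :
    ‖taylorCoeff (fun z => q z * (1 + z * deriv M z)) k‖ ≤ 5 * (1 + 2 * C0) * 2 ^ k := by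
  have hd2 : DifferentiableOn ℂ (deriv M) (ball 0 1) := hM.deriv isOpen_ball
  have hQ : DifferentiableOn ℂ (fun z => q z * (1 + z * deriv M z)) (ball 0 1) := by fun_prop
  have hb := norm_taylorCoeff_le (r := 1 / 2) (C := 5 * (1 + 2 * C0)) (by norm_num) (by norm_num)
    hQ ?_ (n := k)
  · refine hb.trans_eq ?_
    rw [one_div, inv_pow, div_inv_eq_mul]
  intro z hz
  have hz' : ‖z‖ = 1 / 2 := by simpa using hz
  have hsub : closedBall z (1 / 4) ⊆ closedBall 0 (3 / 4) :=
    closedBall_subset_closedBall' (by rw [dist_zero_right, hz']; norm_num)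
  have h1 : ‖deriv M z‖ ≤ C0 / (1 / 4) := by
    refine Complex.norm_deriv_le_of_forall_mem_sphere_norm_le (by norm_num) ?_ ?_
    · refine (hM.mono ?_).diffContOnCl
      refine closure_ball_subset_closedBall.trans (hsub.trans (closedBall_subset_ball (by norm_num)))
    · intro w hw
      exact hC w (mem_closedBall_zero_iff.1 (hsub (sphere_subset_closedBall hw)))
  have h2 : ‖1 + z * deriv M z‖ ≤ 1 + 2 * C0 := by
    refine (norm_add_le _ _).trans ?_
    rw [norm_one, norm_mul, hz']
    linarith
  rw [norm_mul]
  exact mul_le_mul (norm_le_five hq hre hq0 hz'.le) h2 (norm_nonneg _) (by norm_num)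

theorem milin_of_chain {L : ℝ → ℂ → ℂ} {C0 : ℝ}
    (hL : ∀ s, 0 ≤ s → DifferentiableOn ℂ (L s) (ball 0 1))
    (hC : ∀ s, 0 ≤ s → ∀ z : ℂ, ‖z‖ ≤ 3 / 4 → ‖L s z‖ ≤ C0)
    (hsub : ∀ s s', 0 ≤ s → s ≤ s' → ∃ q : ℂ → ℂ, DifferentiableOn ℂ q (ball 0 1) ∧
      (∀ z ∈ ball (0 : ℂ) 1, 0 ≤ (q z).re) ∧ q 0 = 1 ∧
      ∀ z ∈ ball (0 : ℂ) 1, L s z =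
        ((s' - s : ℝ) : ℂ) * (1 - q z) + L s' (z * cexp (-((s' - s : ℝ) : ℂ) * q z)))
    (n : ℕ) :
    ∑ k ∈ Finset.range n,
      ((n : ℝ) - k) * ((k + 1) * ‖taylorCoeff (L 0) (k + 1)‖ ^ 2 - 4 / (k + 1)) ≤ 0 := by
  obtain ⟨P, Q, hPQ, hrel, hPn, hQn, hP1, hP0, hQpos⟩ := exists_weights n
  choose BP hBP using fun k => exists_bound_eval (P k)
  choose BQ hBQ using fun k => exists_bound_eval (Q k)
  choose BS hBS using fun k => exists_second_order (P k)
  have hC0 : 0 ≤ C0 := (norm_nonneg _).trans (hC 0 le_rfl 0 (by norm_num))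
  set S : ℝ := ∑ k ∈ Finset.range (n + 1), (|BP k| + |BQ k| + |BS k|) with hS
  have hS0 : 0 ≤ S := Finset.sum_nonneg fun k _ => by positivity
  have hSk : ∀ k ≤ n, |BP k| + |BQ k| + |BS k| ≤ S := fun k hk =>
    Finset.single_le_sum (f := fun k => |BP k| + |BQ k| + |BS k|)
      (fun k _ => by positivity) (Finset.mem_range.2 (Nat.lt_succ_of_le hk))
  set B : ℝ := 1 + n + S + (5 + 1600 * C0) * 2 ^ n with hB
  have hcoef : ∀ k ≤ n, (5 + 1600 * C0) * 2 ^ k ≤ B := fun k hk => by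
    have : (5 + 1600 * C0) * 2 ^ k ≤ (5 + 1600 * C0) * (2 : ℝ) ^ n := by
      gcongr
      norm_num
    have : (0 : ℝ) ≤ n := by positivity
    linarith
  have hSB : S ≤ B := by
    have : (0 : ℝ) ≤ n := by positivity
    have : 0 ≤ (5 + 1600 * C0) * (2 : ℝ) ^ n := by positivity
    linarith
  have hx : ∀ s, 0 ≤ s → ∀ k ≤ n, ‖taylorCoeff (L s) k‖ ≤ B := by
    intro s hs k hk
    have hb := norm_taylorCoeff_le (r := 1 / 2) (C := C0) (by norm_num) (by norm_num)
      (hL s hs) (fun z hz => hC s hs z (by rw [mem_sphere_zero_iff_norm.1 hz]; norm_num)) (n := k)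
    rw [one_div, inv_pow, div_inv_eq_mul] at hb
    refine (hb.trans ?_).trans (hcoef k hk)
    gcongr
    linarith
  set u : ℝ → ℝ := fun s => ∑ i ∈ Finset.range n, (P (i + 1)).eval (Real.exp (-s)) *
    ((i + 1) * ‖taylorCoeff (L s) (i + 1)‖ ^ 2 - 4 / (i + 1)) with hu
  have hu0 : u 0 = ∑ k ∈ Finset.range n,
      ((n : ℝ) - k) * ((k + 1) * ‖taylorCoeff (L 0) (k + 1)‖ ^ 2 - 4 / (k + 1)) := by
    refine Finset.sum_congr rfl fun i hi => ?_
    rw [neg_zero, Real.exp_zero, hP1 (i + 1) (by simp at hi; omega)]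
    push_cast
    ring
  have hstep : ∀ s s', 0 ≤ s → s ≤ s' → s' - s ≤ 1 / 40 →
      u s ≤ u s' + (n * (100 * B ^ 5)) * (s' - s) ^ 2 := by
    intro s s' hs hss hh
    have hs' : 0 ≤ s' := hs.trans hss
    obtain ⟨q, hq, hre, hq0, hLs⟩ := hsub s s' hs hss
    set h : ℝ := s' - s with hh_def
    have hh0 : 0 ≤ h := sub_nonneg.2 hss
    set a : ℝ := Real.exp (-s') with ha
    have ha0 : 0 ≤ a := (Real.exp_pos _).le
    have ha1 : a ≤ 1 := Real.exp_le_one_iff.2 (by linarith)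
    have hexp : Real.exp (-s) = a * Real.exp h := by
      rw [ha, ← Real.exp_add]; congr 1; rw [hh_def]; ring
    have aM := analyticAt_zero (hL s' hs')
    have aq := analyticAt_zero hq
    have aZ : AnalyticAt ℂ (fun z => z * deriv (L s') z) 0 := analyticAt_id.mul aM.deriv
    have aE : AnalyticAt ℂ (fun z => 1 + z * deriv (L s') z) 0 := analyticAt_const.add aZ
    set e : ℕ → ℂ := taylorCoeff (fun z => 1 + z * deriv (L s') z) with he
    have he0 : e 0 = 1 := by simp [he, taylorCoeff_zero]
    have hei : ∀ i : ℕ, e (i + 1) = ((i + 1 : ℝ) : ℂ) * taylorCoeff (L s') (i + 1) := by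
      intro i
      rw [he, taylorCoeff_add (f := fun _ => (1 : ℂ)) analyticAt_const aZ, taylorCoeff_const,
        zero_add, taylorCoeff_id_mul_deriv aM]
      push_cast
      ring
    have hW := weighted_ineq (n := n) (p := fun k => (P k).eval a) (lam := fun k => (Q k).eval a)
      (fun k => hQpos k a ha0 ha1)
      (fun i hi => by
        have := congrArg (Polynomial.eval a) (hrel (i + 1) hi)
        simpa using this) (by simp [hPn]) (by simp [hQn]) he0 hq hre hq0
    have hterm : ∀ i ∈ Finset.range n, (P (i + 1)).eval (Real.exp (-s)) *
        ((i + 1) * ‖taylorCoeff (L s) (i + 1)‖ ^ 2 - 4 / (i + 1)) ≤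
        (P (i + 1)).eval a *
        ((i + 1) * ‖taylorCoeff (L s') (i + 1)‖ ^ 2 - 4 / (i + 1)) -
        h * (-(Q (i + 1)).eval a * (‖e (i + 1)‖ ^ 2 - 4) + 2 * (P (i + 1)).eval a *
          (starRingEnd ℂ (e (i + 1)) * ∑ j ∈ Finset.range (i + 2),
            taylorCoeff q j * e (i + 1 - j)).re) + 100 * B ^ 5 * h ^ 2 := by
      intro i hi
      have hin : i + 1 ≤ n := Finset.mem_range.1 hi
      have hy : ∑ j ∈ Finset.range (i + 2), taylorCoeff q j * e (i + 1 - j) =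
          taylorCoeff (fun z => q z * (1 + z * deriv (L s') z)) (i + 1) :=
        (taylorCoeff_mul aq aE).symm
      have hder : (Polynomial.X * Polynomial.derivative (P (i + 1))).eval a =
          ((i : ℝ) + 1) * (Q (i + 1)).eval a := by
        rw [hPQ, Polynomial.eval_mul, Polynomial.eval_C]
        push_cast
        ring
      have hρ := hBS (i + 1) a h ha0 ha1 hh0 (by linarith)
      rw [hder, ← hexp] at hρ
      have hε := norm_taylorCoeff_step_le (hL s' hs') (hC s' hs') hq hre hq0 hh0 (by linarith)
        (k := i + 1) (by omega)
      rw [← taylorCoeff_congr_ball hLs] at hε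
      have hyB := norm_taylorCoeff_mul_one_add_le (hL s' hs') (hC s' hs') hq hre hq0 (i + 1)
      have hBi := hcoef (i + 1) hin
      have hSi := hSk (i + 1) hin
      have p1 := abs_nonneg (BP (i + 1))
      have p2 := abs_nonneg (BQ (i + 1))
      have p3 := abs_nonneg (BS (i + 1))
      have l1 := le_abs_self (BP (i + 1))
      have l2 := le_abs_self (BQ (i + 1))
      have l3 := le_abs_self (BS (i + 1))
      have key := weight_step (k := (i : ℝ) + 1) (B := B) (h := h) (T := (P (i + 1)).eval a)
        (lam := (Q (i + 1)).eval a) (x := taylorCoeff (L s') (i + 1))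
        (y := taylorCoeff (fun z => q z * (1 + z * deriv (L s') z)) (i + 1))
        (ρ := (P (i + 1)).eval (Real.exp (-s)) - (P (i + 1)).eval a -
          h * ((i + 1) * (Q (i + 1)).eval a))
        (ε := taylorCoeff (L s) (i + 1) - (taylorCoeff (L s') (i + 1) -
          h * taylorCoeff (fun z => q z * (1 + z * deriv (L s') z)) (i + 1)))
        (by have : (0 : ℝ) ≤ i := by positivity
            linarith)
        (by have : ((i + 1 : ℕ) : ℝ) ≤ n := by exact_mod_cast hin
            push_cast at this
            have : 0 ≤ (5 + 1600 * C0) * (2 : ℝ) ^ n := by positivity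
            linarith) hh0 (by linarith)
        ((hBP (i + 1) a ha0 ha1).trans (by linarith))
        ((hBQ (i + 1) a ha0 ha1).trans (by linarith))
        (hρ.trans (by gcongr; linarith))
        (hx s' hs' (i + 1) hin)
        (hyB.trans (le_trans (by gcongr; linarith) hBi))
        (hε.trans (by
          calc 1600 * C0 * h ^ 2 * 2 ^ (i + 1) = 1600 * C0 * 2 ^ (i + 1) * h ^ 2 := by ring
            _ ≤ (5 + 1600 * C0) * 2 ^ (i + 1) * h ^ 2 := by gcongr; linarith
            _ ≤ B * h ^ 2 := by gcongr))
      rw [hy, hei]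
      refine le_trans (le_of_eq ?_) key
      congr 1
      · ring
      · congr 4
        ring
    have := Finset.sum_le_sum hterm
    rw [Finset.sum_add_distrib, Finset.sum_sub_distrib, ← Finset.mul_sum] at this
    simp only [Finset.sum_const, Finset.card_range, nsmul_eq_mul] at this
    have h1 := mul_nonneg hh0 hW
    simp only [hu]
    linarith
  have hmono : ∀ T, 0 ≤ T → u 0 ≤ u T := fun T hT =>
    le_of_le_add_sq (by norm_num) hT hstep
  rw [← hu0]
  have hlim : Tendsto (fun T : ℝ => ∑ i ∈ Finset.range n,
      |(P (i + 1)).eval (Real.exp (-T))| * ((i + 1) * B ^ 2 + 4)) atTop (𝓝 0) := by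
    have : (0 : ℝ) = ∑ i ∈ Finset.range n, |(P (i + 1)).eval 0| * ((i + 1) * B ^ 2 + 4) := by
      symm
      refine Finset.sum_eq_zero fun i _ => ?_
      rw [hP0 (i + 1) (by omega), abs_zero, zero_mul]
    rw [this]
    refine tendsto_finsetSum _ fun i _ => ?_
    refine Tendsto.mul_const _ (Tendsto.abs ?_)
    exact ((P (i + 1)).continuous.tendsto 0).comp
      (Real.tendsto_exp_atBot.comp tendsto_neg_atTop_atBot)
  refine ge_of_tendsto hlim ?_
  filter_upwards [eventually_ge_atTop 0] with T hT
  refine (hmono T hT).trans (Finset.sum_le_sum fun i hi => ?_)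
  have hin : i + 1 ≤ n := Finset.mem_range.1 hi
  refine (le_abs_self _).trans ?_
  rw [abs_mul]
  gcongr
  have h1 : ((i : ℝ) + 1) * ‖taylorCoeff (L T) (i + 1)‖ ^ 2 ≤ (i + 1) * B ^ 2 := by
    gcongr
    exact hx T hT _ hin
  have h2 : 4 / ((i : ℝ) + 1) ≤ 4 := by
    rw [div_le_iff₀ (by positivity)]
    have : (0 : ℝ) ≤ i := by positivity
    linarith
  have h3 : 0 ≤ 4 / ((i : ℝ) + 1) := by positivity
  have h4 : 0 ≤ ((i : ℝ) + 1) * ‖taylorCoeff (L T) (i + 1)‖ ^ 2 := by positivity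
  rw [abs_le]
  constructor <;> nlinarith

section Univalent

variable {F : ℂ → ℂ} {U : Set ℂ}

lemma nhds_le_map_nhds_of_injOn (hU : IsOpen U) (hF : DifferentiableOn ℂ F U) (hinj : InjOn F U)
    {z : ℂ} (hz : z ∈ U) : 𝓝 (F z) ≤ map F (𝓝 z) := by
  refine (hF.analyticAt (hU.mem_nhds hz)).eventually_constant_or_nhds_le_map_nhds.resolve_left ?_
  intro h
  have h1 : ∀ᶠ w in 𝓝 z, w = z := by
    filter_upwards [h, hU.mem_nhds hz] with w hw hwU using hinj hwU hz hw
  have h2 : ({z}ᶜ : Set ℂ) ∩ {w | w = z} ∈ 𝓝[≠] z :=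
    inter_mem self_mem_nhdsWithin (mem_nhdsWithin_of_mem_nhds h1)
  obtain ⟨w, hw1, hw2⟩ := (inferInstance : (𝓝[≠] z).NeBot).nonempty_of_mem h2
  exact hw1 hw2

lemma isOpen_image_of_injOn (hU : IsOpen U) (hF : DifferentiableOn ℂ F U) (hinj : InjOn F U) :
    IsOpen (F '' U) := by
  rw [isOpen_iff_mem_nhds]
  rintro _ ⟨z, hz, rfl⟩
  exact nhds_le_map_nhds_of_injOn hU hF hinj hz (image_mem_map (hU.mem_nhds hz))

lemma continuousAt_invFunOn (hU : IsOpen U) (hF : DifferentiableOn ℂ F U) (hinj : InjOn F U)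
    {z : ℂ} (hz : z ∈ U) : ContinuousAt (Function.invFunOn F U) (F z) := by
  have hl := hinj.leftInvOn_invFunOn
  rw [ContinuousAt, hl hz]
  intro s hs
  have h1 := nhds_le_map_nhds_of_injOn hU hF hinj hz
    (image_mem_map (inter_mem hs (hU.mem_nhds hz)))
  refine mem_map.2 (mem_of_superset h1 ?_)
  rintro _ ⟨w, ⟨hws, hwU⟩, rfl⟩
  rwa [mem_preimage, hl hwU]

lemma hasDerivAt_invFunOn (hU : IsOpen U) (hF : DifferentiableOn ℂ F U) (hinj : InjOn F U)
    {z : ℂ} (hz : z ∈ U) (hd : deriv F z ≠ 0) :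
    HasDerivAt (Function.invFunOn F U) (deriv F z)⁻¹ (F z) := by
  have hl := hinj.leftInvOn_invFunOn
  refine HasDerivAt.of_local_left_inverse (f := F)
    (continuousAt_invFunOn hU hF hinj hz) ?_ hd ?_
  · rw [hl hz]
    exact (hF.differentiableAt (hU.mem_nhds hz)).hasDerivAt
  · filter_upwards [(isOpen_image_of_injOn hU hF hinj).mem_nhds (mem_image_of_mem F hz)] with y hy
    exact Function.invFunOn_eq hy

lemma deriv_ne_zero_of_injOn (hU : IsOpen U) (hF : DifferentiableOn ℂ F U) (hinj : InjOn F U)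
    {z : ℂ} (hz : z ∈ U) : deriv F z ≠ 0 := by
  have hl := hinj.leftInvOn_invFunOn
  have hF' : AnalyticAt ℂ (deriv F) z := (hF.analyticAt (hU.mem_nhds hz)).deriv
  have hne : ∀ᶠ w in 𝓝[≠] z, deriv F w ≠ 0 := by
    refine hF'.eventually_eq_zero_or_eventually_ne_zero.resolve_left fun h => ?_
    obtain ⟨r, hr, hball⟩ := Metric.mem_nhds_iff.1 (inter_mem h (hU.mem_nhds hz))
    have hw : z + (r / 2 : ℝ) ∈ ball z r := by
      rw [mem_ball, dist_eq_norm, add_sub_cancel_left, Complex.norm_real,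
        Real.norm_of_nonneg (by positivity)]
      linarith
    have hconst : F z = F (z + (r / 2 : ℝ)) := by
      refine (convex_ball z r).is_const_of_fderivWithin_eq_zero (𝕜 := ℂ)
        (hF.mono fun w hw => (hball hw).2) ?_ (mem_ball_self hr) hw
      intro x hx
      rw [fderivWithin_of_isOpen isOpen_ball hx]
      ext
      simpa using (hball hx).1
    have := hinj hz (hball hw).2 hconst
    have h3 : ((r / 2 : ℝ) : ℂ) = 0 := by
      simpa using this.symm
    rw [ofReal_eq_zero] at h3
    linarith
  have hO := isOpen_image_of_injOn hU hF hinj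
  rw [eventually_nhdsWithin_iff] at hne
  obtain ⟨W, hW, hWo, hzW⟩ := _root_.eventually_nhds_iff.1 (hne.and (hU.mem_nhds hz))
  have hWU : W ⊆ U := fun w hw => (hW w hw).2
  have hWim : F '' W ∈ 𝓝 (F z) :=
    nhds_le_map_nhds_of_injOn hU hF hinj hz (image_mem_map (hWo.mem_nhds hzW))
  have hd : DifferentiableOn ℂ (Function.invFunOn F U) (F '' W) := by
    refine (Complex.differentiableOn_compl_singleton_and_continuousAt_iff hWim).1
      ⟨?_, continuousAt_invFunOn hU hF hinj hz⟩
    rintro _ ⟨⟨w, hw, rfl⟩, hwz⟩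
    have hwz' : w ≠ z := fun h => hwz (by rw [h]; rfl)
    exact (hasDerivAt_invFunOn hU hF hinj (hWU hw)
      ((hW w hw).1 hwz')).differentiableAt.differentiableWithinAt
  have h1 := (hd.differentiableAt hWim).hasDerivAt
  have h2 := h1.comp z (hF.differentiableAt (hU.mem_nhds hz)).hasDerivAt
  have h3 : HasDerivAt (Function.invFunOn F U ∘ F) 1 z := by
    refine (hasDerivAt_id z).congr_of_eventuallyEq ?_
    filter_upwards [hU.mem_nhds hz] with w hw using hl hw
  intro h0
  rw [h0, mul_zero] at h2
  exact zero_ne_one (h2.unique h3)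

lemma differentiableOn_invFunOn (hU : IsOpen U) (hF : DifferentiableOn ℂ F U) (hinj : InjOn F U) :
    DifferentiableOn ℂ (Function.invFunOn F U) (F '' U) := by
  rintro _ ⟨z, hz, rfl⟩
  exact (hasDerivAt_invFunOn hU hF hinj hz
    (deriv_ne_zero_of_injOn hU hF hinj hz)).differentiableAt.differentiableWithinAt

end Univalent

section Log

lemma eqOn_of_exp_eq {L M : ℂ → ℂ} (hL : DifferentiableOn ℂ L (ball 0 1))
    (hM : DifferentiableOn ℂ M (ball 0 1)) (h0 : L 0 = M 0)
    (h : ∀ z ∈ ball (0 : ℂ) 1, cexp (L z) = cexp (M z)) : EqOn L M (ball 0 1) := by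
  have hder : ∀ z ∈ ball (0 : ℂ) 1, deriv L z = deriv M z := by
    intro z hz
    have hn := isOpen_ball.mem_nhds hz
    have h1 := (hL.differentiableAt hn).hasDerivAt.cexp
    have h2 := (hM.differentiableAt hn).hasDerivAt.cexp
    have h3 := h1.unique (h2.congr_of_eventuallyEq (by filter_upwards [hn] with w hw using h w hw))
    rw [h z hz] at h3
    exact mul_left_cancel₀ (Complex.exp_ne_zero _) h3
  intro z hz
  have hc : L 0 - M 0 = L z - M z := by
    refine (convex_ball (0 : ℂ) 1).is_const_of_fderivWithin_eq_zero (𝕜 := ℂ) (f := fun z => L z - M z)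
      (hL.sub hM) ?_ (mem_ball_self one_pos) hz
    intro x hx
    have hn := isOpen_ball.mem_nhds hx
    rw [fderivWithin_of_isOpen isOpen_ball hx]
    ext
    have := deriv_fun_sub (hL.differentiableAt hn) (hM.differentiableAt hn)
    rw [hder x hx, sub_self] at this
    simpa using this
  rw [h0, sub_self] at hc
  exact (sub_eq_zero.1 hc.symm)

lemma exists_log {g : ℂ → ℂ} (hg : DifferentiableOn ℂ g (ball 0 1))
    (hne : ∀ z ∈ ball (0 : ℂ) 1, g z ≠ 0) {c : ℂ} (hc : cexp c = g 0) :
    ∃ L : ℂ → ℂ, DifferentiableOn ℂ L (ball 0 1) ∧ L 0 = c ∧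
      ∀ z ∈ ball (0 : ℂ) 1, cexp (L z) = g z := by
  have hd : DifferentiableOn ℂ (fun z => deriv g z / g z) (ball 0 1) :=
    (hg.deriv isOpen_ball).div hg hne
  obtain ⟨L, hL0, hL⟩ := hd.isExactOn_ball.with_val_at 0 c
  have hLd : DifferentiableOn ℂ L (ball 0 1) := fun z hz =>
    (hL z hz).differentiableAt.differentiableWithinAt
  refine ⟨L, hLd, hL0, fun z hz => ?_⟩
  have hconst : g 0 * cexp (-L 0) = g z * cexp (-L z) := by
    refine (convex_ball (0 : ℂ) 1).is_const_of_fderivWithin_eq_zero (𝕜 := ℂ)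
      (f := fun z => g z * cexp (-L z)) (hg.mul hLd.neg.cexp) ?_ (mem_ball_self one_pos) hz
    intro x hx
    rw [fderivWithin_of_isOpen isOpen_ball hx]
    ext
    have := ((hg.differentiableAt (isOpen_ball.mem_nhds hx)).hasDerivAt.mul
      (hL x hx).neg.cexp).deriv
    have h2 : deriv (fun z => g z * cexp (-L z)) x = 0 := by
      refine this.trans ?_
      have := hne x hx
      field_simp
      ring
    simpa using h2
  rw [hL0, ← hc, ← Complex.exp_add, add_neg_cancel, Complex.exp_zero, Complex.exp_neg] at hconst
  have := Complex.exp_ne_zero (L z)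
  field_simp at hconst
  exact hconst

lemma differentiableOn_of_exp_eq {U : Set ℂ} (hU : IsOpen U) {H h : ℂ → ℂ} (hH : ContinuousOn H U)
    (hh : DifferentiableOn ℂ h U) (he : ∀ z ∈ U, cexp (H z) = h z) : DifferentiableOn ℂ H U := by
  intro z hz
  have hn := hU.mem_nhds hz
  obtain ⟨E, hE, hEd⟩ : ∃ E : ℂ → ℂ, (∀ᶠ x in 𝓝 (H z), E (cexp x) = x) ∧
      DifferentiableAt ℂ E (cexp (H z)) := by
    have hs := Complex.hasStrictDerivAt_exp (H z)
    exact ⟨hs.localInverse _ _ _ (Complex.exp_ne_zero _),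
      hs.eventually_left_inverse (Complex.exp_ne_zero _),
      (hs.to_localInverse (Complex.exp_ne_zero _)).hasDerivAt.differentiableAt⟩
  have h1 := (hH.continuousAt hn).eventually hE
  rw [he z hz] at hEd
  refine DifferentiableAt.differentiableWithinAt ?_
  refine (hEd.comp z (hh.differentiableAt hn)).congr_of_eventuallyEq ?_
  filter_upwards [h1, hn] with w hw hwU
  rw [← hw, he w hwU]
  rfl

end Log

section Normal

variable {ι : Type*} {U : Set ℂ} {C : ℝ}

/-- Montel's theorem along an ultrafilter. -/
lemma exists_tendstoLocallyUniformlyOn (l : Ultrafilter ι) (hU : IsOpen U) {F : ι → ℂ → ℂ}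
    (hF : ∀ᶠ i in (l : Filter ι), DifferentiableOn ℂ (F i) U ∧ ∀ z ∈ U, ‖F i z‖ ≤ C) :
    ∃ G : ℂ → ℂ, TendstoLocallyUniformlyOn F G l U ∧ DifferentiableOn ℂ G U := by
  have hpt : ∀ z, ∃ w, z ∈ U → Tendsto (fun i => F i z) l (𝓝 w) := by
    intro z
    by_cases hz : z ∈ U
    · have h1 : (l.map (fun i => F i z) : Filter ℂ) ≤ 𝓟 (closedBall 0 C) := by
        rw [le_principal_iff]
        show ∀ᶠ i in (l : Filter ι), _
        filter_upwards [hF] with i hi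
        exact mem_closedBall_zero_iff.2 (hi.2 z hz)
      obtain ⟨w, _, hw⟩ := (isCompact_closedBall (0 : ℂ) C).ultrafilter_le_nhds _ h1
      exact ⟨w, fun _ => hw⟩
    · exact ⟨0, fun h => absurd h hz⟩
  choose G hG using hpt
  have hlu : TendstoLocallyUniformlyOn F G l U := by
    rw [Metric.tendstoLocallyUniformlyOn_iff]
    intro ε hε z hz
    obtain ⟨r, hr, hball⟩ := Metric.isOpen_iff.1 hU z hz
    obtain ⟨δ, hδ, hδr, hδε⟩ : ∃ δ > 0, δ ≤ r ∧ 2 * |C| / r * δ ≤ ε / 4 := by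
      refine ⟨min r (ε / 4 / (2 * |C| / r + 1)), by positivity, min_le_left _ _, ?_⟩
      calc 2 * |C| / r * min r (ε / 4 / (2 * |C| / r + 1))
          ≤ (2 * |C| / r + 1) * (ε / 4 / (2 * |C| / r + 1)) := by
            gcongr
            · linarith
            · exact min_le_right _ _
        _ = ε / 4 := by field_simp
    have hlip : ∀ᶠ i in (l : Filter ι), ∀ w ∈ ball z δ, dist (F i w) (F i z) ≤ ε / 4 := by
      filter_upwards [hF] with i hi w hw
      have h1 := Complex.dist_le_div_mul_dist_of_mapsTo_ball (R₂ := 2 * |C|) (hi.1.mono hball)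
        (fun x hx => by
          rw [mem_closedBall, dist_eq_norm]
          have := norm_sub_le (F i x) (F i z)
          linarith [hi.2 x (hball hx), hi.2 z hz, le_abs_self C]) (ball_subset_ball hδr hw)
      refine h1.trans (le_trans ?_ hδε)
      gcongr
      exact (mem_ball.1 hw).le
    have hlim : ∀ w ∈ ball z δ, dist (G w) (G z) ≤ ε / 4 := by
      intro w hw
      refine le_of_tendsto ((hG w (hball (ball_subset_ball hδr hw))).dist (hG z hz)) ?_
      filter_upwards [hlip] with i hi using hi w hw
    refine ⟨ball z δ, mem_nhdsWithin_of_mem_nhds (ball_mem_nhds z hδ), ?_⟩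
    filter_upwards [hlip, (Metric.tendsto_nhds.1 (hG z hz)) (ε / 4) (by positivity)] with i h1 h2
      w hw
    have h3 := hlim w hw
    have h4 := h1 w hw
    calc dist (G w) (F i w) ≤ dist (G w) (G z) + dist (G z) (F i z) + dist (F i z) (F i w) :=
          dist_triangle4 _ _ _ _
      _ < ε := by rw [dist_comm (G z) (F i z), dist_comm (F i z) (F i w)]; linarith
  exact ⟨G, hlu, hlu.differentiableOn (hF.mono fun i hi => hi.1) hU⟩

lemma eventually_mem_image_closedBall {l : Filter ι} (hU : IsOpen U) {F : ι → ℂ → ℂ} {G : ℂ → ℂ}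
    (hFG : TendstoLocallyUniformlyOn F G l U) (hF : ∀ᶠ i in l, DifferentiableOn ℂ (F i) U)
    (hinj : ∀ᶠ i in l, InjOn (F i) U) [l.NeBot]
    {a : ℂ} (ha : a ∈ U) (hG : ¬ ∀ᶠ z in 𝓝 a, G z = G a) {R : ℝ} (hR : 0 < R) :
    ∃ r, 0 < r ∧ r < R ∧ ∀ᶠ i in l, G a ∈ F i '' closedBall a r := by
  have hGd : DifferentiableOn ℂ G U := hFG.differentiableOn hF hU
  have hne := ((hGd.analyticAt (hU.mem_nhds ha)).eventually_eq_or_eventually_ne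
    (analyticAt_const (v := G a))).resolve_left hG
  rw [eventually_nhdsWithin_iff] at hne
  obtain ⟨r0, hr0, hball⟩ := Metric.mem_nhds_iff.1 (inter_mem hne (hU.mem_nhds ha))
  set r := min r0 R / 2 with hr
  have hmin : 0 < min r0 R := lt_min hr0 hR
  have hrpos : 0 < r := by positivity
  have hrr0 : r < r0 := by linarith [min_le_left r0 R]
  refine ⟨r, hrpos, by linarith [min_le_right r0 R], ?_⟩
  have hcb : closedBall a r ⊆ U := fun w hw => (hball (closedBall_subset_ball hrr0 hw)).2
  have hcont : ContinuousOn (fun z => ‖G z - G a‖) (sphere a r) :=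
    ((hGd.continuousOn.mono (sphere_subset_closedBall.trans hcb)).sub continuousOn_const).norm
  obtain ⟨w0, hw0, hmin⟩ := (isCompact_sphere a r).exists_isMinOn
    (NormedSpace.sphere_nonempty.2 hrpos.le) hcont
  have hpos : 0 < ‖G w0 - G a‖ := by
    rw [norm_pos_iff, sub_ne_zero]
    refine (hball (closedBall_subset_ball hrr0 (sphere_subset_closedBall hw0))).1 ?_
    exact ne_of_mem_sphere hw0 hrpos.ne'
  set ε := ‖G w0 - G a‖ with hε
  have hunif := (tendstoLocallyUniformlyOn_iff_forall_isCompact hU).1 hFG _ hcb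
    (isCompact_closedBall a r)
  have h1 := Metric.tendstoUniformlyOn_iff.1 hunif (ε / 8) (by positivity)
  filter_upwards [h1, hF, hinj] with i hi hFi hinji
  have hia := hi a (mem_closedBall_self hrpos.le)
  rw [dist_eq_norm] at hia
  have hsub := DiffContOnCl.ball_subset_image_closedBall (f := F i) (z₀ := a) (r := r) (ε := ε / 2)
    ((hFi.mono (closure_ball_subset_closedBall.trans hcb)).diffContOnCl) hrpos ?_ ?_
  · refine hsub ?_
    rw [mem_ball, dist_eq_norm]
    linarith
  · intro z hz
    have h2 : ε ≤ ‖G z - G a‖ := hmin hz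
    have h3 := hi z (sphere_subset_closedBall hz)
    rw [dist_eq_norm] at h3
    have h4 : ‖G z - G a‖ ≤ ‖F i z - F i a‖ + ‖G z - F i z‖ + ‖G a - F i a‖ := by
      have : G z - G a = (F i z - F i a) + (G z - F i z) - (G a - F i a) := by ring
      rw [this]
      exact (norm_sub_le _ _).trans (by gcongr; exact norm_add_le _ _)
    linarith
  · have h5 : ∀ᶠ z in 𝓝[≠] a, F i z ≠ F i a := by
      filter_upwards [self_mem_nhdsWithin, mem_nhdsWithin_of_mem_nhds (hU.mem_nhds ha)] with z hz hzU
      exact fun h => hz (hinji hzU ha h)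
    exact h5.frequently.filter_mono nhdsWithin_le_nhds

/-- Hurwitz's theorem: a nonconstant locally uniform limit of injective holomorphic functions is
injective. -/
lemma injOn_of_tendstoLocallyUniformlyOn {l : Filter ι} [l.NeBot] (hU : IsOpen U)
    (hUc : IsPreconnected U) {F : ι → ℂ → ℂ} {G : ℂ → ℂ}
    (hFG : TendstoLocallyUniformlyOn F G l U) (hF : ∀ᶠ i in l, DifferentiableOn ℂ (F i) U)
    (hinj : ∀ᶠ i in l, InjOn (F i) U) {c : ℂ} (hc : c ∈ U) (hG : deriv G c ≠ 0) : InjOn G U := by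
  have hGd : DifferentiableOn ℂ G U := hFG.differentiableOn hF hU
  have hnc : ∀ a ∈ U, ¬ ∀ᶠ z in 𝓝 a, G z = G a := by
    intro a ha h
    have h1 : EqOn G (fun _ => G a) U :=
      (hGd.analyticOnNhd hU).eqOn_of_preconnected_of_eventuallyEq analyticOnNhd_const hUc ha h
    apply hG
    rw [(h1.eventuallyEq_of_mem (hU.mem_nhds hc)).deriv_eq, deriv_const]
  intro a ha b hb hab
  by_contra hne
  have hd : 0 < dist a b / 2 := by have := dist_pos.2 hne; positivity
  obtain ⟨Ra, hRa, hUa⟩ := Metric.isOpen_iff.1 hU a ha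
  obtain ⟨Rb, hRb, hUb⟩ := Metric.isOpen_iff.1 hU b hb
  obtain ⟨r1, _, hr1, h1⟩ := eventually_mem_image_closedBall hU hFG hF hinj ha (hnc a ha)
    (lt_min hd hRa)
  obtain ⟨r2, _, hr2, h2⟩ := eventually_mem_image_closedBall hU hFG hF hinj hb (hnc b hb)
    (lt_min hd hRb)
  obtain ⟨i, ⟨x, hx, hxa⟩, ⟨y, hy, hyb⟩, hi⟩ := (h1.and (h2.and hinj)).exists
  have hxy : x = y := by
    refine hi (hUa ?_) (hUb ?_) (by rw [hxa, hyb, hab])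
    · exact closedBall_subset_ball (hr1.trans_le (min_le_right _ _)) hx
    · exact closedBall_subset_ball (hr2.trans_le (min_le_right _ _)) hy
  rw [← hxy, mem_closedBall] at hy
  rw [mem_closedBall] at hx
  have := dist_triangle_left a b x
  linarith [min_le_left (dist a b / 2) Ra, min_le_left (dist a b / 2) Rb]

end Normal

section Blaschke

/-- The disc automorphism exchanging `a` with `0` up to sign. -/
noncomputable def blaschke (a z : ℂ) : ℂ := (z - a) / (1 - starRingEnd ℂ a * z)

variable {a z : ℂ}

lemma one_sub_conj_mul_ne_zero (ha : ‖a‖ < 1) (hz : ‖z‖ < 1) : 1 - starRingEnd ℂ a * z ≠ 0 := by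
  intro h
  have h1 : ‖starRingEnd ℂ a * z‖ = 1 := by rw [← sub_eq_zero.1 h, norm_one]
  rw [norm_mul, RCLike.norm_conj] at h1
  nlinarith [norm_nonneg a, norm_nonneg z]

lemma norm_blaschke_lt_one (ha : ‖a‖ < 1) (hz : ‖z‖ < 1) : ‖blaschke a z‖ < 1 := by
  have hne := one_sub_conj_mul_ne_zero ha hz
  rw [blaschke, norm_div, div_lt_one (norm_pos_iff.2 hne)]
  refine lt_of_pow_lt_pow_left₀ 2 (norm_nonneg _) ?_
  have key : ‖1 - starRingEnd ℂ a * z‖ ^ 2 - ‖z - a‖ ^ 2 = (1 - ‖a‖ ^ 2) * (1 - ‖z‖ ^ 2) := by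
    simp only [← Complex.normSq_eq_norm_sq, Complex.normSq_apply]
    simp
    ring
  have : 0 < (1 - ‖a‖ ^ 2) * (1 - ‖z‖ ^ 2) := by
    apply mul_pos <;> nlinarith [norm_nonneg a, norm_nonneg z]
  linarith

lemma injOn_blaschke (ha : ‖a‖ < 1) : InjOn (blaschke a) (ball 0 1) := by
  intro z hz w hw h
  rw [mem_ball_zero_iff] at hz hw
  have h1 := one_sub_conj_mul_ne_zero ha hz
  have h2 := one_sub_conj_mul_ne_zero ha hw
  rw [blaschke, blaschke, div_eq_div_iff h1 h2] at h
  have h3 : (z - w) * (1 - starRingEnd ℂ a * a) = 0 := by linear_combination h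
  exact sub_eq_zero.1 ((mul_eq_zero.1 h3).resolve_right (one_sub_conj_mul_ne_zero ha ha))

lemma hasDerivAt_blaschke (ha : ‖a‖ < 1) (hz : ‖z‖ < 1) :
    HasDerivAt (blaschke a) ((1 - starRingEnd ℂ a * a) / (1 - starRingEnd ℂ a * z) ^ 2) z := by
  have h1 := one_sub_conj_mul_ne_zero ha hz
  have h2 : HasDerivAt (fun z => z - a) 1 z := (hasDerivAt_id z).sub_const a
  have h3 : HasDerivAt (fun z => 1 - starRingEnd ℂ a * z) (-(starRingEnd ℂ a * 1)) z :=
    ((hasDerivAt_id z).const_mul _).const_sub 1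
  refine (h2.div h3 h1).congr_deriv ?_
  congr 1
  ring

end Blaschke

section RiemannMapping

variable {Ω : Set ℂ}

/-- Every nonvanishing continuous function on the set has a continuous logarithm. -/
def HasContLog (Ω : Set ℂ) : Prop :=
  ∀ h : ℂ → ℂ, ContinuousOn h Ω → (∀ z ∈ Ω, h z ≠ 0) →
    ∃ H : ℂ → ℂ, ContinuousOn H Ω ∧ ∀ z ∈ Ω, cexp (H z) = h z

/-- Normalised injective holomorphic maps of a domain into the unit disc. -/
def UnivalentToDisc (Ω : Set ℂ) (F : ℂ → ℂ) : Prop :=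
  DifferentiableOn ℂ F Ω ∧ InjOn F Ω ∧ MapsTo F Ω (ball 0 1) ∧ F 0 = 0

lemma exists_larger_deriv (hO : IsOpen Ω) (h0 : 0 ∈ Ω) (hlog : HasContLog Ω) {F : ℂ → ℂ}
    (hF : UnivalentToDisc Ω F) {a : ℂ} (ha : a ∈ ball (0 : ℂ) 1) (haF : a ∉ F '' Ω) :
    ∃ F₁, UnivalentToDisc Ω F₁ ∧ ‖deriv F 0‖ < ‖deriv F₁ 0‖ := by
  obtain ⟨hd, hinj, hmaps, hF0⟩ := hF
  have hF' : deriv F 0 ≠ 0 := deriv_ne_zero_of_injOn hO hd hinj h0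
  have ha1 : ‖a‖ < 1 := mem_ball_zero_iff.1 ha
  have hF1 : ∀ z ∈ Ω, ‖F z‖ < 1 := fun z hz => mem_ball_zero_iff.1 (hmaps hz)
  have ha0 : a ≠ 0 := fun h => haF ⟨0, h0, by rw [hF0, h]⟩
  have hBd : DifferentiableOn ℂ (fun z => blaschke a (F z)) Ω := fun z hz =>
    ((hasDerivAt_blaschke ha1 (hF1 z hz)).differentiableAt.comp z
      (hd.differentiableAt (hO.mem_nhds hz))).differentiableWithinAt
  obtain ⟨H, hHc, hH⟩ := hlog (fun z => blaschke a (F z)) hBd.continuousOn (by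
    intro z hz h
    rw [blaschke, div_eq_zero_iff] at h
    rcases h with h | h
    · exact haF ⟨z, hz, sub_eq_zero.1 h⟩
    · exact one_sub_conj_mul_ne_zero ha1 (hF1 z hz) h)
  have hHd := differentiableOn_of_exp_eq hO hHc hBd hH
  set G : ℂ → ℂ := fun z => cexp (H z / 2) with hG
  have hGd : DifferentiableOn ℂ G Ω := (hHd.div_const 2).cexp
  have hG2 : ∀ z ∈ Ω, G z * G z = blaschke a (F z) := by
    intro z hz
    rw [hG, ← hH z hz]
    simp only
    rw [← Complex.exp_add, add_halves]
  have hG1 : ∀ z ∈ Ω, ‖G z‖ < 1 := by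
    intro z hz
    have h1 := norm_blaschke_lt_one ha1 (hF1 z hz)
    rw [← hG2 z hz, norm_mul] at h1
    nlinarith [norm_nonneg (G z)]
  have hGinj : InjOn G Ω := by
    intro z hz w hw h
    refine hinj hz hw (injOn_blaschke ha1 (hmaps hz) (hmaps hw) ?_)
    rw [← hG2 z hz, ← hG2 w hw, h]
  set c := G 0 with hc
  have hc1 : ‖c‖ < 1 := hG1 0 h0
  have hcc : ‖c‖ * ‖c‖ = ‖a‖ := by
    rw [← norm_mul, hc, hG2 0 h0, hF0]
    simp [blaschke]
  have hn := hO.mem_nhds h0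
  have hGda := (hGd.differentiableAt hn).hasDerivAt
  have hderG : 2 * c * deriv G 0 = (1 - starRingEnd ℂ a * a) * deriv F 0 := by
    have h1 := hGda.mul hGda
    have h2 : HasDerivAt (fun z => blaschke a (F z)) _ 0 :=
      (hasDerivAt_blaschke ha1 (hF1 0 h0)).comp 0 (hd.differentiableAt hn).hasDerivAt
    have h3 := h1.unique (h2.congr_of_eventuallyEq (by
      filter_upwards [hn] with z hz using hG2 z hz))
    rw [hF0] at h3
    simp only [mul_zero, sub_zero, one_pow, div_one] at h3
    rw [← h3, hc]
    ring
  have hB : HasDerivAt (blaschke c) _ (G 0) := hasDerivAt_blaschke (a := c) (z := c) hc1 hc1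
  have hcomp : HasDerivAt (fun z => blaschke c (G z))
      ((1 - starRingEnd ℂ c * c) / (1 - starRingEnd ℂ c * c) ^ 2 * deriv G 0) 0 :=
    HasDerivAt.comp (h₂ := blaschke c) 0 hB hGda
  refine ⟨fun z => blaschke c (G z), ⟨?_, ?_, ?_, ?_⟩, ?_⟩
  · exact fun z hz => ((hasDerivAt_blaschke hc1 (hG1 z hz)).differentiableAt.comp z
      (hGd.differentiableAt (hO.mem_nhds hz))).differentiableWithinAt
  · intro z hz w hw h
    exact hGinj hz hw (injOn_blaschke hc1 (mem_ball_zero_iff.2 (hG1 z hz))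
      (mem_ball_zero_iff.2 (hG1 w hw)) h)
  · exact fun z hz => mem_ball_zero_iff.2 (norm_blaschke_lt_one hc1 (hG1 z hz))
  · simp [blaschke, ← hc]
  · rw [hcomp.deriv]
    have e1 : ∀ b : ℂ, 1 - starRingEnd ℂ b * b = ((1 - ‖b‖ ^ 2 : ℝ) : ℂ) := by
      intro b
      rw [mul_comm, Complex.mul_conj, Complex.normSq_eq_norm_sq]
      push_cast
      ring
    have hpos : 0 < 1 - ‖c‖ ^ 2 := by nlinarith [norm_nonneg c]
    have hapos : 0 < 1 - ‖a‖ ^ 2 := by nlinarith [norm_nonneg a]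
    have e2 := congrArg norm hderG
    rw [e1, norm_mul, norm_mul, norm_mul, Complex.norm_real, Real.norm_of_nonneg hapos.le] at e2
    have e3 : ‖(2 : ℂ)‖ = 2 := by simp
    rw [e3] at e2
    rw [e1, norm_mul, norm_div, norm_pow, Complex.norm_real, Real.norm_of_nonneg hpos.le]
    have hF'pos : 0 < ‖deriv F 0‖ := norm_pos_iff.2 hF'
    have hcpos : 0 < ‖c‖ := by
      rcases (norm_nonneg c).eq_or_lt with h | h
      · rw [← h, mul_zero] at hcc
        exact absurd (norm_eq_zero.1 hcc.symm) ha0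
      · exact h
    rw [sq (1 - ‖c‖ ^ 2), div_mul_eq_mul_div, lt_div_iff₀ (by positivity)]
    rw [← hcc] at e2
    have e4 : 2 * ‖c‖ < 1 + ‖c‖ ^ 2 := by nlinarith [sq_nonneg (1 - ‖c‖)]
    have e5 : 2 * ‖c‖ * ‖deriv G 0‖ = (1 - ‖c‖ ^ 2) * ((1 + ‖c‖ ^ 2) * ‖deriv F 0‖) := by
      rw [e2]; ring
    have e6 : 2 * ‖c‖ * ((1 - ‖c‖ ^ 2) * ‖deriv F 0‖) < 2 * ‖c‖ * ‖deriv G 0‖ := by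
      rw [e5]
      calc 2 * ‖c‖ * ((1 - ‖c‖ ^ 2) * ‖deriv F 0‖)
          = (1 - ‖c‖ ^ 2) * ((2 * ‖c‖) * ‖deriv F 0‖) := by ring
        _ < _ := by gcongr
    have e7 := lt_of_mul_lt_mul_left e6 (by positivity)
    nlinarith

lemma exists_extremal (hO : IsOpen Ω) (hc : IsPreconnected Ω) (h0 : 0 ∈ Ω) {C : ℝ}
    (hC : ∀ w ∈ Ω, ‖w‖ ≤ C) :
    ∃ F, UnivalentToDisc Ω F ∧ ∀ F₁, UnivalentToDisc Ω F₁ → ‖deriv F₁ 0‖ ≤ ‖deriv F 0‖ := by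
  obtain ⟨δ, hδ, hball⟩ := Metric.isOpen_iff.1 hO 0 h0
  have hC0 : 0 ≤ C := (norm_nonneg _).trans (hC 0 h0)
  set S : Set ℝ := (fun F : ℂ → ℂ => ‖deriv F 0‖) '' {F | UnivalentToDisc Ω F} with hS
  have hbdd : BddAbove S := by
    refine ⟨1 / δ, ?_⟩
    rintro _ ⟨F, ⟨hd, -, hm, hF0⟩, rfl⟩
    refine Complex.norm_deriv_le_div_of_mapsTo_ball (hd.mono hball) ?_ hδ
    rw [hF0]
    exact fun z hz => ball_subset_closedBall (hm (hball hz))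
  have hlin : UnivalentToDisc Ω (fun z => z / ((C + 1 : ℝ) : ℂ)) := by
    have hne : ((C + 1 : ℝ) : ℂ) ≠ 0 := by
      rw [Ne, ofReal_eq_zero]; linarith
    refine ⟨by fun_prop, fun z _ w _ h => ?_, fun z hz => ?_, by simp⟩
    · exact (div_left_inj' hne).1 h
    · rw [mem_ball_zero_iff, norm_div, Complex.norm_real, Real.norm_of_nonneg (by linarith),
        div_lt_one (by linarith)]
      linarith [hC z hz]
  have hne : S.Nonempty := ⟨_, _, hlin, rfl⟩
  obtain ⟨u, -, hu, huS⟩ := exists_seq_tendsto_sSup hne hbdd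
  choose F hF hFu using huS
  set l : Ultrafilter ℕ := Ultrafilter.of atTop with hl
  have hlat : (l : Filter ℕ) ≤ atTop := Ultrafilter.of_le _
  obtain ⟨G, hFG, hGd⟩ := exists_tendstoLocallyUniformlyOn l hO (C := 1) (F := F)
    (Eventually.of_forall fun i => ⟨(hF i).1, fun z hz =>
      (mem_ball_zero_iff.1 ((hF i).2.2.1 hz)).le⟩)
  have hFd : ∀ᶠ i in (l : Filter ℕ), DifferentiableOn ℂ (F i) Ω :=
    Eventually.of_forall fun i => (hF i).1
  have hder : Tendsto (fun i => deriv (F i) 0) l (𝓝 (deriv G 0)) :=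
    (hFG.deriv hFd hO).tendsto_at h0
  have hM : ‖deriv G 0‖ = sSup S := by
    refine tendsto_nhds_unique hder.norm ?_
    refine Tendsto.congr (fun i => (hFu i).symm) (hu.mono_left hlat)
  have hle : ∀ F₁, UnivalentToDisc Ω F₁ → ‖deriv F₁ 0‖ ≤ ‖deriv G 0‖ := fun F₁ h => by
    rw [hM]
    exact le_csSup hbdd ⟨F₁, h, rfl⟩
  have hG' : deriv G 0 ≠ 0 := by
    rw [← norm_pos_iff]
    refine lt_of_lt_of_le ?_ (hle _ hlin)
    exact norm_pos_iff.2 (deriv_ne_zero_of_injOn hO hlin.1 hlin.2.1 h0)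
  have hGinj : InjOn G Ω := injOn_of_tendstoLocallyUniformlyOn hO hc hFG hFd
    (Eventually.of_forall fun i => (hF i).2.1) h0 hG'
  refine ⟨G, ⟨hGd, hGinj, ?_, ?_⟩, hle⟩
  · have h1 : G '' Ω ⊆ closedBall 0 1 := by
      rintro _ ⟨z, hz, rfl⟩
      refine isClosed_closedBall.mem_of_tendsto (hFG.tendsto_at hz) ?_
      exact Eventually.of_forall fun i => ball_subset_closedBall ((hF i).2.2.1 hz)
    have h2 := interior_maximal h1 (isOpen_image_of_injOn hO hGd hGinj)
    rw [interior_closedBall _ one_ne_zero] at h2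
    exact fun z hz => h2 (mem_image_of_mem G hz)
  · refine tendsto_nhds_unique (hFG.tendsto_at h0) ?_
    simp [(hF _).2.2.2]

/-- The Riemann mapping theorem for bounded domains. -/
theorem exists_riemannMap (hO : IsOpen Ω) (hc : IsPreconnected Ω) (h0 : 0 ∈ Ω) {C : ℝ}
    (hC : ∀ w ∈ Ω, ‖w‖ ≤ C) (hlog : HasContLog Ω) :
    ∃ p : ℂ → ℂ, DifferentiableOn ℂ p (ball 0 1) ∧ InjOn p (ball 0 1) ∧ p '' ball 0 1 = Ω ∧
      p 0 = 0 ∧ ∃ r : ℝ, 0 < r ∧ deriv p 0 = r := by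
  obtain ⟨F, hF, hmax⟩ := exists_extremal hO hc h0 hC
  obtain ⟨hd, hinj, hmaps, hF0⟩ := hF
  have hsurj : F '' Ω = ball 0 1 := by
    refine Subset.antisymm hmaps.image_subset fun a ha => ?_
    by_contra haF
    obtain ⟨F₁, hF₁, hlt⟩ := exists_larger_deriv hO h0 hlog ⟨hd, hinj, hmaps, hF0⟩ ha haF
    exact absurd (hmax F₁ hF₁) (not_le.2 hlt)
  have hF' : deriv F 0 ≠ 0 := deriv_ne_zero_of_injOn hO hd hinj h0
  have hn : 0 < ‖deriv F 0‖ := norm_pos_iff.2 hF'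
  set u : ℂ := deriv F 0 / ‖deriv F 0‖ with hu
  have hu1 : ‖u‖ = 1 := by
    rw [hu, norm_div, Complex.norm_real, norm_norm, div_self hn.ne']
  have hu0 : u ≠ 0 := by rw [← norm_pos_iff, hu1]; exact one_pos
  set I := Function.invFunOn F Ω with hI
  have hId : DifferentiableOn ℂ I (ball 0 1) := hsurj ▸ differentiableOn_invFunOn hO hd hinj
  have hIl := hinj.leftInvOn_invFunOn
  have hum : MapsTo (fun z => u * z) (ball 0 1) (ball 0 1) := by
    intro z hz
    rw [mem_ball_zero_iff] at hz ⊢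
    rwa [norm_mul, hu1, one_mul]
  have hIF : ∀ y ∈ ball (0 : ℂ) 1, F (I y) = y := fun y hy => by
    rw [← hsurj] at hy
    exact Function.invFunOn_eq hy
  have hIΩ : ∀ y ∈ ball (0 : ℂ) 1, I y ∈ Ω := fun y hy => by
    rw [← hsurj] at hy
    exact Function.invFunOn_mem hy
  have hI0 : I 0 = 0 := by
    have := hIl h0
    rwa [hF0] at this
  refine ⟨fun z => I (u * z), hId.comp (by fun_prop) hum, ?_, ?_, by simp [hI0],
    ‖deriv F 0‖⁻¹, inv_pos.2 hn, ?_⟩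
  · intro z hz w hw h
    have := congrArg F h
    simp only at this
    rw [hIF _ (hum hz), hIF _ (hum hw)] at this
    exact mul_left_cancel₀ hu0 this
  · refine Subset.antisymm ?_ fun w hw => ?_
    · rintro _ ⟨z, hz, rfl⟩
      exact hIΩ _ (hum hz)
    · refine ⟨u⁻¹ * F w, ?_, ?_⟩
      · have := mem_ball_zero_iff.1 (hmaps hw)
        rwa [mem_ball_zero_iff, norm_mul, norm_inv, hu1, inv_one, one_mul]
      · simp only
        rw [mul_inv_cancel_left₀ hu0]
        exact hIl hw
  · have h1 := hasDerivAt_invFunOn hO hd hinj h0 hF'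
    rw [hF0] at h1
    have h2 : HasDerivAt (fun z : ℂ => u * z) (u * 1) 0 := (hasDerivAt_id 0).const_mul u
    have h1' : HasDerivAt I (deriv F 0)⁻¹ (u * 0) := by rwa [mul_zero]
    have h3 : HasDerivAt (fun z => I (u * z)) _ 0 := h1'.comp 0 h2
    rw [h3.deriv, hu]
    push_cast
    field_simp

end RiemannMapping

/-- The complement, inverted in the unit circle, of the image of a closed disc. -/
def invCompl (g : ℂ → ℂ) (ρ : ℝ) : Set ℂ := {w | ∀ z ∈ closedBall (0 : ℂ) ρ, w * g z ≠ 1}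

lemma invCompl_anti (g : ℂ → ℂ) {ρ ρ' : ℝ} (h : ρ ≤ ρ') : invCompl g ρ' ⊆ invCompl g ρ :=
  fun _ hw z hz => hw z (closedBall_subset_closedBall h hz)

lemma zero_mem_invCompl (g : ℂ → ℂ) (ρ : ℝ) : (0 : ℂ) ∈ invCompl g ρ := by
  intro z _
  simp

section InvCompl

variable {g : ℂ → ℂ} {R ρ : ℝ}

lemma isOpen_invCompl (hg : DifferentiableOn ℂ g (ball 0 R)) (hρR : ρ < R) :
    IsOpen (invCompl g ρ) := by
  rw [isOpen_iff_mem_nhds]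
  intro w hw
  refine (isCompact_closedBall (0 : ℂ) ρ).eventually_forall_of_forall_eventually
    (P := fun w z => w * g z ≠ 1) fun z hz => ?_
  have hzR : z ∈ ball (0 : ℂ) R := closedBall_subset_ball hρR hz
  have hgz : ContinuousAt g z := hg.continuousOn.continuousAt (isOpen_ball.mem_nhds hzR)
  have hc : ContinuousAt (fun p : ℂ × ℂ => p.1 * g p.2) (w, z) :=
    continuousAt_fst.mul (ContinuousAt.comp (g := g) (f := Prod.snd) hgz continuousAt_snd)
  exact hc.eventually_ne (hw z hz)

/-- Change the modulus of a complex number according to a function on the reals. -/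
noncomputable def radial (k : ℝ → ℝ) (z : ℂ) : ℂ := ((k ‖z‖ / ‖z‖ : ℝ) : ℂ) * z

lemma norm_radial {k : ℝ → ℝ} {z : ℂ} (hz : z ≠ 0) (hk : 0 ≤ k ‖z‖) : ‖radial k z‖ = k ‖z‖ := by
  have := norm_pos_iff.2 hz
  rw [radial, norm_mul, Complex.norm_real, Real.norm_of_nonneg (by positivity),
    div_mul_cancel₀ _ this.ne']

lemma radial_of_eq {k : ℝ → ℝ} {z : ℂ} (hk : k ‖z‖ = ‖z‖) : radial k z = z := by
  rcases eq_or_ne z 0 with rfl | hz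
  · simp [radial]
  · rw [radial, hk, div_self (norm_ne_zero_iff.2 hz), ofReal_one, one_mul]

lemma radial_radial {k l : ℝ → ℝ} {z : ℂ} (hz : z ≠ 0) (hk : 0 < k ‖z‖) (hl : l (k ‖z‖) = ‖z‖) :
    radial l (radial k z) = z := by
  have h1 := norm_pos_iff.2 hz
  have h2 : l ‖radial k z‖ / ‖radial k z‖ = ‖z‖ / k ‖z‖ := by rw [norm_radial hz hk.le, hl]
  rw [radial, h2, radial, ← mul_assoc, ← ofReal_mul, div_mul_div_cancel₀' h1.ne' , div_self hk.ne',
    ofReal_one, one_mul]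

lemma continuousAt_radial {k : ℝ → ℝ} (hk : Continuous k) {z : ℂ} (hz : z ≠ 0) :
    ContinuousAt (radial k) z := by
  have h1 : ContinuousAt (fun z : ℂ => k ‖z‖ / ‖z‖) z :=
    (hk.comp continuous_norm).continuousAt.div continuous_norm.continuousAt (norm_ne_zero_iff.2 hz)
  exact (continuous_ofReal.continuousAt.comp h1).mul continuousAt_id

open Classical in
/-- The radial map transported to the exterior of the image of `g`, in inverted coordinates. -/
noncomputable def push (g : ℂ → ℂ) (R : ℝ) (k : ℝ → ℝ) (w : ℂ) : ℂ :=
  if ∃ z ∈ ball (0 : ℂ) R, w * g z = 1 then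
    (g (radial k (Function.invFunOn g (ball 0 R) w⁻¹)))⁻¹
  else w

lemma push_of_not {k : ℝ → ℝ} {w : ℂ} (h : ¬ ∃ z ∈ ball (0 : ℂ) R, w * g z = 1) :
    push g R k w = w := if_neg h

lemma push_of_eq (hinj : InjOn g (ball 0 R)) {k : ℝ → ℝ} {w z : ℂ} (hz : z ∈ ball (0 : ℂ) R)
    (h : w * g z = 1) : push g R k w = (g (radial k z))⁻¹ := by
  have hw : w⁻¹ = g z := inv_eq_of_mul_eq_one_right h
  rw [push, if_pos ⟨z, hz, h⟩, hw, hinj.leftInvOn_invFunOn hz]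

lemma ne_zero_of_mul_eq_one (h0 : g 0 = 0) {w z : ℂ} (h : w * g z = 1) : z ≠ 0 := by
  rintro rfl
  simp [h0] at h

lemma map_ne_zero_of_injOn (hinj : InjOn g (ball 0 R)) (h0 : g 0 = 0) {z : ℂ}
    (hz : z ∈ ball (0 : ℂ) R) (hz0 : z ≠ 0) : g z ≠ 0 := fun h =>
  hz0 (hinj hz (mem_ball_self ((norm_nonneg z).trans_lt (mem_ball_zero_iff.1 hz)))
    (h.trans h0.symm))

lemma continuousOn_push (hg : DifferentiableOn ℂ g (ball 0 R)) (hinj : InjOn g (ball 0 R))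
    (h0 : g 0 = 0) (hρR : ρ < R) {k : ℝ → ℝ} (hk : Continuous k) (hk' : ∀ t, ρ ≤ t → k t = t)
    {S : Set ℂ} (hS : ∀ w ∈ S, ∀ z ∈ ball (0 : ℂ) R, w * g z = 1 → 0 < k ‖z‖ ∧ k ‖z‖ < R) :
    ContinuousOn (push g R k) S := by
  intro w hw
  refine ContinuousAt.continuousWithinAt ?_
  by_cases hex : ∃ z ∈ ball (0 : ℂ) R, w * g z = 1
  · obtain ⟨z, hz, hwz⟩ := hex
    have hz0 := ne_zero_of_mul_eq_one h0 hwz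
    have hw0 : w ≠ 0 := left_ne_zero_of_mul_eq_one hwz
    have hwi : w⁻¹ = g z := inv_eq_of_mul_eq_one_right hwz
    have hinv : ContinuousAt (fun w : ℂ => w⁻¹) w := continuousAt_inv₀ hw0
    have hIz : Function.invFunOn g (ball 0 R) (g z) = z := hinj.leftInvOn_invFunOn hz
    have hev : push g R k =ᶠ[𝓝 w]
        fun w => (g (radial k (Function.invFunOn g (ball 0 R) w⁻¹)))⁻¹ := by
      have hopen := isOpen_image_of_injOn isOpen_ball hg hinj
      have h1 : ∀ᶠ w' in 𝓝 w, w'⁻¹ ∈ g '' ball 0 R :=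
        hinv.eventually_mem (hopen.mem_nhds (hwi ▸ mem_image_of_mem g hz))
      filter_upwards [h1, continuousAt_id.eventually_ne hw0] with w' ⟨z', hz', h⟩ hw'
      exact if_pos ⟨z', hz', by rw [h]; exact mul_inv_cancel₀ hw'⟩
    refine ContinuousAt.congr ?_ hev.symm
    obtain ⟨hk1, hk2⟩ := hS w hw z hz hwz
    have hn := norm_radial hz0 hk1.le
    have hQ : radial k z ∈ ball (0 : ℂ) R := by rwa [mem_ball_zero_iff, hn]
    have hQ0 : radial k z ≠ 0 := by rwa [← norm_pos_iff, hn]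
    have c1 : ContinuousAt (fun w : ℂ => Function.invFunOn g (ball 0 R) w⁻¹) w :=
      ContinuousAt.comp_of_eq (continuousAt_invFunOn isOpen_ball hg hinj hz) hinv hwi
    have c2 : ContinuousAt (fun w : ℂ => radial k (Function.invFunOn g (ball 0 R) w⁻¹)) w :=
      ContinuousAt.comp_of_eq (continuousAt_radial hk hz0) c1 (by rw [hwi, hIz])
    have c3 : ContinuousAt (fun w : ℂ => g (radial k (Function.invFunOn g (ball 0 R) w⁻¹))) w :=
      ContinuousAt.comp_of_eq (hg.continuousOn.continuousAt (isOpen_ball.mem_nhds hQ)) c2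
        (by rw [hwi, hIz])
    refine c3.inv₀ ?_
    rw [hwi, hIz]
    exact map_ne_zero_of_injOn hinj h0 hQ hQ0
  · push Not at hex
    have hmem : w ∈ invCompl g ρ := fun z hz => hex z (closedBall_subset_ball hρR hz)
    refine continuousAt_id.congr ?_
    filter_upwards [(isOpen_invCompl hg hρR).mem_nhds hmem] with w' hw'
    by_cases hex' : ∃ z ∈ ball (0 : ℂ) R, w' * g z = 1
    · obtain ⟨z, hz, hwz⟩ := hex'
      have hzρ : ρ < ‖z‖ := by
        by_contra h
        exact hw' z (mem_closedBall_zero_iff.2 (not_lt.1 h)) hwz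
      rw [push_of_eq hinj hz hwz, radial_of_eq (hk' _ hzρ.le)]
      exact eq_inv_of_mul_eq_one_left hwz
    · exact (push_of_not hex').symm

/-- The inverted complement is a continuous retract of the plane: `B` is a section of `A`. -/
lemma exists_continuous_param (hg : DifferentiableOn ℂ g (ball 0 R)) (hinj : InjOn g (ball 0 R))
    (h0 : g 0 = 0) (hρ : 0 < ρ) (hρR : ρ < R) :
    ∃ A B : ℂ → ℂ, Continuous A ∧ (∀ w, A w ∈ invCompl g ρ) ∧
      ContinuousOn B (invCompl g ρ) ∧ ∀ w ∈ invCompl g ρ, A (B w) = w := by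
  obtain ⟨ρ', h1, h2⟩ := exists_between hρR
  have hρ' : 0 < ρ' := hρ.trans h1
  set c : ℝ := 1 - ρ / ρ' with hc
  have hc0 : 0 < c := by rw [hc, sub_pos, div_lt_one hρ']; exact h1
  have hcρ : ρ' * c = ρ' - ρ := by rw [hc]; field_simp
  have hc1 : c < 1 := by rw [hc]; linarith [div_pos hρ hρ']
  set τ : ℝ → ℝ := fun t => max t (ρ + c * t) with hτ
  set κ : ℝ → ℝ := fun s => min s ((s - ρ) / c) with hκ
  have hτc : Continuous τ := by fun_prop
  have hκc : Continuous κ := by fun_prop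
  have hτ' : ∀ t, ρ' ≤ t → τ t = t := fun t ht => max_eq_left (by nlinarith)
  have hκ' : ∀ t, ρ' ≤ t → κ t = t := fun t ht => min_eq_left (by
    rw [le_div_iff₀ hc0]; nlinarith)
  have hτρ : ∀ t, 0 < t → ρ < τ t := fun t ht =>
    lt_of_lt_of_le (by nlinarith) (le_max_right _ _)
  have hτR : ∀ t, t < R → τ t < R := fun t ht => max_lt ht (by
    rcases le_total ρ' t with h | h
    · nlinarith
    · nlinarith)
  have hκ0 : ∀ s, ρ < s → 0 < κ s := fun s hs =>
    lt_min (hρ.trans hs) (div_pos (by linarith) hc0)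
  have hκR : ∀ s, s < R → κ s < R := fun s hs => (min_le_left _ _).trans_lt hs
  have hτκ : ∀ s, τ (κ s) = s := by
    intro s
    rcases le_total ρ' s with h | h
    · rw [hκ' s h, hτ' s h]
    · have h3 : κ s = (s - ρ) / c := min_eq_right (by rw [div_le_iff₀ hc0]; nlinarith)
      rw [h3, hτ]
      simp only
      rw [mul_div_cancel₀ _ hc0.ne', add_sub_cancel]
      refine max_eq_right ?_
      rw [div_le_iff₀ hc0]; nlinarith
  have hV : ∀ w ∈ invCompl g ρ, ∀ z ∈ ball (0 : ℂ) R, w * g z = 1 → ρ < ‖z‖ := by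
    intro w hw z _ h
    by_contra hz
    exact hw z (mem_closedBall_zero_iff.2 (not_lt.1 hz)) h
  refine ⟨push g R τ, push g R κ, ?_, ?_, ?_, ?_⟩
  · rw [← continuousOn_univ]
    refine continuousOn_push hg hinj h0 h2 hτc hτ' fun w _ z hz h => ?_
    have := hτρ _ (norm_pos_iff.2 (ne_zero_of_mul_eq_one h0 h))
    exact ⟨hρ.trans this, hτR _ (mem_ball_zero_iff.1 hz)⟩
  · intro w
    by_cases hex : ∃ z ∈ ball (0 : ℂ) R, w * g z = 1
    · obtain ⟨z, hz, h⟩ := hex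
      have hz0 := ne_zero_of_mul_eq_one h0 h
      have hlt := hτρ _ (norm_pos_iff.2 hz0)
      have hn := norm_radial hz0 (hρ.trans hlt).le
      have hQ : radial τ z ∈ ball (0 : ℂ) R := by
        rw [mem_ball_zero_iff, hn]; exact hτR _ (mem_ball_zero_iff.1 hz)
      rw [push_of_eq hinj hz h]
      intro z' hz' h'
      have h3 : g z' = g (radial τ z) := by
        rw [← inv_inj]; exact (eq_inv_of_mul_eq_one_left h').symm
      have h4 := hinj (closedBall_subset_ball hρR hz') hQ h3
      rw [mem_closedBall_zero_iff, h4, hn] at hz'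
      exact absurd hz' (not_le.2 hlt)
    · rw [push_of_not hex]
      push Not at hex
      exact fun z hz => hex z (closedBall_subset_ball hρR hz)
  · refine continuousOn_push hg hinj h0 h2 hκc hκ' fun w hw z hz h => ?_
    exact ⟨hκ0 _ (hV w hw z hz h), hκR _ (mem_ball_zero_iff.1 hz)⟩
  · intro w hw
    by_cases hex : ∃ z ∈ ball (0 : ℂ) R, w * g z = 1
    · obtain ⟨z, hz, h⟩ := hex
      have hz0 := ne_zero_of_mul_eq_one h0 h
      have hpos := hκ0 _ (hV w hw z hz h)
      have hn := norm_radial hz0 hpos.le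
      have hQ : radial κ z ∈ ball (0 : ℂ) R := by
        rw [mem_ball_zero_iff, hn]; exact hκR _ (mem_ball_zero_iff.1 hz)
      have hQ0 : radial κ z ≠ 0 := by rwa [← norm_pos_iff, hn]
      rw [push_of_eq hinj hz h, push_of_eq hinj hQ
        (inv_mul_cancel₀ (map_ne_zero_of_injOn hinj h0 hQ hQ0)),
        radial_radial hz0 hpos (hτκ _)]
      exact (eq_inv_of_mul_eq_one_left h).symm
    · rw [push_of_not hex, push_of_not hex]

lemma isPreconnected_invCompl (hg : DifferentiableOn ℂ g (ball 0 R)) (hinj : InjOn g (ball 0 R))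
    (h0 : g 0 = 0) (hρ : 0 < ρ) (hρR : ρ < R) : IsPreconnected (invCompl g ρ) := by
  obtain ⟨A, B, hA, hAm, -, hAB⟩ := exists_continuous_param hg hinj h0 hρ hρR
  have h1 : range A = invCompl g ρ :=
    Subset.antisymm (range_subset_iff.2 hAm) fun w hw => ⟨B w, hAB w hw⟩
  exact h1 ▸ isPreconnected_range hA

lemma hasContLog_invCompl (hg : DifferentiableOn ℂ g (ball 0 R)) (hinj : InjOn g (ball 0 R))
    (h0 : g 0 = 0) (hρ : 0 < ρ) (hρR : ρ < R) : HasContLog (invCompl g ρ) := by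
  obtain ⟨A, B, hA, hAm, hB, hAB⟩ := exists_continuous_param hg hinj h0 hρ hρR
  intro h hh hne
  have hsc : IsSimplyConnected (univ : Set ℂ) := by
    have := (convex_univ (𝕜 := ℝ) (E := ℂ)).contractibleSpace univ_nonempty
    exact SimplyConnectedSpace.ofContractible _
  obtain ⟨H, hH, hHe⟩ := Complex.exists_continuousOn_eqOn_exp_comp (U := (univ : Set ℂ))
    (g := fun z => h (A z)) hsc isOpen_univ
    (hh.comp hA.continuousOn fun w _ => hAm w) (by
      rintro ⟨w, -, hw⟩
      exact hne _ (hAm w) hw)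
  refine ⟨fun w => H (B w), (continuousOn_univ.1 hH).comp_continuousOn hB, fun w hw => ?_⟩
  have := hHe (mem_univ (B w))
  simpa [hAB w hw] using this

lemma map_eq_mul_dslope {p : ℂ → ℂ} (h0 : p 0 = 0) (z : ℂ) : p z = z * dslope p 0 z := by
  have := sub_smul_dslope p 0 z
  simpa [h0] using this.symm

/-- A univalent function vanishing at the origin is comparable to the identity. -/
lemma exists_bounds (hg : DifferentiableOn ℂ g (ball 0 R)) (hinj : InjOn g (ball 0 R))
    (h0 : g 0 = 0) (hρ : 0 < ρ) (hρR : ρ < R) : ∃ m M : ℝ, 0 < m ∧ 0 < M ∧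
      ∀ z ∈ closedBall (0 : ℂ) ρ, m * ‖z‖ ≤ ‖g z‖ ∧ ‖g z‖ ≤ M * ‖z‖ := by
  have hR : (0 : ℂ) ∈ ball (0 : ℂ) R := mem_ball_self (hρ.trans hρR)
  have hd : DifferentiableOn ℂ (dslope g 0) (ball 0 R) :=
    (differentiableOn_dslope (isOpen_ball.mem_nhds hR)).2 hg
  have hsub := closedBall_subset_ball (x := (0 : ℂ)) hρR
  have hcont : ContinuousOn (fun z => ‖dslope g 0 z‖) (closedBall 0 ρ) :=
    (hd.mono hsub).continuousOn.norm
  have heq := map_eq_mul_dslope h0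
  have hne : ∀ z ∈ ball (0 : ℂ) R, dslope g 0 z ≠ 0 := by
    intro z hz
    rcases eq_or_ne z 0 with rfl | hz0
    · rw [dslope_same]
      exact deriv_ne_zero_of_injOn isOpen_ball hg hinj hR
    · intro h
      refine map_ne_zero_of_injOn hinj h0 hz hz0 ?_
      rw [heq, h, mul_zero]
  have hK := isCompact_closedBall (0 : ℂ) ρ
  have hKn : (closedBall (0 : ℂ) ρ).Nonempty := ⟨0, mem_closedBall_self hρ.le⟩
  obtain ⟨a, ha, hmin⟩ := hK.exists_isMinOn hKn hcont
  obtain ⟨b, hb, hmax⟩ := hK.exists_isMaxOn hKn hcont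
  refine ⟨‖dslope g 0 a‖, ‖dslope g 0 b‖, norm_pos_iff.2 (hne a (hsub ha)),
    norm_pos_iff.2 (hne b (hsub hb)), fun z hz => ?_⟩
  rw [heq z, norm_mul, mul_comm ‖z‖]
  exact ⟨mul_le_mul_of_nonneg_right (hmin hz) (norm_nonneg z),
    mul_le_mul_of_nonneg_right (hmax hz) (norm_nonneg z)⟩

lemma norm_le_of_mem_invCompl (hg : DifferentiableOn ℂ g (ball 0 R)) (hinj : InjOn g (ball 0 R))
    (h0 : g 0 = 0) (hρ : 0 < ρ) (hρR : ρ < R) {m : ℝ} (hm : 0 < m)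
    (hlow : ∀ z ∈ closedBall (0 : ℂ) ρ, m * ‖z‖ ≤ ‖g z‖) {w : ℂ} (hw : w ∈ invCompl g ρ) :
    ‖w‖ ≤ 2 / (m * ρ) := by
  by_contra hlt
  push Not at hlt
  have hR : (0 : ℂ) ∈ ball (0 : ℂ) R := mem_ball_self (hρ.trans hρR)
  have hmρ : 0 < m * ρ := mul_pos hm hρ
  have hw0 : 0 < ‖w‖ := (by positivity : 0 < 2 / (m * ρ)).trans hlt
  have hdc : DiffContOnCl ℂ g (ball 0 ρ) := by
    refine DifferentiableOn.diffContOnCl ?_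
    rw [closure_ball _ hρ.ne']
    exact hg.mono (closedBall_subset_ball hρR)
  have hsub := hdc.ball_subset_image_closedBall hρ (ε := m * ρ) (fun z hz => by
    have h1 := hlow z (sphere_subset_closedBall hz)
    rw [mem_sphere_zero_iff_norm.1 hz] at h1
    rwa [h0, sub_zero]) (by
    have h1 : ∃ᶠ z in 𝓝[≠] (0 : ℂ), True :=
      frequently_true_iff_neBot _ |>.2 inferInstance
    have h2 := h1.and_eventually
      ((eventually_mem_nhdsWithin (a := (0 : ℂ)) (s := {0}ᶜ)).and
        (eventually_nhdsWithin_of_eventually_nhds (isOpen_ball.mem_nhds hR)))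
    refine (h2.filter_mono nhdsWithin_le_nhds).mono fun z hz => ?_
    rw [h0]
    exact map_ne_zero_of_injOn hinj h0 hz.2.2 hz.2.1)
  have hmem : w⁻¹ ∈ ball (g 0) (m * ρ / 2) := by
    rw [h0, mem_ball_zero_iff, norm_inv, inv_lt_comm₀ hw0 (by positivity), inv_div]
    exact hlt
  obtain ⟨z, hz, hgz⟩ := hsub hmem
  refine hw z hz ?_
  rw [hgz, mul_inv_cancel₀ (norm_pos_iff.1 hw0)]

lemma ball_subset_invCompl (hρ : 0 < ρ) {M : ℝ} (hM : 0 < M)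
    (hup : ∀ z ∈ closedBall (0 : ℂ) ρ, ‖g z‖ ≤ M * ‖z‖) :
    ball (0 : ℂ) (1 / (M * ρ)) ⊆ invCompl g ρ := by
  intro w hw z hz h
  rw [mem_ball_zero_iff, lt_div_iff₀ (by positivity)] at hw
  have h1 : ‖w‖ * ‖g z‖ = 1 := by rw [← norm_mul, h, norm_one]
  have h2 := hup z hz
  have h3 : M * ‖z‖ ≤ M * ρ := by gcongr; exact mem_closedBall_zero_iff.1 hz
  nlinarith [norm_nonneg w]

/-- The Riemann map of an inverted complement. -/
lemma exists_riemannMap_invCompl (hg : DifferentiableOn ℂ g (ball 0 R))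
    (hinj : InjOn g (ball 0 R)) (h0 : g 0 = 0) (hρ : 0 < ρ) (hρR : ρ < R) :
    ∃ p : ℂ → ℂ, DifferentiableOn ℂ p (ball 0 1) ∧ InjOn p (ball 0 1) ∧
      p '' ball 0 1 = invCompl g ρ ∧ p 0 = 0 ∧ ∃ r : ℝ, 0 < r ∧ deriv p 0 = r := by
  obtain ⟨m, M, hm, -, hb⟩ := exists_bounds hg hinj h0 hρ hρR
  exact exists_riemannMap (isOpen_invCompl hg hρR) (isPreconnected_invCompl hg hinj h0 hρ hρR)
    (zero_mem_invCompl g ρ)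
    (fun w hw => norm_le_of_mem_invCompl hg hinj h0 hρ hρR hm (fun z hz => (hb z hz).1) hw)
    (hasContLog_invCompl hg hinj h0 hρ hρR)

end InvCompl

/-- `p` is the normalised Riemann map of `Ω`, with derivative `r` at the origin. -/
structure IsRiemannMap (p : ℂ → ℂ) (Ω : Set ℂ) (r : ℝ) : Prop where
  differentiableOn : DifferentiableOn ℂ p (ball 0 1)
  injOn : InjOn p (ball 0 1)
  image_eq : p '' ball 0 1 = Ω
  map_zero : p 0 = 0
  pos : 0 < r
  deriv_zero : deriv p 0 = r

lemma exists_subordination {p q : ℂ → ℂ} {R : ℝ} (hR : 0 < R)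
    (hq : DifferentiableOn ℂ q (ball 0 R)) (hinj : InjOn q (ball 0 R)) (hq0 : q 0 = 0)
    (hp : DifferentiableOn ℂ p (ball 0 1)) (hp0 : p 0 = 0)
    (hm : MapsTo p (ball 0 1) (q '' ball 0 R)) :
    ∃ ω : ℂ → ℂ, DifferentiableOn ℂ ω (ball 0 1) ∧ ω 0 = 0 ∧ MapsTo ω (ball 0 1) (ball 0 R) ∧
      (∀ z ∈ ball (0 : ℂ) 1, q (ω z) = p z) ∧ deriv p 0 = deriv q 0 * deriv ω 0 := by
  set I := Function.invFunOn q (ball 0 R) with hI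
  have hId := differentiableOn_invFunOn isOpen_ball hq hinj
  have hd : DifferentiableOn ℂ (fun z => I (p z)) (ball 0 1) := hId.comp hp hm
  have hI0 : I (p 0) = 0 := by
    have h := hinj.leftInvOn_invFunOn (mem_ball_self hR)
    rw [hq0] at h
    rw [hp0]
    exact h
  have heq : ∀ z ∈ ball (0 : ℂ) 1, q (I (p z)) = p z := fun z hz =>
    Function.invFunOn_eq (hm hz)
  refine ⟨fun z => I (p z), hd, hI0, fun z hz => Function.invFunOn_mem (hm hz), heq, ?_⟩
  have hn : ball (0 : ℂ) 1 ∈ 𝓝 0 := ball_mem_nhds _ one_pos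
  have h1 := (hd.differentiableAt hn).hasDerivAt
  have h2 : HasDerivAt q (deriv q 0) (I (p 0)) := by
    rw [hI0]
    exact (hq.differentiableAt (ball_mem_nhds _ hR)).hasDerivAt
  have h3 : HasDerivAt (fun z => q (I (p z))) (deriv q 0 * deriv (fun z => I (p z)) 0) 0 :=
    HasDerivAt.comp (h₂ := q) (h := fun z => I (p z)) 0 h2 h1
  have h4 : HasDerivAt p (deriv q 0 * deriv (fun z => I (p z)) 0) 0 :=
    h3.congr_of_eventuallyEq (by filter_upwards [hn] with z hz using (heq z hz).symm)
  exact h4.deriv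

lemma IsRiemannMap.norm_deriv_le {p q : ℂ → ℂ} {Ω : Set ℂ} {r : ℝ} (hq : IsRiemannMap q Ω r)
    (hp : DifferentiableOn ℂ p (ball 0 1)) (hp0 : p 0 = 0) (hm : MapsTo p (ball 0 1) Ω) :
    ‖deriv p 0‖ ≤ r := by
  obtain ⟨ω, hω, hω0, hωm, -, hder⟩ := exists_subordination one_pos hq.differentiableOn hq.injOn
    hq.map_zero hp hp0 (by rwa [hq.image_eq])
  have h1 : ‖deriv ω 0‖ ≤ 1 := Complex.norm_deriv_le_one_of_mapsTo_ball hω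
    (by rw [hω0]; exact fun z hz => ball_subset_closedBall (hωm hz)) one_pos
  rw [hder, hq.deriv_zero, norm_mul, Complex.norm_real, Real.norm_of_nonneg hq.pos.le]
  exact mul_le_of_le_one_right hq.pos.le h1

section Radius

variable {g : ℂ → ℂ} {p : ℝ → ℂ → ℂ} {r : ℝ → ℝ}

lemma radius_anti (hpr : ∀ ρ ∈ Ioo (0 : ℝ) 1, IsRiemannMap (p ρ) (invCompl g ρ) (r ρ))
    {ρ ρ' : ℝ} (h : ρ ∈ Ioo (0 : ℝ) 1) (h' : ρ' ∈ Ioo (0 : ℝ) 1) (hle : ρ ≤ ρ') : r ρ' ≤ r ρ := by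
  have h1 := (hpr ρ h).norm_deriv_le (hpr ρ' h').differentiableOn (hpr ρ' h').map_zero
    (fun z hz => invCompl_anti g hle ((hpr ρ' h').image_eq ▸ mem_image_of_mem _ hz))
  rwa [(hpr ρ' h').deriv_zero, Complex.norm_real, Real.norm_of_nonneg (hpr ρ' h').pos.le] at h1

lemma exists_limit_map (hg : DifferentiableOn ℂ g (ball 0 1)) (hinj : InjOn g (ball 0 1))
    (h0 : g 0 = 0) (hpr : ∀ ρ ∈ Ioo (0 : ℝ) 1, IsRiemannMap (p ρ) (invCompl g ρ) (r ρ))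
    {ρ₀ y : ℝ} (hρ₀ : 0 < ρ₀) (hρ₁ : ρ₀ ≤ 1) (hy : 0 < y) (hr : ∀ ρ, 0 < ρ → ρ < ρ₀ → y ≤ r ρ) :
    ∃ P : ℂ → ℂ, DifferentiableOn ℂ P (ball 0 1) ∧ InjOn P (ball 0 1) ∧ P 0 = 0 ∧
      y ≤ ‖deriv P 0‖ ∧ ∀ z ∈ ball (0 : ℂ) 1, ∀ ζ ∈ ball (0 : ℂ) ρ₀, P z * g ζ ≠ 1 := by
  set l : Ultrafilter ℝ := Ultrafilter.of (𝓝[<] ρ₀) with hl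
  have hle : (l : Filter ℝ) ≤ 𝓝[<] ρ₀ := Ultrafilter.of_le _
  have hgt : ∀ a < ρ₀, ∀ᶠ ρ in (l : Filter ℝ), a < ρ ∧ ρ < ρ₀ := fun a ha =>
    hle (Ioo_mem_nhdsLT ha)
  have hmem : ∀ ρ, 0 < ρ → ρ < ρ₀ → ρ ∈ Ioo (0 : ℝ) 1 := fun ρ h h' => ⟨h, h'.trans_le hρ₁⟩
  have hev : ∀ᶠ ρ in (l : Filter ℝ), IsRiemannMap (p ρ) (invCompl g ρ) (r ρ) := by
    filter_upwards [hgt 0 hρ₀] with ρ hρ using hpr ρ (hmem ρ hρ.1 hρ.2)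
  have hhalf : ρ₀ / 2 < 1 := by linarith
  obtain ⟨m, M, hm, -, hb⟩ := exists_bounds hg hinj h0 (half_pos hρ₀) hhalf
  have hbd : ∀ w ∈ invCompl g (ρ₀ / 2), ‖w‖ ≤ 2 / (m * (ρ₀ / 2)) := fun w hw =>
    norm_le_of_mem_invCompl hg hinj h0 (half_pos hρ₀) hhalf hm (fun z hz => (hb z hz).1) hw
  obtain ⟨P, hpP, hPd⟩ := exists_tendstoLocallyUniformlyOn l isOpen_ball
    (U := ball 0 1) (F := p) (C := 2 / (m * (ρ₀ / 2))) (by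
      filter_upwards [hev, hgt (ρ₀ / 2) (half_lt_self hρ₀)] with ρ hρ hρ2
      refine ⟨hρ.differentiableOn, fun z hz => hbd _ (invCompl_anti g hρ2.1.le ?_)⟩
      exact hρ.image_eq ▸ mem_image_of_mem _ hz)
  have hdiff : ∀ᶠ ρ in (l : Filter ℝ), DifferentiableOn ℂ (p ρ) (ball 0 1) :=
    hev.mono fun ρ h => h.differentiableOn
  have hpinj : ∀ᶠ ρ in (l : Filter ℝ), InjOn (p ρ) (ball 0 1) := hev.mono fun ρ h => h.injOn
  have hz : (0 : ℂ) ∈ ball (0 : ℂ) 1 := mem_ball_self one_pos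
  have hder : Tendsto (fun ρ => deriv (p ρ) 0) l (𝓝 (deriv P 0)) :=
    (hpP.deriv hdiff isOpen_ball).tendsto_at hz
  have hyP : y ≤ ‖deriv P 0‖ := by
    refine ge_of_tendsto hder.norm ?_
    filter_upwards [hev, hgt 0 hρ₀] with ρ hρ hρ2
    rw [hρ.deriv_zero, Complex.norm_real, Real.norm_of_nonneg hρ.pos.le]
    exact hr ρ hρ2.1 hρ2.2
  have hPinj : InjOn P (ball 0 1) := injOn_of_tendstoLocallyUniformlyOn isOpen_ball
    (convex_ball _ _).isPreconnected hpP hdiff hpinj hz (norm_pos_iff.1 (hy.trans_le hyP))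
  refine ⟨P, hPd, hPinj, ?_, hyP, ?_⟩
  · refine tendsto_nhds_unique (hpP.tendsto_at hz) (Tendsto.congr' ?_ tendsto_const_nhds)
    filter_upwards [hev] with ρ hρ using hρ.map_zero.symm
  · intro z hz ζ hζ h
    have hnc : ¬ ∀ᶠ w in 𝓝 z, P w = P z := by
      intro hc
      have h1 : deriv P z = 0 := by
        rw [EventuallyEq.deriv_eq (f := fun _ => P z) hc, deriv_const]
      exact deriv_ne_zero_of_injOn isOpen_ball hPd hPinj hz h1
    obtain ⟨δ, hδ, hball⟩ := Metric.isOpen_iff.1 isOpen_ball z hz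
    obtain ⟨t, ht, htδ, hev2⟩ := eventually_mem_image_closedBall isOpen_ball hpP hdiff hpinj hz hnc hδ
    obtain ⟨ρ, hρ, hρ2, w, hw, hwP⟩ :=
      (hev.and ((hgt _ (mem_ball_zero_iff.1 hζ)).and hev2)).exists
    have hw1 : p ρ w ∈ invCompl g ρ :=
      hρ.image_eq ▸ mem_image_of_mem _ (hball (closedBall_subset_ball htδ hw))
    rw [hwP] at hw1
    exact hw1 ζ (mem_closedBall_zero_iff.2 hρ2.1.le) h

lemma exists_radius_gt (hg : DifferentiableOn ℂ g (ball 0 1))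
    (hpr : ∀ ρ ∈ Ioo (0 : ℝ) 1, IsRiemannMap (p ρ) (invCompl g ρ) (r ρ))
    {ρ₀ y : ℝ} (hρ₀ : ρ₀ ∈ Ioo (0 : ℝ) 1) (hy : 0 < y) (hr : y < r ρ₀) :
    ∃ ρ ∈ Ioo ρ₀ 1, y ≤ r ρ := by
  have hR := hpr ρ₀ hρ₀
  set s : ℝ := y / r ρ₀ with hs
  have hs0 : 0 < s := div_pos hy hR.pos
  have hs1 : s < 1 := (div_lt_one hR.pos).2 hr
  have hcomp : IsCompact (closedBall (0 : ℂ) s ×ˢ closedBall (0 : ℂ) 1) :=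
    (isCompact_closedBall _ _).prod (isCompact_closedBall _ _)
  have hev : ∀ᶠ ρ : ℝ in 𝓝 ρ₀, ∀ x ∈ closedBall (0 : ℂ) s ×ˢ closedBall (0 : ℂ) 1,
      p ρ₀ x.1 * g ((ρ : ℂ) * x.2) ≠ 1 := by
    refine hcomp.eventually_forall_of_forall_eventually
      (P := fun (ρ : ℝ) (x : ℂ × ℂ) => p ρ₀ x.1 * g (ρ * x.2) ≠ 1) ?_
    rintro ⟨z, ζ⟩ ⟨hz, hζ⟩
    have hz1 : z ∈ ball (0 : ℂ) 1 := closedBall_subset_ball hs1 hz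
    have hζρ : ‖(ρ₀ : ℂ) * ζ‖ ≤ ρ₀ := by
      rw [norm_mul, Complex.norm_real, Real.norm_of_nonneg hρ₀.1.le]
      exact mul_le_of_le_one_right hρ₀.1.le (mem_closedBall_zero_iff.1 hζ)
    have hζ1 : (ρ₀ : ℂ) * ζ ∈ ball (0 : ℂ) 1 := mem_ball_zero_iff.2 (hζρ.trans_lt hρ₀.2)
    have c1 : ContinuousAt (fun x : ℝ × ℂ × ℂ => p ρ₀ x.2.1) (ρ₀, z, ζ) :=
      ContinuousAt.comp_of_eq (hR.differentiableOn.continuousOn.continuousAt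
        (isOpen_ball.mem_nhds hz1)) (by fun_prop) rfl
    have c2 : ContinuousAt (fun x : ℝ × ℂ × ℂ => g ((x.1 : ℂ) * x.2.2)) (ρ₀, z, ζ) :=
      ContinuousAt.comp_of_eq (hg.continuousOn.continuousAt
        (isOpen_ball.mem_nhds hζ1)) (by fun_prop) rfl
    refine (c1.mul c2).eventually_ne ?_
    have h1 : p ρ₀ z ∈ invCompl g ρ₀ := hR.image_eq ▸ mem_image_of_mem _ hz1
    exact h1 _ (mem_closedBall_zero_iff.2 hζρ)
  have hev2 : ∀ᶠ ρ in 𝓝[>] ρ₀, ρ ∈ Ioo ρ₀ 1 := Ioo_mem_nhdsGT hρ₀.2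
  obtain ⟨ρ, hρ, hρ2⟩ := (hev2.and (hev.filter_mono nhdsWithin_le_nhds)).exists
  have hρ0 : 0 < ρ := hρ₀.1.trans hρ.1
  refine ⟨ρ, hρ, ?_⟩
  have hmap : MapsTo (fun z : ℂ => (s : ℂ) * z) (ball 0 1) (closedBall 0 s) := by
    intro z hz
    rw [mem_closedBall_zero_iff, norm_mul, Complex.norm_real, Real.norm_of_nonneg hs0.le]
    exact mul_le_of_le_one_right hs0.le (mem_ball_zero_iff.1 hz).le
  have hd : DifferentiableOn ℂ (fun z : ℂ => p ρ₀ ((s : ℂ) * z)) (ball 0 1) :=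
    hR.differentiableOn.comp (by fun_prop)
      (hmap.mono_right (closedBall_subset_ball hs1))
  have h1 := (hpr ρ ⟨hρ0, hρ.2⟩).norm_deriv_le hd (by simp [hR.map_zero]) (by
    intro z hz ζ hζ
    have h2 := hρ2 ((s : ℂ) * z, ζ / ρ) ⟨hmap hz, by
      simp only [mem_closedBall_zero_iff, norm_div, Complex.norm_real]
      rw [Real.norm_of_nonneg hρ0.le, div_le_one hρ0]
      exact mem_closedBall_zero_iff.1 hζ⟩
    simp only at h2
    rwa [mul_div_cancel₀ _ (ofReal_ne_zero.2 hρ0.ne')] at h2)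
  have h2 : HasDerivAt (fun z : ℂ => p ρ₀ ((s : ℂ) * z)) (r ρ₀ * ((s : ℂ) * 1)) 0 := by
    have h3 : HasDerivAt (p ρ₀) (r ρ₀ : ℂ) ((s : ℂ) * 0) := by
      rw [mul_zero, ← hR.deriv_zero]
      exact (hR.differentiableOn.differentiableAt (ball_mem_nhds _ one_pos)).hasDerivAt
    exact HasDerivAt.comp (h₂ := p ρ₀) (h := fun z : ℂ => (s : ℂ) * z) 0 h3
      ((hasDerivAt_id (0 : ℂ)).const_mul (s : ℂ))
  rw [h2.deriv, mul_one, ← ofReal_mul, Complex.norm_real,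
    Real.norm_of_nonneg (mul_pos hR.pos hs0).le, hs, mul_div_cancel₀ _ hR.pos.ne'] at h1
  exact h1

lemma le_radius (hpr : ∀ ρ ∈ Ioo (0 : ℝ) 1, IsRiemannMap (p ρ) (invCompl g ρ) (r ρ)) {ρ M : ℝ}
    (hρ : ρ ∈ Ioo (0 : ℝ) 1) (hM : 0 < M)
    (hup : ∀ z ∈ closedBall (0 : ℂ) ρ, ‖g z‖ ≤ M * ‖z‖) : 1 / (M * ρ) ≤ r ρ := by
  have hsub := ball_subset_invCompl hρ.1 hM hup
  have hpos : 0 < 1 / (M * ρ) := by have := hρ.1; positivity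
  set a : ℝ := 1 / (M * ρ) with ha
  have h1 := (hpr ρ hρ).norm_deriv_le (p := fun z => (a : ℂ) * z) (by fun_prop) (by simp) (by
    intro z hz
    refine hsub ?_
    rw [mem_ball_zero_iff, norm_mul, Complex.norm_real, Real.norm_of_nonneg hpos.le]
    exact mul_lt_of_lt_one_right hpos (mem_ball_zero_iff.1 hz))
  have h2 : HasDerivAt (fun z : ℂ => (a : ℂ) * z) ((a : ℂ) * 1) 0 :=
    (hasDerivAt_id (0 : ℂ)).const_mul (a : ℂ)
  rwa [h2.deriv, mul_one, Complex.norm_real, Real.norm_of_nonneg hpos.le] at h1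

lemma exists_radius_eq (hg : DifferentiableOn ℂ g (ball 0 1)) (hinj : InjOn g (ball 0 1))
    (h0 : g 0 = 0) (hpr : ∀ ρ ∈ Ioo (0 : ℝ) 1, IsRiemannMap (p ρ) (invCompl g ρ) (r ρ))
    {y : ℝ} (hy : 0 < y)
    (hlim : ∀ P : ℂ → ℂ, DifferentiableOn ℂ P (ball 0 1) → P 0 = 0 →
      (∀ z ∈ ball (0 : ℂ) 1, ∀ ζ ∈ ball (0 : ℂ) 1, P z * g ζ ≠ 1) → ‖deriv P 0‖ < y) :
    ∃ ρ ∈ Ioo (0 : ℝ) 1, r ρ = y := by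
  obtain ⟨m, M, -, hM, hb⟩ := exists_bounds hg hinj h0 (half_pos one_pos) one_half_lt_one
  set A : Set ℝ := {ρ | ρ ∈ Ioo (0 : ℝ) 1 ∧ y ≤ r ρ} with hA
  have hbdd : BddAbove A := ⟨1, fun ρ hρ => hρ.1.2.le⟩
  have hne : A.Nonempty := by
    have hpos : 0 < min (1 / 2) (1 / (M * y)) := lt_min (by norm_num) (by positivity)
    have hlt : min (1 / 2) (1 / (M * y)) < 1 := (min_le_left _ _).trans_lt one_half_lt_one
    refine ⟨min (1 / 2) (1 / (M * y)), ⟨hpos, hlt⟩, ?_⟩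
    refine le_trans ?_ (le_radius hpr ⟨hpos, hlt⟩ hM fun z hz =>
      (hb z (closedBall_subset_closedBall (min_le_left _ _) hz)).2)
    rw [le_div_iff₀ (by positivity)]
    calc y * (M * min (1 / 2) (1 / (M * y))) ≤ y * (M * (1 / (M * y))) := by
          gcongr; exact min_le_right _ _
      _ = 1 := by field_simp
  set ρ₀ := sSup A with hρ₀
  have hle : ∀ ρ ∈ A, ρ ≤ ρ₀ := fun ρ hρ => le_csSup hbdd hρ
  have hpos : 0 < ρ₀ := by
    obtain ⟨a, ha⟩ := hne
    exact ha.1.1.trans_le (hle a ha)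
  have hle1 : ρ₀ ≤ 1 := csSup_le hne fun ρ hρ => hρ.1.2.le
  have hbelow : ∀ ρ, 0 < ρ → ρ < ρ₀ → y ≤ r ρ := by
    intro ρ h1 h2
    obtain ⟨a, ha, hρa⟩ := exists_lt_of_lt_csSup hne h2
    exact ha.2.trans (radius_anti hpr ⟨h1, hρa.trans ha.1.2⟩ ha.1 hρa.le)
  obtain ⟨P, hPd, hPinj, hP0, hyP, hav⟩ := exists_limit_map hg hinj h0 hpr hpos hle1 hy hbelow
  have hlt1 : ρ₀ < 1 := by
    refine lt_of_le_of_ne hle1 fun h => ?_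
    rw [h] at hav
    exact absurd hyP (not_le.2 (hlim P hPd hP0 hav))
  refine ⟨ρ₀, ⟨hpos, hlt1⟩, le_antisymm ?_ ?_⟩
  · by_contra h
    obtain ⟨ρ, hρ, hyρ⟩ := exists_radius_gt hg hpr ⟨hpos, hlt1⟩ hy (not_le.1 h)
    exact absurd (hle ρ ⟨⟨hpos.trans hρ.1, hρ.2⟩, hyρ⟩) (not_le.2 hρ.1)
  · refine hyP.trans ((hpr ρ₀ ⟨hpos, hlt1⟩).norm_deriv_le hPd hP0 fun z hz ζ hζ h => ?_)
    have hζ1 : ζ ∈ ball (0 : ℂ) 1 := closedBall_subset_ball hlt1 hζ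
    have hζ0 := ne_zero_of_mul_eq_one h0 h
    have hgζ := map_ne_zero_of_injOn hinj h0 hζ1 hζ0
    have hopen := isOpen_image_of_injOn isOpen_ball hPd hPinj
    have hcont : ContinuousAt (fun t : ℝ => (g ((t : ℂ) * ζ))⁻¹) 1 := by
      refine ContinuousAt.inv₀ (ContinuousAt.comp_of_eq (hg.continuousOn.continuousAt
        (isOpen_ball.mem_nhds hζ1)) (by fun_prop) (by simp)) (by simpa using hgζ)
    have hPz : (g (((1 : ℝ) : ℂ) * ζ))⁻¹ ∈ P '' ball 0 1 := by
      rw [ofReal_one, one_mul, ← eq_inv_of_mul_eq_one_left h]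
      exact mem_image_of_mem _ hz
    have hev := hcont.eventually_mem (hopen.mem_nhds hPz)
    have hev2 : ∀ᶠ t in 𝓝[<] (1 : ℝ), t ∈ Ioo (0 : ℝ) 1 := Ioo_mem_nhdsLT one_pos
    obtain ⟨t, ht, z', hz', hPt⟩ := (hev2.and (hev.filter_mono nhdsWithin_le_nhds)).exists
    have htζ : ‖(t : ℂ) * ζ‖ < ρ₀ := by
      rw [norm_mul, Complex.norm_real, Real.norm_of_nonneg ht.1.le]
      have h1 := mem_closedBall_zero_iff.1 hζ
      have h2 := norm_pos_iff.2 hζ0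
      nlinarith [ht.2]
    refine hav z' hz' ((t : ℂ) * ζ) (mem_ball_zero_iff.2 htζ) ?_
    rw [hPt]
    refine inv_mul_cancel₀ (map_ne_zero_of_injOn hinj h0
      (mem_ball_zero_iff.2 (htζ.trans hlt1)) ?_)
    exact mul_ne_zero (ofReal_ne_zero.2 ht.1.ne') hζ0

end Radius

/-- Increasing families of domains swept out by normalised Riemann maps. -/
lemma exists_chain {f : ℂ → ℂ} {R : ℝ} (hR : 1 < R) (hf : DifferentiableOn ℂ f (ball 0 R))
    (hinj : InjOn f (ball 0 R)) (h0 : f 0 = 0) (h1 : deriv f 0 = 1) :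
    ∃ (P : ℝ → ℂ → ℂ) (Ω : ℝ → Set ℂ) (K : ℝ), P 0 = f ∧ 1 < K ∧
      (∀ s, 0 ≤ s → IsRiemannMap (P s) (Ω s) (Real.exp s)) ∧
      (∀ s s', 0 ≤ s → s ≤ s' → Ω s ⊆ Ω s') ∧
      ∀ s, 0 ≤ s → ∀ w ∈ Ω s, ‖w‖ ≤ K * Real.exp s := by
  have hsub : ball (0 : ℂ) 1 ⊆ ball 0 R := ball_subset_ball hR.le
  have hfR : IsRiemannMap f (f '' ball 0 1) (Real.exp 0) :=
    ⟨hf.mono hsub, hinj.mono hsub, rfl, h0, Real.exp_pos _, by simp [h1]⟩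
  obtain ⟨g, hg, hginj, hgim, hg0, -⟩ := exists_riemannMap_invCompl hf hinj h0 one_pos hR
  have hex : ∀ ρ : ℝ, ∃ p : ℂ → ℂ, ∃ r : ℝ, ρ ∈ Ioo (0 : ℝ) 1 →
      IsRiemannMap p (invCompl g ρ) r := by
    intro ρ
    by_cases hρ : ρ ∈ Ioo (0 : ℝ) 1
    · obtain ⟨p, hp, hpi, hpim, hp0, r, hr, hpr⟩ :=
        exists_riemannMap_invCompl hg hginj hg0 hρ.1 hρ.2
      exact ⟨p, r, fun _ => ⟨hp, hpi, hpim, hp0, hr, hpr⟩⟩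
    · exact ⟨0, 0, fun h => absurd h hρ⟩
  choose p r hpr using hex
  have hfsub : ∀ ρ < 1, f '' ball 0 1 ⊆ invCompl g ρ := by
    rintro ρ hρ _ ⟨z, hz, rfl⟩ ζ hζ h
    have h2 : g ζ ∈ invCompl f 1 := hgim ▸ mem_image_of_mem g (closedBall_subset_ball hρ hζ)
    exact h2 z (ball_subset_closedBall hz) (by rwa [mul_comm])
  have hlim : ∀ P : ℂ → ℂ, DifferentiableOn ℂ P (ball 0 1) → P 0 = 0 →
      (∀ z ∈ ball (0 : ℂ) 1, ∀ ζ ∈ ball (0 : ℂ) 1, P z * g ζ ≠ 1) → ‖deriv P 0‖ ≤ 1 := by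
    intro P hP hP0 hav
    have him : ∀ z ∈ ball (0 : ℂ) 1, ∃ ζ ∈ closedBall (0 : ℂ) 1, f ζ = P z := by
      intro z hz
      rcases eq_or_ne (P z) 0 with hPz | hPz
      · exact ⟨0, mem_closedBall_self zero_le_one, by rw [h0, hPz]⟩
      · have hn : (P z)⁻¹ ∉ invCompl f 1 := by
          rw [← hgim]
          rintro ⟨ζ, hζ, hgζ⟩
          exact hav z hz ζ hζ (by rw [hgζ, mul_inv_cancel₀ hPz])
        simp only [invCompl, Set.mem_ofPred_eq, not_forall, not_not] at hn
        obtain ⟨ζ, hζ, h⟩ := hn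
        exact ⟨ζ, hζ, by rwa [inv_mul_eq_one₀ hPz, eq_comm] at h⟩
    have hsub' := closedBall_subset_ball (x := (0 : ℂ)) hR
    obtain ⟨ω, hω, hω0, hωm, hωe, hder⟩ := exists_subordination (zero_lt_one.trans hR) hf hinj h0
      hP hP0 (by
        intro z hz
        obtain ⟨ζ, hζ, h⟩ := him z hz
        exact ⟨ζ, hsub' hζ, h⟩)
    rw [hder, h1, one_mul]
    refine Complex.norm_deriv_le_one_of_mapsTo_ball hω ?_ one_pos
    intro z hz
    obtain ⟨ζ, hζ, h⟩ := him z hz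
    rw [hω0, hinj (hωm hz) (hsub' hζ) ((hωe z hz).trans h.symm)]
    exact hζ
  have hrad : ∀ s : ℝ, ∃ ρ : ℝ, 0 < s → ρ ∈ Ioo (0 : ℝ) 1 ∧ r ρ = Real.exp s := by
    intro s
    by_cases hs : 0 < s
    · obtain ⟨ρ, hρ, h⟩ := exists_radius_eq hg hginj hg0 hpr (Real.exp_pos s)
        fun P hP hP0 hav => (hlim P hP hP0 hav).trans_lt (Real.one_lt_exp_iff.2 hs)
      exact ⟨ρ, fun _ => ⟨hρ, h⟩⟩
    · exact ⟨0, fun h => absurd h hs⟩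
  choose ρ hρ using hrad
  obtain ⟨m, M, hm, hM, hb⟩ := exists_bounds hg hginj hg0 (half_pos one_pos) one_half_lt_one
  have hlow : ∀ t, 0 < t → t ≤ 1 / 2 → ∀ w ∈ invCompl g t, ‖w‖ ≤ 2 / (m * t) := fun t ht ht' w hw =>
    norm_le_of_mem_invCompl hg hginj hg0 ht (ht'.trans_lt one_half_lt_one) hm
      (fun z hz => (hb z (closedBall_subset_closedBall ht' hz)).1) hw
  have hK1 : 0 < 2 * M / m := by positivity
  have hK2 : 0 < 4 / m := by positivity
  have hhalf : ∀ s, 0 ≤ s → ∀ w ∈ invCompl g (1 / 2),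
      ‖w‖ ≤ (2 * M / m + 4 / m + 2) * Real.exp s := by
    intro s hs w hw
    have e1 := hlow _ (by norm_num) le_rfl w hw
    have e2 : 2 / (m * (1 / 2)) = 4 / m := by field_simp; norm_num
    have e3 := Real.one_le_exp hs
    rw [e2] at e1
    nlinarith
  refine ⟨fun s => if 0 < s then p (ρ s) else f,
    fun s => if 0 < s then invCompl g (ρ s) else f '' ball 0 1, 2 * M / m + 4 / m + 2,
    if_neg (lt_irrefl _), by linarith, ?_, ?_, ?_⟩
  · intro s hs
    rcases hs.eq_or_lt with rfl | hs
    · simpa using hfR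
    · simp only [if_pos hs]
      have := hpr (ρ s) (hρ s hs).1
      rwa [(hρ s hs).2] at this
  · intro s s' hs hss'
    rcases hs.eq_or_lt with rfl | hs
    · rcases hss'.eq_or_lt with rfl | hs'
      · exact Subset.rfl
      · simp only [lt_irrefl, if_false, if_pos hs']
        exact hfsub _ (hρ s' hs').1.2
    · have hs' : 0 < s' := hs.trans_le hss'
      simp only [if_pos hs, if_pos hs']
      rcases le_or_gt (ρ s') (ρ s) with h | h
      · exact invCompl_anti g h
      · have h2 := radius_anti hpr (hρ s hs).1 (hρ s' hs').1 h.le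
        rw [(hρ s hs).2, (hρ s' hs').2, Real.exp_le_exp] at h2
        rw [le_antisymm hss' h2]
  · intro s hs w hw
    rcases hs.eq_or_lt with rfl | hs
    · simp only [lt_irrefl, if_false] at hw
      exact hhalf 0 le_rfl w (hfsub _ one_half_lt_one hw)
    · simp only [if_pos hs] at hw
      obtain ⟨hρs, hrs⟩ := hρ s hs
      rcases le_or_gt (ρ s) (1 / 2) with h | h
      · have e1 := hlow _ hρs.1 h w hw
        have e2 := le_radius hpr hρs hM fun z hz => (hb z (closedBall_subset_closedBall h hz)).2
        rw [hrs] at e2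
        have e3 : 2 / (m * ρ s) = 2 * M / m * (1 / (M * ρ s)) := by
          have := hρs.1
          field_simp
        have e4 : 2 * M / m * (1 / (M * ρ s)) ≤ 2 * M / m * Real.exp s := by gcongr
        have e5 := Real.exp_pos s
        rw [e3] at e1
        nlinarith
      · exact hhalf s hs.le w (invCompl_anti g h.le hw)

lemma differentiableOn_dslope_zero {p : ℂ → ℂ} (hp : DifferentiableOn ℂ p (ball 0 1)) :
    DifferentiableOn ℂ (dslope p 0) (ball 0 1) :=
  (differentiableOn_dslope (ball_mem_nhds (0 : ℂ) one_pos)).2 hp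

lemma dslope_ne_zero_of_injOn {p : ℂ → ℂ} (hp : DifferentiableOn ℂ p (ball 0 1))
    (hinj : InjOn p (ball 0 1)) (h0 : p 0 = 0) {z : ℂ} (hz : z ∈ ball (0 : ℂ) 1) :
    dslope p 0 z ≠ 0 := by
  rcases eq_or_ne z 0 with rfl | hz0
  · rw [dslope_same]
    exact deriv_ne_zero_of_injOn isOpen_ball hp hinj hz
  · intro h
    refine map_ne_zero_of_injOn hinj h0 hz hz0 ?_
    rw [map_eq_mul_dslope h0, h, mul_zero]

/-- The logarithm of a normalised Riemann map divided by its linear part. -/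
lemma IsRiemannMap.exists_log {p : ℂ → ℂ} {Ω : Set ℂ} {r K : ℝ} (hp : IsRiemannMap p Ω r)
    (hK : 1 < K) (hbd : ∀ w ∈ Ω, ‖w‖ ≤ K * r) :
    ∃ L : ℂ → ℂ, DifferentiableOn ℂ L (ball 0 1) ∧ L 0 = 0 ∧
      (∀ z ∈ ball (0 : ℂ) 1, p z = r * z * cexp (L z)) ∧
      ∀ z, ‖z‖ ≤ 3 / 4 → ‖L z‖ ≤ 6 * Real.log K := by
  have hr : (r : ℂ) ≠ 0 := ofReal_ne_zero.2 hp.pos.ne'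
  obtain ⟨L, hL, hL0, hexp⟩ := DeBranges.exists_log (g := fun z => dslope p 0 z / r) (c := 0)
    ((differentiableOn_dslope_zero hp.differentiableOn).div_const _)
    (fun z hz => div_ne_zero
      (dslope_ne_zero_of_injOn hp.differentiableOn hp.injOn hp.map_zero hz) hr)
    (by rw [dslope_same, hp.deriv_zero, div_self hr, Complex.exp_zero])
  refine ⟨L, hL, hL0, fun z hz => ?_, fun z hz => ?_⟩
  · rw [hexp z hz, map_eq_mul_dslope hp.map_zero]
    field_simp
  · have hlog : 0 < Real.log K := Real.log_pos hK
    have hre : MapsTo L (ball 0 1) {z | z.re ≤ Real.log K} := by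
      intro z hz
      have h1 : ‖dslope p 0 z‖ ≤ K * r / 1 := Complex.norm_dslope_le_div_of_mapsTo_ball
        hp.differentiableOn (by
          intro w hw
          rw [hp.map_zero, mem_closedBall_zero_iff]
          exact hbd _ (hp.image_eq ▸ mem_image_of_mem p hw)) hz
      have h2 := congrArg norm (hexp z hz)
      rw [Complex.norm_exp, norm_div, Complex.norm_real, Real.norm_of_nonneg hp.pos.le] at h2
      rw [Set.mem_ofPred_eq, Real.le_log_iff_exp_le (zero_lt_one.trans hK), h2,
        div_le_iff₀ hp.pos]
      simpa using h1
    have hz1 : z ∈ ball (0 : ℂ) 1 := mem_ball_zero_iff.2 (by linarith)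
    refine (Complex.borelCaratheodory_zero hlog hL hre one_pos hz1 hL0).trans ?_
    rw [div_le_iff₀ (by linarith)]
    nlinarith [norm_nonneg z]

lemma exists_subordination_log {p q L M : ℂ → ℂ} {Ω Ω' : Set ℂ} {s s' : ℝ}
    (hp : IsRiemannMap p Ω (Real.exp s)) (hq : IsRiemannMap q Ω' (Real.exp s')) (hΩ : Ω ⊆ Ω')
    (hss' : s < s') (hL : DifferentiableOn ℂ L (ball 0 1)) (hL0 : L 0 = 0)
    (hpL : ∀ z ∈ ball (0 : ℂ) 1, p z = Real.exp s * z * cexp (L z))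
    (hM : DifferentiableOn ℂ M (ball 0 1)) (hM0 : M 0 = 0)
    (hqM : ∀ z ∈ ball (0 : ℂ) 1, q z = Real.exp s' * z * cexp (M z)) :
    ∃ Q : ℂ → ℂ, DifferentiableOn ℂ Q (ball 0 1) ∧ (∀ z ∈ ball (0 : ℂ) 1, 0 ≤ (Q z).re) ∧
      Q 0 = 1 ∧ ∀ z ∈ ball (0 : ℂ) 1, L z = ((s' - s : ℝ) : ℂ) * (1 - Q z) +
        M (z * cexp (-((s' - s : ℝ) : ℂ) * Q z)) := by
  obtain ⟨ω, hω, hω0, hωm, hωe, hder⟩ := exists_subordination one_pos hq.differentiableOn hq.injOn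
    hq.map_zero hp.differentiableOn hp.map_zero (by
      rw [hq.image_eq]
      exact fun z hz => hΩ (hp.image_eq ▸ mem_image_of_mem p hz))
  have hωinj : InjOn ω (ball 0 1) := by
    intro z hz w hw h
    refine hp.injOn hz hw ?_
    rw [← hωe z hz, ← hωe w hw, h]
  have hh : 0 < s' - s := sub_pos.2 hss'
  have hhC : ((s' - s : ℝ) : ℂ) ≠ 0 := ofReal_ne_zero.2 hh.ne'
  have hω' : cexp (-((s' - s : ℝ) : ℂ)) = dslope ω 0 0 := by
    rw [dslope_same]
    rw [hp.deriv_zero, hq.deriv_zero] at hder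
    have : (Real.exp s' : ℂ) ≠ 0 := ofReal_ne_zero.2 (Real.exp_pos _).ne'
    refine mul_left_cancel₀ this ?_
    rw [← hder, ofReal_exp, ofReal_exp, ← Complex.exp_add]
    congr 1
    push_cast
    ring
  obtain ⟨l, hl, hl0, hle⟩ := exists_log (differentiableOn_dslope_zero hω)
    (fun z hz => dslope_ne_zero_of_injOn hω hωinj hω0 hz) hω'
  have hωl : ∀ z ∈ ball (0 : ℂ) 1, ω z = z * cexp (l z) := fun z hz => by
    rw [hle z hz, ← map_eq_mul_dslope hω0]
  have hkey : EqOn L (fun z => ((s' - s : ℝ) : ℂ) + l z + M (ω z)) (ball 0 1) := by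
    refine eqOn_of_exp_eq hL ((hl.const_add _).add (hM.comp hω hωm)) ?_ ?_
    · rw [hL0, hl0, hω0, hM0]
      ring
    · intro z hz
      rcases eq_or_ne z 0 with rfl | hz0
      · rw [hL0, hl0, hω0, hM0]
        congr 1
        ring
      · have h1 := hωe z hz
        rw [hpL z hz, hqM _ (hωm hz)] at h1
        rw [Complex.exp_add, Complex.exp_add]
        have h2 : cexp ((s' - s : ℝ) : ℂ) = Real.exp s' / Real.exp s := by
          rw [ofReal_exp, ofReal_exp, ← Complex.exp_sub, ofReal_sub]
        have h3 : (Real.exp s : ℂ) ≠ 0 := ofReal_ne_zero.2 (Real.exp_pos _).ne'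
        rw [h2]
        refine mul_left_cancel₀ (mul_ne_zero h3 hz0) ?_
        rw [← h1]
        nth_rewrite 1 [hωl z hz]
        field_simp
  refine ⟨fun z => -l z / ((s' - s : ℝ) : ℂ), hl.neg.div_const _, fun z hz => ?_, ?_,
    fun z hz => ?_⟩
  · have h1 : ‖dslope ω 0 z‖ ≤ 1 / 1 := Complex.norm_dslope_le_div_of_mapsTo_ball hω
      (by rw [hω0]; exact fun w hw => ball_subset_closedBall (hωm hw)) hz
    rw [← hle z hz, Complex.norm_exp, div_one, Real.exp_le_one_iff] at h1
    rw [Complex.div_ofReal_re, Complex.neg_re]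
    exact div_nonneg (by linarith) hh.le
  · simp only
    rw [hl0, neg_neg, div_self hhC]
  · have h1 : -((s' - s : ℝ) : ℂ) * (-l z / ((s' - s : ℝ) : ℂ)) = l z := by field_simp
    simp only
    rw [h1, ← hωl z hz, hkey hz]
    simp only
    field_simp
    ring

/-- The coefficient bound for functions univalent on a neighbourhood of the closed disc. -/
lemma norm_taylorCoeff_le_of_injOn {f : ℂ → ℂ} {R : ℝ} (hR : 1 < R)
    (hf : DifferentiableOn ℂ f (ball 0 R)) (hinj : InjOn f (ball 0 R)) (h0 : f 0 = 0)
    (h1 : deriv f 0 = 1) (n : ℕ) : ‖taylorCoeff f (n + 1)‖ ≤ n + 1 := by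
  obtain ⟨P, Ω, K, hP0, hK, hP, hΩ, hbd⟩ := exists_chain hR hf hinj h0 h1
  have hex : ∀ s : ℝ, ∃ L : ℂ → ℂ, 0 ≤ s → DifferentiableOn ℂ L (ball 0 1) ∧ L 0 = 0 ∧
      (∀ z ∈ ball (0 : ℂ) 1, P s z = Real.exp s * z * cexp (L z)) ∧
      ∀ z, ‖z‖ ≤ 3 / 4 → ‖L z‖ ≤ 6 * Real.log K := by
    intro s
    by_cases hs : 0 ≤ s
    · obtain ⟨L, hL⟩ := (hP s hs).exists_log hK (hbd s hs)
      exact ⟨L, fun _ => hL⟩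
    · exact ⟨0, fun h => absurd h hs⟩
  choose L hL using hex
  have hmilin := milin_of_chain (L := L) (fun s hs => (hL s hs).1) (fun s hs => (hL s hs).2.2.2) (by
    intro s s' hs hss'
    have hs' := hs.trans hss'
    rcases hss'.eq_or_lt with rfl | hlt
    · exact ⟨fun _ => 1, differentiableOn_const _, fun _ _ => by simp, rfl, fun z _ => by simp⟩
    · exact exists_subordination_log (hP s hs) (hP s' hs') (hΩ s s' hs hss') hlt (hL s hs).1
        (hL s hs).2.1 (hL s hs).2.2.1 (hL s' hs').1 (hL s' hs').2.1 (hL s' hs').2.2.1) n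
  obtain ⟨hLd, hL0, hLe, -⟩ := hL 0 le_rfl
  have h2 := norm_taylorCoeff_le_of_milin hLd hL0 n hmilin
  rwa [taylorCoeff_congr_ball (g := f) (fun z hz => ?_)] at h2
  have h3 := hLe z hz
  rw [hP0] at h3
  simp [h3]

lemma taylorCoeff_comp_const_mul {f : ℂ → ℂ} (hf : DifferentiableOn ℂ f (ball 0 1)) {c : ℂ}
    (hc : ‖c‖ ≤ 1) (n : ℕ) : taylorCoeff (fun z => f (c * z)) n = c ^ n * taylorCoeff f n := by
  have h0 : (0 : ℂ) ∈ ball (0 : ℂ) 1 := mem_ball_self one_pos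
  have h := iteratedDerivWithin_comp_const_smul (n := n) h0 isOpen_ball.uniqueDiffOn
    (hf.contDiffOn isOpen_ball) c (fun z hz => by
      rw [mem_ball_zero_iff] at hz ⊢
      rw [norm_mul]
      exact (mul_le_of_le_one_left (norm_nonneg z) hc).trans_lt hz)
  rw [mul_zero, iteratedDerivWithin_of_isOpen isOpen_ball h0,
    iteratedDerivWithin_of_isOpen isOpen_ball h0, smul_eq_mul] at h
  rw [taylorCoeff, taylorCoeff, h, mul_div_assoc]

lemma norm_taylorCoeff_mul_pow_le {f : ℂ → ℂ} (hf : DifferentiableOn ℂ f (ball 0 1))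
    (hinj : InjOn f (ball 0 1)) (h0 : f 0 = 0) (h1 : deriv f 0 = 1) {r : ℝ} (hr : r ∈ Ioo (0 : ℝ) 1)
    (n : ℕ) : ‖taylorCoeff f (n + 1)‖ * r ^ n ≤ n + 1 := by
  have hr0 : (r : ℂ) ≠ 0 := ofReal_ne_zero.2 hr.1.ne'
  have hmap : MapsTo (fun z : ℂ => (r : ℂ) * z) (ball 0 r⁻¹) (ball 0 1) := by
    intro z hz
    rw [mem_ball_zero_iff] at hz ⊢
    rw [norm_mul, Complex.norm_real, Real.norm_of_nonneg hr.1.le]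
    calc r * ‖z‖ < r * r⁻¹ := by gcongr; exact hr.1
      _ = 1 := mul_inv_cancel₀ hr.1.ne'
  have hder : HasDerivAt (fun z : ℂ => (r : ℂ)⁻¹ * f ((r : ℂ) * z))
      ((r : ℂ)⁻¹ * (1 * ((r : ℂ) * 1))) 0 := by
    have h2 : HasDerivAt f 1 ((r : ℂ) * 0) := by
      rw [mul_zero, ← h1]
      exact (hf.differentiableAt (ball_mem_nhds _ one_pos)).hasDerivAt
    exact (HasDerivAt.comp (h₂ := f) (h := fun z : ℂ => (r : ℂ) * z) 0 h2
      ((hasDerivAt_id (0 : ℂ)).const_mul (r : ℂ))).const_mul _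
  have h := norm_taylorCoeff_le_of_injOn (f := fun z => (r : ℂ)⁻¹ * f ((r : ℂ) * z))
    ((one_lt_inv₀ hr.1).2 hr.2) ((hf.comp (by fun_prop) hmap).const_mul _)
    (fun z hz w hw h => mul_left_cancel₀ hr0
      (hinj (hmap hz) (hmap hw) (mul_left_cancel₀ (inv_ne_zero hr0) h)))
    (by simp [h0]) (by rw [hder.deriv]; field_simp) n
  rw [taylorCoeff_const_mul, taylorCoeff_comp_const_mul hf (by
    rw [Complex.norm_real, Real.norm_of_nonneg hr.1.le]; exact hr.2.le), pow_succ] at h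
  have e : (r : ℂ)⁻¹ * ((r : ℂ) ^ n * (r : ℂ) * taylorCoeff f (n + 1)) =
      taylorCoeff f (n + 1) * (r : ℂ) ^ n := by field_simp
  rwa [e, norm_mul, norm_pow, Complex.norm_real, Real.norm_of_nonneg hr.1.le] at h

end DeBranges

/-- de Branges's theorem (the Bieberbach conjecture): if `f` is holomorphic
and injective on the open unit disc with `f 0 = 0` and `f' 0 = 1`, then
the `n`-th Taylor coefficient `bₙ = f⁽ⁿ⁾(0)/n!` satisfies `|bₙ| ≤ n` for
every `n ≥ 2`. -/
theorem deBranges (f : ℂ → ℂ)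
    (hdiff : DifferentiableOn ℂ f (Metric.ball 0 1))
    (hinj : Set.InjOn f (Metric.ball 0 1))
    (h0 : f 0 = 0) (h1 : deriv f 0 = 1) :
    ∀ n : ℕ, 2 ≤ n → ‖iteratedDeriv n f 0 / (n.factorial : ℂ)‖ ≤ n := by
  intro n hn
  obtain ⟨k, rfl⟩ : ∃ k, n = k + 1 := ⟨n - 1, by omega⟩
  have hc : Continuous fun r : ℝ => ‖DeBranges.taylorCoeff f (k + 1)‖ * r ^ k := by fun_prop
  have ht := (hc.tendsto 1).mono_left (nhdsWithin_le_nhds (s := Set.Iio 1))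
  rw [one_pow, mul_one] at ht
  have hle := le_of_tendsto ht (by
    filter_upwards [Ioo_mem_nhdsLT (zero_lt_one' ℝ)] with r hr
    exact DeBranges.norm_taylorCoeff_mul_pow_le hdiff hinj h0 h1 hr k)
  exact_mod_cast hle
end

section
/- Let f : ℂ → ℂ be holomorphic and injective on the open unit disc 𝔻 = {z ∈ ℂ : |z| < 1}, with f(0) = 0 and f'(0) = 1, and suppose that every Taylor coefficient bₙ = f⁽ⁿ⁾(0)/n! of f at 0 is a real number. Then |bₙ| ≤ n for every integer n ≥ 2. -/
open Complex Metric MeasureTheory intervalIntegral Filter Topology ComplexConjugate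

/-- The classical estimate `|sin (n θ)| ≤ n |sin θ|`. -/
lemma abs_sin_nat_mul_le (n : ℕ) (θ : ℝ) : |Real.sin (n * θ)| ≤ n * |Real.sin θ| := by
  induction n with
  | zero => simp
  | succ k ih =>
    push_cast
    rw [add_mul, one_mul, Real.sin_add, add_mul, one_mul]
    refine (abs_add_le _ _).trans (add_le_add ?_ ?_)
    · rw [abs_mul]
      exact (mul_le_of_le_one_right (abs_nonneg _) (Real.abs_cos_le_one θ)).trans ih
    · rw [abs_mul]
      exact mul_le_of_le_one_left (abs_nonneg _) (Real.abs_cos_le_one _)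

/-- A holomorphic function on the unit disc with real Taylor coefficients commutes with complex
conjugation. -/
lemma map_conj_of_taylor_coeff_im_eq_zero {f : ℂ → ℂ} (hf : DifferentiableOn ℂ f (ball 0 1))
    (hreal : ∀ n : ℕ, (iteratedDeriv n f 0 / (n.factorial : ℂ)).im = 0) {z : ℂ}
    (hz : z ∈ ball (0 : ℂ) 1) : f (conj z) = conj (f z) := by
  have hz' : conj z ∈ ball (0 : ℂ) 1 := by simpa using hz
  have h := (hasSum_taylorSeries_on_ball hf hz).map (starRingEnd ℂ) continuous_conj
  refine (hasSum_taylorSeries_on_ball hf hz').unique (h.congr_fun ?_)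
  intro n
  have hn := conj_eq_iff_im.2 (hreal n)
  simp only [map_div₀, map_natCast] at hn
  simp only [Function.comp_apply, smul_eq_mul, map_mul, map_inv₀, map_natCast, map_pow,
    sub_zero]
  linear_combination (-(conj z) ^ n) * hn

/-- A function vanishing at `0` with derivative `1` there has positive imaginary part somewhere on
the upper half of the unit disc. -/
lemma exists_im_pos_of_deriv_eq_one {f : ℂ → ℂ} (hf : HasDerivAt f 1 0) (h0 : f 0 = 0) :
    ∃ z ∈ ball (0 : ℂ) 1, 0 < z.im ∧ 0 < (f z).im := by
  have hline : HasDerivAt (fun t : ℝ => (t : ℂ) * I) I 0 := by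
    simpa using (ofRealCLM.hasDerivAt (x := (0 : ℝ))).mul_const I
  have hg : HasDerivAt (fun t : ℝ => f (t * I)) I 0 := by
    have hf' : HasDerivAt f 1 (((0 : ℝ) : ℂ) * I) := by simpa using hf
    simpa only [one_mul] using! hf'.comp (0 : ℝ) hline
  have hlim := (continuous_im.tendsto _).comp hg.tendsto_slope_zero_right
  have hpos := hlim.eventually (lt_mem_nhds (show (0 : ℝ) < I.im by simp))
  have hlt : ∀ᶠ t : ℝ in 𝓝[>] 0, t < 1 := nhdsWithin_le_nhds (gt_mem_nhds one_pos)
  obtain ⟨t, ⟨ht, ht1⟩, ht0⟩ := ((hpos.and hlt).and self_mem_nhdsWithin).exists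
  have ht0 : 0 < t := ht0
  refine ⟨t * I, by simpa [abs_of_pos ht0] using ht1, by simpa using ht0, ?_⟩
  have : 0 < t⁻¹ * (f (t * I)).im := by simpa [h0] using ht
  exact pos_of_mul_pos_right this (inv_pos.2 ht0).le

/-- A schlicht function with real Taylor coefficients is typically real: it preserves the sign of
the imaginary part. -/
lemma im_mul_im_nonneg_of_schlicht {f : ℂ → ℂ} (hf : DifferentiableOn ℂ f (ball 0 1))
    (hinj : Set.InjOn f (ball 0 1)) (h0 : f 0 = 0) (h1 : deriv f 0 = 1)
    (hconj : ∀ z ∈ ball (0 : ℂ) 1, f (conj z) = conj (f z)) {z : ℂ} (hz : z ∈ ball (0 : ℂ) 1) :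
    0 ≤ (f z).im * z.im := by
  have hne : ∀ w ∈ ball (0 : ℂ) 1, 0 < w.im → (f w).im ≠ 0 := by
    intro w hw hw0 him
    have hw' : conj w ∈ ball (0 : ℂ) 1 := by simpa using hw
    have := hinj hw' hw ((hconj w hw).trans (conj_eq_iff_im.2 him))
    exact hw0.ne' (conj_eq_iff_im.1 this)
  have hderiv : HasDerivAt f 1 0 :=
    h1 ▸ (hf.differentiableAt (ball_mem_nhds 0 one_pos)).hasDerivAt
  obtain ⟨w, hw, hw0, hfw⟩ := exists_im_pos_of_deriv_eq_one hderiv h0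
  have hconn : IsPreconnected (ball (0 : ℂ) 1 ∩ {z | 0 < z.im}) :=
    ((convex_ball 0 1).inter (convex_halfSpace_im_gt 0)).isPreconnected
  have hcont : ContinuousOn (fun z => (f z).im) (ball (0 : ℂ) 1 ∩ {z | 0 < z.im}) :=
    continuous_im.comp_continuousOn (hf.continuousOn.mono Set.inter_subset_left)
  have hpos : ∀ u ∈ ball (0 : ℂ) 1, 0 < u.im → 0 < (f u).im := by
    intro u hu hu0
    by_contra! hle
    obtain ⟨v, ⟨hv, hv0⟩, hfv⟩ :=
      hconn.intermediate_value ⟨hu, hu0⟩ ⟨hw, hw0⟩ hcont ⟨hle, hfw.le⟩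
    exact hne v hv hv0 hfv
  rcases lt_trichotomy z.im 0 with h | h | h
  · have hz' : conj z ∈ ball (0 : ℂ) 1 := by simpa using hz
    have := hpos (conj z) hz' (by simpa using h)
    rw [hconj z hz, conj_im] at this
    exact mul_nonneg_of_nonpos_of_nonpos (by linarith) h.le
  · simp [h]
  · exact mul_nonneg (hpos z hz h).le h.le

/-- The sine Fourier coefficients of the imaginary part of a holomorphic function on a circle
recover the real parts of its Taylor coefficients. -/
lemma integral_im_mul_sin_eq {f : ℂ → ℂ} {r : ℝ} (hr : 0 < r)
    (hf : DifferentiableOn ℂ f (closedBall 0 r)) {n : ℕ} (hn : n ≠ 0) :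
    ∫ θ in (0 : ℝ)..2 * Real.pi, (f (circleMap 0 r θ)).im * Real.sin (n * θ) =
      Real.pi * r ^ n * (iteratedDeriv n f 0 / (n.factorial : ℂ)).re := by
  have hfc : Continuous fun θ : ℝ => f (circleMap 0 r θ) :=
    hf.continuousOn.comp_continuous (continuous_circleMap 0 r)
      fun θ => circleMap_mem_closedBall 0 hr.le θ
  have hr0 : (r : ℂ) ≠ 0 := ofReal_ne_zero.2 hr.ne'
  have hz0 : ∀ θ : ℝ, circleMap 0 r θ ≠ 0 := fun θ => circleMap_ne_center hr.ne'
  have hcauchy := hf.circleIntegral_one_div_sub_center_pow_smul hr n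
  have hzero : ∮ z in C(0, r), z ^ (n - 1) * f z = 0 := by
    refine DiffContOnCl.circleIntegral_eq_zero hr.le (DifferentiableOn.diffContOnCl ?_)
    rw [closure_ball 0 hr.ne']
    fun_prop
  simp only [circleIntegral, deriv_circleMap, smul_eq_mul, sub_zero] at hcauchy hzero
  have hpoint : ∀ θ : ℝ, f (circleMap 0 r θ) * (Real.sin (n * θ) : ℂ) =
      (r : ℂ) ^ n / 2 *
        (circleMap 0 r θ * I * (1 / circleMap 0 r θ ^ (n + 1) * f (circleMap 0 r θ))) -
      1 / (2 * (r : ℂ) ^ n) *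
        (circleMap 0 r θ * I * (circleMap 0 r θ ^ (n - 1) * f (circleMap 0 r θ))) := by
    intro θ
    have h1 : circleMap 0 r θ * (1 / circleMap 0 r θ ^ (n + 1)) =
        cexp (-(n * θ * I)) / (r : ℂ) ^ n := by
      have := hz0 θ
      rw [pow_succ, exp_neg]
      field_simp
      rw [circleMap_zero, mul_pow, ← exp_nat_mul]
      ring_nf
    have h2 : circleMap 0 r θ * circleMap 0 r θ ^ (n - 1) =
        (r : ℂ) ^ n * cexp (n * θ * I) := by
      rw [mul_pow_sub_one hn, circleMap_zero, mul_pow, ← exp_nat_mul]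
      ring_nf
    have h3 : (Real.sin (n * θ) : ℂ) = (cexp (-(n * θ * I)) - cexp (n * θ * I)) * I / 2 := by
      rw [ofReal_sin, Complex.sin]
      push_cast
      ring_nf
    rw [h3]
    calc _ = (r : ℂ) ^ n / 2 * (I * (cexp (-(n * θ * I)) / (r : ℂ) ^ n) * f (circleMap 0 r θ)) -
          1 / (2 * (r : ℂ) ^ n) *
            (I * ((r : ℂ) ^ n * cexp (n * θ * I)) * f (circleMap 0 r θ)) := by
          field_simp
      _ = _ := by rw [← h1, ← h2]; ring
  have hcomplex : ∫ θ in (0 : ℝ)..2 * Real.pi,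
      f (circleMap 0 r θ) * (Real.sin (n * θ) : ℂ) =
      Real.pi * r ^ n * (iteratedDeriv n f 0 / (n.factorial : ℂ)) * I := by
    simp_rw [hpoint]
    rw [intervalIntegral.integral_sub, intervalIntegral.integral_const_mul,
      intervalIntegral.integral_const_mul, hcauchy, hzero]
    · ring
    · refine Continuous.intervalIntegrable ?_ _ _
      have hinv : Continuous fun θ : ℝ => 1 / circleMap 0 r θ ^ (n + 1) :=
        continuous_const.div ((continuous_circleMap 0 r).pow _) fun θ => pow_ne_zero _ (hz0 θ)
      exact continuous_const.mul
        (((continuous_circleMap 0 r).mul continuous_const).mul (hinv.mul hfc))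
    · refine Continuous.intervalIntegrable ?_ _ _
      exact continuous_const.mul (((continuous_circleMap 0 r).mul continuous_const).mul
        (((continuous_circleMap 0 r).pow _).mul hfc))
  have him := imCLM.intervalIntegral_comp_comm (μ := volume) (a := 0) (b := 2 * Real.pi)
    (Continuous.intervalIntegrable (u := fun θ : ℝ =>
      f (circleMap 0 r θ) * (Real.sin (n * θ) : ℂ)) (hfc.mul (by fun_prop)) _ _)
  rw [hcomplex] at him
  simp only [imCLM_apply, im_mul_ofReal, mul_I_im] at him
  rw [him, ← ofReal_pow, ← ofReal_mul, re_ofReal_mul]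

/-- Coefficient bound on a circle of radius `r` for a typically real function. -/
lemma abs_re_coeff_mul_pow_le {f : ℂ → ℂ} {r : ℝ} (hr : 0 < r)
    (hf : DifferentiableOn ℂ f (closedBall 0 r)) (h1 : deriv f 0 = 1)
    (hpos : ∀ z ∈ closedBall (0 : ℂ) r, 0 ≤ (f z).im * z.im) {n : ℕ} (hn : n ≠ 0) :
    |(iteratedDeriv n f 0 / (n.factorial : ℂ)).re| * r ^ n ≤ n * r := by
  have hfc : Continuous fun θ : ℝ => f (circleMap 0 r θ) :=
    hf.continuousOn.comp_continuous (continuous_circleMap 0 r)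
      fun θ => circleMap_mem_closedBall 0 hr.le θ
  have hfirst := integral_im_mul_sin_eq hr hf one_ne_zero
  simp only [iteratedDeriv_one, h1, Nat.cast_one, one_mul, pow_one, Nat.factorial_one, div_one,
    one_re, mul_one] at hfirst
  have hbound : ∀ θ : ℝ, |(f (circleMap 0 r θ)).im * Real.sin (n * θ)| ≤
      n * ((f (circleMap 0 r θ)).im * Real.sin θ) := by
    intro θ
    have him : (circleMap 0 r θ).im = r * Real.sin θ := by
      simp [circleMap_zero, exp_ofReal_mul_I_im]
    have hsign := hpos _ (circleMap_mem_closedBall 0 hr.le θ)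
    rw [him] at hsign
    have hsign' : 0 ≤ (f (circleMap 0 r θ)).im * Real.sin θ :=
      nonneg_of_mul_nonneg_right (by linarith : 0 ≤ r * ((f (circleMap 0 r θ)).im * Real.sin θ)) hr
    rw [← abs_of_nonneg hsign', abs_mul, abs_mul]
    calc _ ≤ |(f (circleMap 0 r θ)).im| * (n * |Real.sin θ|) :=
          mul_le_mul_of_nonneg_left (abs_sin_nat_mul_le n θ) (abs_nonneg _)
      _ = _ := by ring
  have hint := intervalIntegral.norm_integral_le_of_norm_le
    (f := fun θ : ℝ => (f (circleMap 0 r θ)).im * Real.sin (n * θ)) (μ := volume)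
    Real.two_pi_pos.le (ae_of_all _ fun θ _ => hbound θ)
    (Continuous.intervalIntegrable (continuous_const.mul
      ((continuous_im.comp hfc).mul Real.continuous_sin)) _ _)
  rw [integral_im_mul_sin_eq hr hf hn, intervalIntegral.integral_const_mul, hfirst,
    Real.norm_eq_abs, abs_mul, abs_of_pos (by positivity)] at hint
  refine le_of_mul_le_mul_left ?_ Real.pi_pos
  linarith

/-- The Bieberbach conjecture for schlicht functions with real Taylor
coefficients (Dieudonné, Rogosinski, Szász): if `f` is holomorphic and
injective on the open unit disc with `f 0 = 0`, `f' 0 = 1`, and all Taylor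
coefficients `bₙ = f⁽ⁿ⁾(0)/n!` real, then `|bₙ| ≤ n` for every `n ≥ 2`. -/
theorem bieberbach_real_coeffs (f : ℂ → ℂ)
    (hdiff : DifferentiableOn ℂ f (Metric.ball 0 1))
    (hinj : Set.InjOn f (Metric.ball 0 1))
    (h0 : f 0 = 0) (h1 : deriv f 0 = 1)
    (hreal : ∀ n : ℕ, (iteratedDeriv n f 0 / (n.factorial : ℂ)).im = 0) :
    ∀ n : ℕ, 2 ≤ n → ‖iteratedDeriv n f 0 / (n.factorial : ℂ)‖ ≤ n := by
  intro n hn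
  have hn0 : n ≠ 0 := by omega
  have hconj : ∀ z ∈ ball (0 : ℂ) 1, f (conj z) = conj (f z) := fun z hz =>
    map_conj_of_taylor_coeff_im_eq_zero hdiff hreal hz
  rw [← abs_re_eq_norm.2 (hreal n)]
  have hlim : Tendsto
      (fun r : ℝ => |(iteratedDeriv n f 0 / (n.factorial : ℂ)).re| * r ^ n) (𝓝[<] 1)
      (𝓝 |(iteratedDeriv n f 0 / (n.factorial : ℂ)).re|) :=
    (Continuous.tendsto' (by fun_prop) _ _ (by simp)).mono_left nhdsWithin_le_nhds
  have hlim' : Tendsto (fun r : ℝ => (n : ℝ) * r) (𝓝[<] 1) (𝓝 n) :=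
    (Continuous.tendsto' (by fun_prop) _ _ (by simp)).mono_left nhdsWithin_le_nhds
  refine le_of_tendsto_of_tendsto hlim hlim' ?_
  filter_upwards [Ioo_mem_nhdsLT one_pos] with r hr
  have hsub : closedBall (0 : ℂ) r ⊆ ball 0 1 := closedBall_subset_ball hr.2
  exact abs_re_coeff_mul_pow_le hr.1 (hdiff.mono hsub) h1
    (fun z hz => im_mul_im_nonneg_of_schlicht hdiff hinj h0 h1 hconj (hsub hz)) hn0
end
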